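/- Let K be a number field, let n ≤ 5, let E be a finite étale commutative K-algebra of K-dimension n, and let σ be a K-linear algebra involution of E with dim_K E^σ = ⌊(n+1)/2⌋. Let f be a nondegenerate symmetric K-bilinear form on V = K^n. Assume that for every place v of K (finite or archimedean), with completion K_v, there exists an injective K_v-algebra homomorphism ι_v : E ⊗_K K_v → End_{K_v}(K_v^n) such that f_v(ι_v(a)x, y) = f_v(x, ι_v((σ ⊗ id)(a))y) for all a ∈ E ⊗_K K_v and x, y ∈ K_v^n, where f_v is the base change of f to K_v. Then there exists an injective K-algebra homomorphism ι : E → End_K(V) such that f(ι(a)x, y) = f(x, ι(σ(a))y) for all a ∈ E and x, y ∈ V. -/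

import Mathlib

universe u

/-- Given a field `K`, a commutative `K`-algebra `E` with a `K`-algebra involution `σ`, and a
symmetric matrix `M` (the Gram matrix of a symmetric bilinear form `f` on `K^n`), the predicate
stating that over a field extension `Kv` of `K` there exists an injective `Kv`-algebra
homomorphism `ι : E ⊗[K] Kv → End_{Kv} (Kv^n)` compatible with `σ ⊗ id` and the base change
`f_v` of `f`, i.e. `f_v (ι a x, y) = f_v (x, ι ((σ ⊗ id) a) y)` for all `a, x, y`. -/
def CompatibleLocalEmbedding (K : Type*) [Field K] (E : Type*) [CommRing E] [Algebra K E]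
    (σ : E →ₐ[K] E) (n : ℕ) (M : Matrix (Fin n) (Fin n) K)
    (Kv : Type*) [Field Kv] [Algebra K Kv] : Prop :=
  ∃ ι : TensorProduct K Kv E →ₐ[Kv] Module.End Kv (Fin n → Kv),
    Function.Injective ι ∧
      ∀ (a : TensorProduct K Kv E) (x y : Fin n → Kv),
        dotProduct (ι a x) ((M.map (algebraMap K Kv)).mulVec y) =
          dotProduct x ((M.map (algebraMap K Kv)).mulVec
            (ι (Algebra.TensorProduct.map (AlgHom.id K Kv) σ a) y))

set_option linter.all false

namespace QC
section local1
variable {K : Type*} [Field K]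

/-- local squares -/
def Sq (v : AbsoluteValue K ℝ) (x : K) : Prop := ∀ ε > 0, ∃ y, v (x - y ^ 2) < ε

theorem Sq.sq (v : AbsoluteValue K ℝ) (y : K) : Sq v (y ^ 2) := fun ε h => ⟨y, by simpa using h⟩

theorem sq_near [CharZero K] (v : AbsoluteValue K ℝ) : ∃ ε > 0, ∀ x, v (x - 1) < ε → Sq v x := by
  have hc : 0 < v 2 := v.pos (by norm_num)
  set c := v 2
  obtain ⟨δ, hδ, h1, h2⟩ : ∃ δ > 0, δ ≤ c / 8 ∧ δ ≤ c ^ 2 / 8 :=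
    ⟨min (c / 8) (c ^ 2 / 8), by positivity, min_le_left _ _, min_le_right _ _⟩
  refine ⟨δ, hδ, fun x hx => ?_⟩
  have key : ∀ n : ℕ, ∃ y, v (x - y ^ 2) ≤ δ * (1 / 2) ^ n ∧
      v (y - 1) ≤ 1 / 2 - (1 / 2) ^ (n + 1) := by
    intro n
    induction n with
    | zero => exact ⟨1, by simpa using hx.le, by norm_num⟩
    | succ n ih =>
      obtain ⟨y, hy1, hy2⟩ := ih
      have hp : (0 : ℝ) < (1 / 2) ^ n := by positivity
      have hp1 : ((1 / 2) ^ n : ℝ) ≤ 1 := pow_le_one₀ (by norm_num) (by norm_num)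
      rw [pow_succ] at hy2
      have hy : 1 / 2 ≤ v y := by
        have := v.add_le (y) (1 - y)
        rw [v.map_sub 1 y] at this
        simp at this
        linarith
      have hy0 : y ≠ 0 := by rintro rfl; norm_num at hy
      have h20 : (2 : K) ≠ 0 := by norm_num
      set d := (x - y ^ 2) / (2 * y)
      have hd : v d ≤ 2 * δ * (1 / 2) ^ n / c := by
        rw [map_div₀, map_mul, div_le_div_iff₀ (by positivity) hc]
        have : 0 ≤ v (x - y ^ 2) := v.nonneg _
        change _ * c ≤ _ * (c * _)
        nlinarith [mul_le_mul_of_nonneg_right hy1 hc.le, mul_le_mul_of_nonneg_left hy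
          (by positivity : 0 ≤ 2 * δ * (1 / 2) ^ n * c)]
      refine ⟨y + d, ?_, ?_⟩
      · have : x - (y + d) ^ 2 = - d ^ 2 := by simp only [d]; field_simp; ring
        rw [this, v.map_neg, map_pow]
        calc v d ^ 2 ≤ (2 * δ * (1 / 2) ^ n / c) ^ 2 := by gcongr
          _ = δ * (1 / 2) ^ n * ((1 / 2) ^ n * (4 * δ / c ^ 2)) := by field_simp; ring
          _ ≤ δ * (1 / 2) ^ n * (1 * (1 / 2)) := by
            have : 4 * δ / c ^ 2 ≤ 1 / 2 := by rw [div_le_iff₀ (by positivity)]; linarith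
            exact mul_le_mul_of_nonneg_left (mul_le_mul hp1 this (by positivity) (by norm_num))
              (by positivity)
          _ = _ := by rw [pow_succ]; ring
      · have e : y + d - 1 = (y - 1) + d := by ring
        have : 2 * δ * (1 / 2) ^ n / c ≤ (1 / 2) ^ n * (1 / 4) := by
          rw [div_le_iff₀ hc]; nlinarith
        rw [e]
        refine (v.add_le _ _).trans ?_
        rw [pow_succ, pow_succ]
        linarith
  intro ε hε
  obtain ⟨n, hn⟩ := exists_pow_lt_of_lt_one (div_pos hε hδ) (by norm_num : (1 / 2 : ℝ) < 1)
  obtain ⟨y, hy, -⟩ := key n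
  refine ⟨y, hy.trans_lt ?_⟩
  rw [lt_div_iff₀ hδ] at hn
  linarith

theorem Sq.mul {v : AbsoluteValue K ℝ} {x y : K} (hx : Sq v x) (hy : Sq v y) : Sq v (x * y) := by
  intro ε hε
  have h1 := v.nonneg x
  obtain ⟨b, hb⟩ := hy (ε / (2 * (v x + 1))) (by positivity)
  have h2 := v.nonneg b
  obtain ⟨a, ha⟩ := hx (ε / (2 * (v b ^ 2 + 1))) (by positivity)
  refine ⟨a * b, ?_⟩
  have e : x * y - (a * b) ^ 2 = x * (y - b ^ 2) + b ^ 2 * (x - a ^ 2) := by ring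
  rw [e]
  refine (v.add_le _ _).trans_lt ?_
  rw [map_mul, map_mul, map_pow]
  rw [lt_div_iff₀ (by positivity)] at ha hb
  nlinarith [v.nonneg (y - b ^ 2), v.nonneg (x - a ^ 2)]

theorem Sq.inv {v : AbsoluteValue K ℝ} {x : K} (hx : Sq v x) : Sq v x⁻¹ := by
  by_cases h : x = 0
  · simpa [h] using Sq.sq v 0
  · have := hx.mul (Sq.sq v x⁻¹)
    convert this using 1; field_simp

theorem Sq.near [CharZero K] (v : AbsoluteValue K ℝ) {x : K} (hx : x ≠ 0) :
    ∃ ε > 0, ∀ y, v (y - x) < ε → y ≠ 0 ∧ Sq v (x * y) := by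
  obtain ⟨ε, hε, h⟩ := sq_near v
  have hvx := v.pos hx
  refine ⟨min (ε * v x) (v x), by positivity, fun y hy => ⟨?_, ?_⟩⟩
  · rintro rfl
    simp at hy
  · have := (h (y / x) ?_).mul (Sq.sq v x)
    · convert this using 1; field_simp
    · have e : y / x - 1 = (y - x) / x := by field_simp
      rw [e, map_div₀, div_lt_iff₀ hvx]
      exact hy.trans_le (min_le_left _ _)

theorem Sq.of_equiv {L : Type*} [Field L] [Algebra K L] {v : AbsoluteValue K ℝ}
    {w : AbsoluteValue L ℝ} {t : ℝ} (ht : 0 < t) (h : ∀ x, v x ^ t = w (algebraMap K L x)) {x : K}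
    (hx : Sq v x) : Sq w (algebraMap K L x) := by
  intro ε hε
  obtain ⟨y, hy⟩ := hx (ε ^ t⁻¹) (by positivity)
  refine ⟨algebraMap K L y, ?_⟩
  rw [← map_pow, ← map_sub, ← h]
  calc _ < (ε ^ t⁻¹) ^ t := Real.rpow_lt_rpow (v.nonneg _) hy ht
    _ = ε := by rw [← Real.rpow_mul hε.le, inv_mul_cancel₀ ht.ne', Real.rpow_one]

/-- the subgroup of local squares -/
def SqG (v : AbsoluteValue K ℝ) : Subgroup Kˣ where
  carrier := {x | Sq v (x : K)}
  mul_mem' := fun {a b} ha hb => by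
    show Sq v ((a * b : Kˣ) : K)
    rw [Units.val_mul]; exact Sq.mul ha hb
  one_mem' := by simpa using Sq.sq v (1 : K)
  inv_mem' := fun {a} ha => by
    show Sq v ((a⁻¹ : Kˣ) : K)
    rw [Units.val_inv_eq_inv_val]; exact Sq.inv ha

theorem mem_SqG {v : AbsoluteValue K ℝ} {x : Kˣ} : x ∈ SqG v ↔ Sq v (x : K) := Iff.rfl

theorem sq_mem_SqG (v : AbsoluteValue K ℝ) (x : Kˣ) : x ^ 2 ∈ SqG v := by
  rw [mem_SqG, Units.val_pow_eq_pow_val]; exact Sq.sq v _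

/-- global norms from `K(√a)` -/
def Nm (a : K) : Subgroup Kˣ where
  carrier := {b | ∃ x y : K, (b : K) = x ^ 2 - a * y ^ 2}
  mul_mem' := by
    rintro b c ⟨x, y, h⟩ ⟨z, w, h'⟩
    exact ⟨x * z + a * y * w, x * w + y * z, by rw [Units.val_mul, h, h']; ring⟩
  one_mem' := ⟨1, 0, by simp⟩
  inv_mem' := by
    rintro b ⟨x, y, h⟩
    have hb := b.ne_zero
    refine ⟨x / b, y / b, ?_⟩
    rw [Units.val_inv_eq_inv_val]
    field_simp
    exact h

theorem mem_Nm {a : K} {b : Kˣ} : b ∈ Nm a ↔ ∃ x y : K, (b : K) = x ^ 2 - a * y ^ 2 := Iff.rfl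

theorem sq_mem_Nm (a : K) (x : Kˣ) : x ^ 2 ∈ Nm a := ⟨x, 0, by simp⟩

/-- local norms -/
def NV (v : AbsoluteValue K ℝ) (a : K) : Subgroup Kˣ := Nm a ⊔ SqG v

theorem mem_NV {v : AbsoluteValue K ℝ} {a : K} {b : Kˣ} :
    b ∈ NV v a ↔ ∃ n ∈ Nm a, ∃ s ∈ SqG v, n * s = b := Subgroup.mem_sup

theorem NV_eq_top [CharZero K] {v : AbsoluteValue K ℝ} {a : K} (ha0 : a ≠ 0) (ha : Sq v a) :
    NV v a = ⊤ := by
  rw [eq_top_iff]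
  intro c _
  obtain ⟨C, hC⟩ : ∃ C : K, C = c := ⟨_, rfl⟩
  have hc0 : C ≠ 0 := hC ▸ c.ne_zero
  obtain ⟨ε, hε, h⟩ := Sq.near v hc0
  obtain ⟨ε1, hε1, h1⟩ := Sq.near v ha0
  have hva := v.pos ha0
  set k := v ((C - 1) / 2) ^ 2 with hk
  have hk0 : 0 ≤ k := by positivity
  obtain ⟨y, hy⟩ := ha (min (min ε1 (v a / 2)) (ε * (v a / 2) / (k + 1))) (by positivity)
  have hy1 : v (a - y ^ 2) < ε1 := hy.trans_le ((min_le_left _ _).trans (min_le_left _ _))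
  have hy2 : v (a - y ^ 2) < v a / 2 := hy.trans_le ((min_le_left _ _).trans (min_le_right _ _))
  have hy3 := hy.trans_le (min_le_right _ _)
  have hy0 : y ≠ 0 := by
    rintro rfl
    have := (h1 (0 ^ 2) (by rwa [v.map_sub])).1
    simp at this
  have hyy : v a / 2 ≤ v y ^ 2 := by
    have := v.add_le (a - y ^ 2) (y ^ 2)
    rw [sub_add_cancel, map_pow] at this
    linarith
  have hvy : 0 < v y := v.pos hy0
  obtain ⟨hne, hs⟩ := h (((C + 1) / 2) ^ 2 - a * ((C - 1) / 2 / y) ^ 2) (by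
    have e : ((C + 1) / 2) ^ 2 - a * ((C - 1) / 2 / y) ^ 2 - C
      = - ((a - y ^ 2) * (((C - 1) / 2) ^ 2 / y ^ 2)) := by field_simp; ring
    rw [e, v.map_neg, map_mul, map_div₀, map_pow, map_pow, ← hk]
    rw [lt_div_iff₀ (by positivity)] at hy3
    rw [← mul_div_assoc, div_lt_iff₀ (by positivity)]
    have : 0 ≤ v (a - y ^ 2) := v.nonneg _
    nlinarith)
  rw [mem_NV]
  refine ⟨Units.mk0 _ hne, ⟨_, _, rfl⟩, (Units.mk0 _ hne)⁻¹ * c, ?_, by simp⟩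
  rw [mem_SqG]
  simp only [Units.val_mul, Units.val_inv_eq_inv_val, Units.val_mk0, ← hC]
  have := hs.mul (Sq.sq v (((C + 1) / 2) ^ 2 - a * ((C - 1) / 2 / y) ^ 2)⁻¹)
  convert this using 1
  field_simp

theorem weak_approx [CharZero K] {ι : Type*} [Finite ι] {v : ι → AbsoluteValue K ℝ}
    (h : ∀ i, (v i).IsNontrivial) (hv : Pairwise fun i j ↦ ¬(v i).IsEquiv (v j))
    (x : ι → K) (ε : ι → ℝ) (hε : ∀ i, 0 < ε i) : ∃ y : K, ∀ i, v i (y - x i) < ε i := by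
  cases nonempty_fintype ι
  by_cases hι : Nonempty ι
  swap
  · exact ⟨0, fun i => (hι ⟨i⟩).elim⟩
  obtain ⟨i0, hi0⟩ := Finite.exists_min ε
  obtain ⟨y, hy⟩ := (Metric.denseRange_iff.mp (AbsoluteValue.denseRange_algebraMap_pi h hv))
    (fun i => (WithAbs.equiv (v i)).symm (x i)) (ε i0) (hε i0)
  refine ⟨y, fun i => lt_of_lt_of_le ?_ (hi0 i)⟩
  have := (dist_pi_lt_iff (hε i0)).mp hy i
  rw [dist_comm, dist_eq_norm] at this
  exact this

theorem weak_approx_unit [CharZero K] {ι : Type*} [Finite ι] {v : ι → AbsoluteValue K ℝ}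
    (h : ∀ i, (v i).IsNontrivial) (hv : Pairwise fun i j ↦ ¬(v i).IsEquiv (v j))
    (x : ι → Kˣ) : ∃ y : Kˣ, ∀ i, x i * y ∈ SqG (v i) := by
  by_cases hι : Nonempty ι
  swap
  · exact ⟨1, fun i => (hι ⟨i⟩).elim⟩
  choose ε hε hh using fun i => Sq.near (v i) (x i).ne_zero
  obtain ⟨y, hy⟩ := weak_approx h hv (fun i => (x i : K)) ε hε
  have i0 := hι.some
  refine ⟨Units.mk0 y (hh i0 y (hy i0)).1, fun i => ?_⟩
  rw [mem_SqG]
  exact (hh i y (hy i)).2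

end local1
end QC

namespace QC
section local2
open NumberField IsDedekindDomain
variable {K : Type*} [Field K] [NumberField K]

/-- the absolute value of a prime -/
noncomputable abbrev ab (p : HeightOneSpectrum (𝓞 K)) : AbsoluteValue K ℝ :=
  NumberField.HeightOneSpectrum.adicAbv K p

/-- the order at a prime -/
noncomputable def od (p : HeightOneSpectrum (𝓞 K)) (x : K) : ℤ := - WithZero.log (p.valuation K x)

/-- powers of the maximal ideal -/
def PW (p : HeightOneSpectrum (𝓞 K)) (n : ℤ) : AddSubgroup K where
  carrier := {x | p.valuation K x ≤ WithZero.exp (-n)}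
  add_mem' := fun {x y} ha hb => by
    show p.valuation K (x + y) ≤ _
    exact Valuation.map_add_le _ ha hb
  zero_mem' := by simp
  neg_mem' := fun {x} ha => by
    show p.valuation K (-x) ≤ _
    rw [Valuation.map_neg]; exact ha

variable (p : HeightOneSpectrum (𝓞 K))

theorem val_ne {x : K} (hx : x ≠ 0) : p.valuation K x ≠ 0 := by simpa using hx

theorem mem_PW' {n : ℤ} {x : K} : x ∈ PW p n ↔ p.valuation K x ≤ WithZero.exp (-n) := Iff.rfl

theorem mem_PW {n : ℤ} {x : K} (hx : x ≠ 0) : x ∈ PW p n ↔ n ≤ od p x := by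
  rw [mem_PW', ← WithZero.log_le_iff_le_exp (val_ne p hx), od]; omega

theorem PW_mono {m n : ℤ} (h : m ≤ n) {x : K} (hx : x ∈ PW p n) : x ∈ PW p m := by
  rw [mem_PW'] at *
  exact hx.trans (by rw [WithZero.exp_le_exp]; omega)

theorem od_mul {x y : K} (hx : x ≠ 0) (hy : y ≠ 0) : od p (x * y) = od p x + od p y := by
  rw [od, map_mul, WithZero.log_mul (val_ne p hx) (val_ne p hy), od, od]; ring

@[simp] theorem od_inv (x : K) : od p x⁻¹ = - od p x := by simp [od, WithZero.log_inv]

@[simp] theorem od_pow (x : K) (n : ℕ) : od p (x ^ n) = n * od p x := by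
  simp [od, WithZero.log_pow]

@[simp] theorem od_zpow (x : K) (n : ℤ) : od p (x ^ n) = n * od p x := by
  simp [od, WithZero.log_zpow]

@[simp] theorem od_one : od p (1 : K) = 0 := by simp [od]

@[simp] theorem od_neg (x : K) : od p (-x) = od p x := by simp [od, Valuation.map_neg]

theorem od_div {x y : K} (hx : x ≠ 0) (hy : y ≠ 0) : od p (x / y) = od p x - od p y := by
  rw [div_eq_mul_inv, od_mul p hx (inv_ne_zero hy), od_inv]; ring

theorem mul_PW {m n : ℤ} {x y : K} (hx : x ∈ PW p m) (hy : y ∈ PW p n) : x * y ∈ PW p (m + n) := by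
  rw [mem_PW'] at *
  rw [map_mul, neg_add, WithZero.exp_add]
  exact mul_le_mul' hx hy

theorem mul_PW' {m n k : ℤ} {x y : K} (hx : x ∈ PW p m) (hy : y ∈ PW p n) (h : k ≤ m + n) :
    x * y ∈ PW p k := PW_mono p h (mul_PW p hx hy)

theorem one_PW : (1 : K) ∈ PW p 0 := by simp [mem_PW']

theorem sq_PW {m k : ℤ} {x : K} (hx : x ∈ PW p m) (h : k ≤ 2 * m) : x ^ 2 ∈ PW p k := by
  rw [pow_two]; exact mul_PW' p hx hx (by omega)

theorem exists_unif : ∃ π : K, π ≠ 0 ∧ od p π = 1 := by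
  obtain ⟨π, h⟩ := p.valuation_exists_uniformizer K
  refine ⟨π, ?_, by simp [od, h]⟩
  rintro rfl
  rw [map_zero] at h
  exact WithZero.exp_ne_zero h.symm

theorem int_PW (r : 𝓞 K) : (r : K) ∈ PW p 0 := by
  rw [mem_PW']; simpa using p.valuation_le_one r

theorem int_mem_PW (r : 𝓞 K) (n : ℕ) : (r : K) ∈ PW p n ↔ r ∈ p.asIdeal ^ n := by
  rw [mem_PW', ← p.intValuation_le_pow_iff_mem, ← p.valuation_of_algebraMap (K := K)]

theorem near_int {x : K} (hx : x ∈ PW p 0) (n : ℤ) : ∃ r : 𝓞 K, x - r ∈ PW p n := by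
  obtain ⟨a, ha⟩ := p.exists_valuation_sub_lt_of_integer (K := K) (x := x) (by simpa [mem_PW'] using hx)
    (Units.mk0 (WithZero.exp (-n)) (by simp))
  refine ⟨a, ?_⟩
  rw [mem_PW', Valuation.map_sub_swap]
  exact ha.le

theorem od_add {x y : K} (hx : x ≠ 0) (hy : y ∈ PW p (od p x + 1)) :
    x + y ≠ 0 ∧ od p (x + y) = od p x := by
  have h : p.valuation K y < p.valuation K x := by
    rw [mem_PW'] at hy
    refine hy.trans_lt ?_
    rw [← WithZero.lt_log_iff_exp_lt (val_ne p hx), od]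
    omega
  have := Valuation.map_add_eq_of_lt_left (p.valuation K) h
  refine ⟨fun h0 => ?_, by rw [od, this, od]⟩
  rw [h0, map_zero] at this
  exact val_ne p hx this.symm

theorem od_add_ge {x y : K} (hx : x ≠ 0) (hy : y ≠ 0) (h : x + y ≠ 0) :
    min (od p x) (od p y) ≤ od p (x + y) := by
  rw [← mem_PW p h]
  exact add_mem ((mem_PW p hx).2 (min_le_left _ _)) ((mem_PW p hy).2 (min_le_right _ _))

theorem ab_le (n : ℤ) (x : K) :
    x ∈ PW p n ↔ ab p x ≤ ((Ideal.absNorm p.asIdeal : ℕ) : ℝ) ^ (-n) := by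
  have h1 := NumberField.HeightOneSpectrum.one_lt_absNorm_nnreal p
  have e : ((Ideal.absNorm p.asIdeal : ℕ) : ℝ) ^ (-n) =
    WithZeroMulInt.toNNReal (NumberField.HeightOneSpectrum.absNorm_ne_zero p)
      (WithZero.exp (-n)) := by
    rw [WithZeroMulInt.toNNReal_neg_apply _ WithZero.exp_ne_zero]
    rw [WithZero.toAdd_unzero_eq_log, WithZero.log_exp]
    push_cast; rfl
  rw [e, NumberField.HeightOneSpectrum.adicAbv_def, mem_PW', NNReal.coe_le_coe]
  exact (WithZeroMulInt.toNNReal_strictMono h1).le_iff_le.symm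

theorem sq_iff (x : K) : Sq (ab p) x ↔ ∀ n : ℤ, ∃ y, x - y ^ 2 ∈ PW p n := by
  have h1 : (1 : ℝ) < ((Ideal.absNorm p.asIdeal : ℕ) : ℝ) := by
    exact_mod_cast NumberField.HeightOneSpectrum.one_lt_absNorm p
  constructor
  · intro h n
    obtain ⟨y, hy⟩ := h (((Ideal.absNorm p.asIdeal : ℕ) : ℝ) ^ (-n)) (by positivity)
    exact ⟨y, (ab_le p _ _).2 hy.le⟩
  · intro h ε hε
    obtain ⟨n, hn⟩ := pow_unbounded_of_one_lt ε⁻¹ h1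
    obtain ⟨y, hy⟩ := h n
    refine ⟨y, ((ab_le p _ _).1 hy).trans_lt ?_⟩
    rw [zpow_neg, zpow_natCast]
    exact inv_lt_of_inv_lt₀ hε hn

end local2
end QC

namespace QC
section local3
open NumberField IsDedekindDomain

theorem NV_iff {K : Type*} [Field K] [CharZero K] {v : AbsoluteValue K ℝ} {a : K} {b : Kˣ} :
    b ∈ NV v a ↔ ∀ ε > 0, ∃ x y : K, v (b - (x ^ 2 - a * y ^ 2)) < ε := by
  constructor
  · intro h ε hε
    obtain ⟨n, ⟨x, y, hn⟩, s, hs, rfl⟩ := mem_NV.1 h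
    have := v.pos n.ne_zero
    obtain ⟨z, hz⟩ := hs (ε / v n) (by positivity)
    refine ⟨x * z, y * z, ?_⟩
    have e : ((n * s : Kˣ) : K) - ((x * z) ^ 2 - a * (y * z) ^ 2) = n * (s - z ^ 2) := by
      rw [Units.val_mul, hn]; ring
    rw [e, map_mul]
    rwa [lt_div_iff₀' this] at hz
  · intro h
    obtain ⟨ε, hε, hh⟩ := Sq.near v b.ne_zero
    obtain ⟨x, y, hxy⟩ := h ε hε
    obtain ⟨h0, h1⟩ := hh (x ^ 2 - a * y ^ 2) (by rwa [v.map_sub])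
    refine mem_NV.2 ⟨Units.mk0 _ h0, ⟨x, y, rfl⟩, (Units.mk0 _ h0)⁻¹ * b, ?_, by simp⟩
    rw [mem_SqG]
    have := h1.mul (Sq.sq v (x ^ 2 - a * y ^ 2)⁻¹)
    convert this using 1
    simp
    field_simp

theorem NV_symm {K : Type*} [Field K] [CharZero K] {v : AbsoluteValue K ℝ} {a b : Kˣ}
    (h : b ∈ NV v (a : K)) : a ∈ NV v (b : K) := by
  obtain ⟨n, ⟨x, y, hn⟩, s, hs, hb⟩ := mem_NV.1 h
  by_cases hy : y = 0
  · rw [NV_eq_top b.ne_zero]; · trivial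
    rw [← hb, Units.val_mul, hn, hy]
    simpa using (Sq.sq v x).mul hs
  · rw [NV_iff]
    intro ε hε
    have h1 := v.pos b.ne_zero
    have h2 := v.pos hy
    obtain ⟨z, hz⟩ := Sq.inv hs (ε * v y ^ 2 / v b) (by positivity)
    refine ⟨x / y, z / y, ?_⟩
    have e : (a : K) - ((x / y) ^ 2 - b * (z / y) ^ 2) = - b * ((s : K)⁻¹ - z ^ 2) / y ^ 2 := by
      have : (a : K) = (x ^ 2 - n) / y ^ 2 := by rw [hn]; field_simp; ring
      have h3 : (n : K) = b * (s : K)⁻¹ := by rw [← hb]; simp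
      rw [this, h3]; field_simp; ring
    rw [e, map_div₀, map_mul, v.map_neg, map_pow, div_lt_iff₀ (by positivity)]
    rwa [lt_div_iff₀' h1] at hz

variable {K : Type*} [Field K] [NumberField K] (p : HeightOneSpectrum (𝓞 K))

theorem NV_PW {a : K} {b : Kˣ} (h : b ∈ NV (ab p) a) (n : ℤ) :
    ∃ x y : K, b - (x ^ 2 - a * y ^ 2) ∈ PW p n := by
  have h1 : (1 : ℝ) < ((Ideal.absNorm p.asIdeal : ℕ) : ℝ) := by
    exact_mod_cast NumberField.HeightOneSpectrum.one_lt_absNorm p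
  obtain ⟨x, y, hxy⟩ := NV_iff.1 h (((Ideal.absNorm p.asIdeal : ℕ) : ℝ) ^ (-n)) (by positivity)
  exact ⟨x, y, (ab_le p _ _).2 hxy.le⟩

theorem od2 : 0 ≤ od p (2 : K) := by
  rw [← mem_PW p (by norm_num)]
  have := int_PW p (2 : 𝓞 K)
  rwa [RingOfIntegers.coe_eq_algebraMap, map_ofNat] at this

theorem hensel {x : K} (hx : x - 1 ∈ PW p (2 * od p (2 : K) + 1)) : Sq (ab p) x := by
  set e := od p (2 : K)
  obtain ⟨m, rfl⟩ : ∃ m, x = 1 + 4 * m := ⟨(x - 1) / 4, by field_simp; ring⟩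
  have h2 : (2 : K) ∈ PW p e := (mem_PW p (by norm_num)).2 le_rfl
  have h2' : (2 : K)⁻¹ ∈ PW p (-e) := (mem_PW p (by norm_num)).2 (by simp [e])
  have hm : m ∈ PW p 1 := by
    have := mul_PW' p (mul_PW p h2' h2') hx (k := 1) (by omega)
    convert this using 1; ring
  have key : ∀ n : ℕ, ∃ z ∈ PW p 1, z ^ 2 + z - m ∈ PW p (n + 1) := by
    intro n
    induction n with
    | zero => exact ⟨0, zero_mem _, by simpa using hm⟩
    | succ n ih =>
      obtain ⟨z, hz, h⟩ := ih
      have h3 : m - z ^ 2 ∈ PW p 1 := sub_mem hm (sq_PW p hz (by norm_num))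
      refine ⟨m - z ^ 2, h3, ?_⟩
      have := mul_PW p h (add_mem h3 hz)
      convert neg_mem this using 1
      · push_cast; rfl
      · ring
  rw [sq_iff]
  intro n
  obtain ⟨z, hz, h⟩ := key (n - 2 * e).toNat
  refine ⟨1 + 2 * z, ?_⟩
  have := mul_PW' p (mul_PW p h2 h2) h (k := n) (by omega)
  convert neg_mem this using 1
  ring

theorem od_unit_iff {x : K} (hx : x ∈ PW p 0) (hx1 : x ∉ PW p 1) : x ≠ 0 ∧ od p x = 0 := by
  have h0 : x ≠ 0 := by rintro rfl; exact hx1 (zero_mem _)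
  rw [mem_PW p h0] at hx hx1
  exact ⟨h0, by omega⟩

/-- a non-injective polynomial map on the residue field is not surjective -/
theorem nonsurj (α β : 𝓞 K) (hα : α ∉ p.asIdeal) (hβ : β ∉ p.asIdeal) :
    ∃ ρ : 𝓞 K, ∀ x ∈ PW p 0, α * x + β * x ^ 2 - (ρ : K) ∉ PW p 1 := by
  have := p.isMaximal
  let : Field (𝓞 K ⧸ p.asIdeal) := Ideal.Quotient.field _
  have : Finite (𝓞 K ⧸ p.asIdeal) := Ideal.finiteQuotientOfFreeOfNeBot _ p.ne_bot
  set π := Ideal.Quotient.mk p.asIdeal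
  have h1 : π α ≠ 0 := by rwa [Ne, Ideal.Quotient.eq_zero_iff_mem]
  have h2 : π β ≠ 0 := by rwa [Ne, Ideal.Quotient.eq_zero_iff_mem]
  let f : 𝓞 K ⧸ p.asIdeal → 𝓞 K ⧸ p.asIdeal := fun x => π α * x + π β * x ^ 2
  have hf : ¬ Function.Surjective f := by
    rw [← Finite.injective_iff_surjective]
    intro h
    have : f 0 = f (- π α / π β) := by simp only [f]; field_simp; ring
    have := h this
    rw [eq_comm, div_eq_zero_iff] at this
    simp_all
  simp only [Function.Surjective, not_forall] at hf
  obtain ⟨ρ', hρ⟩ := hf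
  obtain ⟨ρ, rfl⟩ := Ideal.Quotient.mk_surjective ρ'
  refine ⟨ρ, fun x hx h => hρ ?_⟩
  obtain ⟨r, hr⟩ := near_int p hx 1
  refine ⟨π r, ?_⟩
  simp only [f]
  rw [← map_pow, ← map_mul, ← map_mul, ← map_add, Ideal.Quotient.mk_eq_mk_iff_sub_mem,
    ← pow_one p.asIdeal, ← int_mem_PW]
  have h3 : (α : K) * (x - r) + β * ((x - r) * (x + r)) ∈ PW p 1 :=
    add_mem (mul_PW' p (int_PW p α) hr (by simp)) (mul_PW' p (int_PW p β) (mul_PW' p hr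
      (add_mem hx (int_PW p r)) (k := 1) (by simp)) (by simp))
  have := sub_mem h h3
  convert this using 1
  · simp
  · simp only [RingOfIntegers.coe_eq_algebraMap, map_add, map_sub, map_mul, map_pow]
    ring

/-- units represented by integers -/
theorem unit_int {x : K} (hx : x ≠ 0) (h : od p x = 0) (n : ℕ) :
    ∃ r : 𝓞 K, r ∉ p.asIdeal ∧ x - r ∈ PW p (n + 1) := by
  obtain ⟨r, hr⟩ := near_int p ((mem_PW p hx).2 h.ge) (n + 1)
  refine ⟨r, fun h1 => ?_, hr⟩
  rw [← pow_one p.asIdeal, ← int_mem_PW] at h1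
  have := add_mem (PW_mono p (by omega) hr) h1
  rw [sub_add_cancel, mem_PW p hx] at this
  push_cast at this
  omega

theorem even_of_norm {ρ : K} (hρ : ρ ∈ PW p 0) (h : ∀ x ∈ PW p 0, x + x ^ 2 - ρ ∉ PW p 1) (z : Kˣ)
    (hz : z ∈ NV (ab p) (1 + 4 * ρ)) : Even (od p (z : K)) := by
  obtain ⟨X, Y, hXY⟩ := NV_PW p hz (od p (z : K) + 1)
  obtain ⟨h0, h1⟩ := od_add p z.ne_zero (neg_mem hXY)
  rw [show (z : K) + -(z - (X ^ 2 - (1 + 4 * ρ) * Y ^ 2)) = X ^ 2 - (1 + 4 * ρ) * Y ^ 2 by ring]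
    at h0 h1
  rw [← h1]
  by_cases hY : Y = 0
  · subst hY
    simp
  · have h2Y : 2 * Y ≠ 0 := by simpa using hY
    obtain ⟨t, ht⟩ : ∃ t, t = (X - Y) / (2 * Y) := ⟨_, rfl⟩
    have e : X ^ 2 - (1 + 4 * ρ) * Y ^ 2 = (2 * Y) ^ 2 * (t + t ^ 2 - ρ) := by
      rw [ht]; field_simp; ring
    have ht0 : t + t ^ 2 - ρ ≠ 0 := by
      intro h'; rw [h', mul_zero] at e; exact h0 e
    rw [e, od_mul p (pow_ne_zero 2 h2Y) ht0, od_pow]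
    have : Even (od p (t + t ^ 2 - ρ)) := by
      by_cases ht1 : t ∈ PW p 0
      · rw [(od_unit_iff p (sub_mem (add_mem ht1 (sq_PW p ht1 (by simp))) hρ) (h t ht1)).2]
        simp
      · have ht0 : t ≠ 0 := by rintro rfl; exact ht1 (zero_mem _)
        have h3 := ht1
        rw [mem_PW p ht0] at h3
        have := (od_add p (x := t ^ 2) (y := t - ρ) (pow_ne_zero 2 ht0) (by
          rw [od_pow]
          refine sub_mem ((mem_PW p ht0).2 (by push_cast; omega)) (PW_mono p (by push_cast; omega) hρ))).2
        rw [show t + t ^ 2 - ρ = t ^ 2 + (t - ρ) by ring, this]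
        simp
    simpa [Int.even_add] using this

theorem sq_odd {X : K} (h : X ^ 2 - 1 ≠ 0) (ho : ¬ Even (od p (X ^ 2 - 1))) :
    2 * od p (2 : K) ≤ od p (X ^ 2 - 1) := by
  obtain ⟨t, rfl⟩ : ∃ t, X = 1 + t := ⟨X - 1, by ring⟩
  have e : (1 + t) ^ 2 - 1 = t ^ 2 + 2 * t := by ring
  rw [e] at h ho ⊢
  have ht : t ≠ 0 := by rintro rfl; simp at h
  by_cases h1 : od p (2 : K) ≤ od p t
  · rw [← mem_PW p h]
    refine add_mem (sq_PW p ((mem_PW p ht).2 h1) le_rfl) (mul_PW' p ((mem_PW p (by norm_num)).2 le_rfl) ((mem_PW p ht).2 h1) (by omega))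
  · exfalso
    apply ho
    rw [(od_add p (x := t ^ 2) (y := 2 * t) (pow_ne_zero 2 ht) ?_).2]
    · simp
    · rw [mem_PW p (by simpa using ht), od_pow, od_mul p (by norm_num) ht]
      push_cast; omega

end local3
end QC

namespace QC
section local4
open NumberField IsDedekindDomain
variable {K : Type*} [Field K] [NumberField K] (p : HeightOneSpectrum (𝓞 K))

theorem unit_of_PW {x : K} (hx : x ∈ PW p 1) : 1 + x ≠ 0 ∧ od p (1 + x) = 0 := by
  have := od_add p (x := (1 : K)) (y := x) one_ne_zero (by simpa using hx)
  simpa using this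

theorem self_PW (x : K) : x ∈ PW p (od p x) := by
  by_cases h : x = 0
  · rw [h]; exact zero_mem _
  · exact (mem_PW p h).2 le_rfl

theorem caseD {c : K} (hc : c ≠ 0) {k : ℤ} (hk : 0 ≤ k) (h : od p c = 2 * k + 1)
    (h2 : 2 * k + 1 < 2 * od p (2 : K)) : ∃ b : Kˣ, b ∉ NV (ab p) (1 + c) := by
  set e := od p (2 : K) with he
  obtain ⟨π, hπ0, hπ⟩ := exists_unif p
  obtain ⟨m, hm⟩ : ∃ m, m = 2 * e - 2 * k - 1 := ⟨_, rfl⟩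
  obtain ⟨n, hn⟩ : ∃ n, n = e - 2 * k - 1 := ⟨_, rfl⟩
  have h20 : (2 : K) ≠ 0 := two_ne_zero
  have hz : ∀ i : ℤ, π ^ i ≠ 0 := fun i => zpow_ne_zero i hπ0
  have hzP : ∀ i : ℤ, π ^ i ∈ PW p i := fun i => (mem_PW p (hz i)).2 (by simp [hπ])
  obtain ⟨α0, hα0⟩ : ∃ α0, α0 = 2 * π ^ n / π ^ m := ⟨_, rfl⟩
  obtain ⟨β0, hβ0⟩ : ∃ β0, β0 = c * (π ^ n) ^ 2 / π ^ m := ⟨_, rfl⟩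
  have hα1 : α0 ≠ 0 := by rw [hα0]; exact div_ne_zero (mul_ne_zero h20 (hz n)) (hz m)
  have hβ1 : β0 ≠ 0 := by
    rw [hβ0]; exact div_ne_zero (mul_ne_zero hc (pow_ne_zero 2 (hz n))) (hz m)
  obtain ⟨α, hα, hα'⟩ := unit_int p (x := α0) hα1 (by
    rw [hα0, od_div p (mul_ne_zero h20 (hz n)) (hz m), od_mul p h20 (hz n)]; simp [hπ]; omega) 0
  obtain ⟨β, hβ, hβ'⟩ := unit_int p (x := β0) hβ1 (by
    rw [hβ0, od_div p (mul_ne_zero hc (pow_ne_zero 2 (hz n))) (hz m), od_mul p hc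
      (pow_ne_zero 2 (hz n))]; simp [hπ]; omega) 0
  obtain ⟨ρ, hρ⟩ := nonsurj p α β hα hβ
  have hρ1 : ∀ y ∈ PW p n, -ρ * π ^ m + 2 * y + c * y ^ 2 ∉ PW p (m + 1) := by
    intro y hy hh
    have hr : y * π ^ (-n) ∈ PW p 0 := mul_PW' p hy (hzP _) (by omega)
    refine hρ _ hr ?_
    have h3 := mul_PW' p hh (hzP (-m)) (k := 1) (by omega)
    have h4 := mul_PW' p hα' hr (k := 1) (by simp)
    have h5 := mul_PW' p hβ' (sq_PW p hr (k := 0) (by simp)) (k := 1) (by simp)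
    convert sub_mem (sub_mem h3 h4) h5 using 1
    rw [hα0, hβ0, zpow_neg, zpow_neg]
    have := hz n; have := hz m
    field_simp
    ring
  obtain ⟨d, hd⟩ : ∃ d, d = -ρ * π ^ m := ⟨_, rfl⟩
  have hdP : d ∈ PW p m := hd ▸ mul_PW' p (neg_mem (int_PW p ρ)) (hzP m) (by omega)
  rw [← hd] at hρ1
  obtain ⟨hb, hb'⟩ := unit_of_PW p (PW_mono p (by omega) hdP)
  refine ⟨Units.mk0 _ hb, fun hN => ?_⟩
  obtain ⟨x, y0, hxy⟩ := NV_PW p hN (m + 1)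
  obtain ⟨X, hX⟩ : ∃ X, X = x + y0 := ⟨_, rfl⟩
  obtain ⟨d', hd'⟩ : ∃ d', d' = x ^ 2 - (1 + c) * y0 ^ 2 - 1 := ⟨_, rfl⟩
  have hdd : d - d' ∈ PW p (m + 1) := by
    convert hxy using 1; rw [hd', Units.val_mk0]; ring
  have hd'P : d' ∈ PW p m := by
    have := sub_mem hdP (PW_mono p (by omega) hdd); simpa using this
  obtain ⟨hu, hu'⟩ := unit_of_PW p (PW_mono p (m := 1) (by omega) hd'P)
  have hX0 : X ≠ 0 := by
    intro h0
    have e1 : 1 + d' = - (c * y0 ^ 2) := by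
      rw [hd', (by linear_combination hX.symm.trans h0 : x = - y0)]; ring
    have hy0 : y0 ≠ 0 := by rintro rfl; exact hu (by rw [e1]; simp)
    rw [e1, od_neg, od_mul p hc (pow_ne_zero 2 hy0), od_pow] at hu'
    push_cast at hu'
    omega
  obtain ⟨y, hy⟩ : ∃ y, y = y0 / X := ⟨_, rfl⟩
  obtain ⟨w, hw⟩ : ∃ w, w = - 2 * y - c * y ^ 2 := ⟨_, rfl⟩
  have e1 : X ^ 2 * (1 + w) = 1 + d' := by
    have : x = X - y0 := by rw [hX]; ring
    rw [hw, hy, hd', this]; field_simp; ring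
  have hw0 : 1 + w ≠ 0 := by intro h0; rw [h0, mul_zero] at e1; exact hu e1.symm
  have e2 : X ^ 2 - 1 = (d' - w) / (1 + w) := by
    rw [eq_div_iff hw0]; linear_combination e1
  have fin : d' - w ≠ 0 → od p (1 + w) = 0 → ¬ Even (od p (d' - w)) → 2 * e ≤ od p (d' - w) := by
    intro h1 h3 h4
    have := sq_odd p (X := X) (by rw [e2]; exact div_ne_zero h1 hw0)
    rw [e2, od_div p h1 hw0, h3, sub_zero] at this
    exact this h4
  by_cases hyn : y ∈ PW p n
  · have hwP : w ∈ PW p m := hw ▸ sub_mem (mul_PW' p (neg_mem (self_PW p _)) hyn (by omega))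
      (mul_PW' p (self_PW p c) (sq_PW p hyn le_rfl) (by omega))
    have h3 := hρ1 y hyn
    have h5 : d' - w ∉ PW p (m + 1) := by
      intro h6
      apply h3
      convert add_mem h6 hdd using 1
      rw [hw]; ring
    have h7 : d' - w ≠ 0 := by intro h0; rw [h0] at h5; exact h5 (zero_mem _)
    have h8 := sub_mem hd'P hwP
    rw [mem_PW p h7] at h5 h8
    have h9 : od p (d' - w) = m := by omega
    have := fin h7 (unit_of_PW p (PW_mono p (by omega) hwP)).2
      (by rw [h9, Int.not_even_iff_odd]; exact ⟨e - k - 1, by omega⟩)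
    omega
  · have hy0 : y ≠ 0 := by rintro rfl; exact hyn (zero_mem _)
    rw [mem_PW p hy0] at hyn
    have hcy : -(c * y ^ 2) ≠ 0 := neg_ne_zero.2 (mul_ne_zero hc (pow_ne_zero 2 hy0))
    have hocy : od p (-(c * y ^ 2)) = 2 * k + 1 + 2 * od p y := by
      rw [od_neg, od_mul p hc (pow_ne_zero 2 hy0), od_pow, h]; push_cast; ring
    obtain ⟨h5, h6⟩ := od_add p (x := -(c * y ^ 2)) (y := - 2 * y) hcy (by
      rw [hocy]
      exact mul_PW' p (neg_mem (self_PW p _)) (self_PW p y) (by omega))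
    rw [show -(c * y ^ 2) + - 2 * y = w by rw [hw]; ring] at h5 h6
    rw [hocy] at h6
    by_cases ho : 0 < od p w
    · obtain ⟨h7, h8⟩ := od_add p (x := -w) (y := d') (neg_ne_zero.2 h5)
        (PW_mono p (by rw [od_neg]; omega) hd'P)
      rw [show -w + d' = d' - w by ring, od_neg, h6] at h8
      have := fin (by rwa [← show -w + d' = d' - w by ring])
        (unit_of_PW p ((mem_PW p h5).2 ho)).2
        (by rw [h8, Int.not_even_iff_odd]; exact ⟨k + od p y, by omega⟩)
      omega
    · obtain ⟨h7, h8⟩ := od_add p (x := w) (y := 1) h5 (PW_mono p (by omega) (one_PW p))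
      rw [add_comm] at h7 h8
      rw [← e1, od_mul p (pow_ne_zero 2 hX0) h7, h8, od_pow] at hu'
      push_cast at hu'
      omega

/-- improve a unit by squares (dyadic case) -/
theorem unit_step (he : 0 < od p (2 : K)) {x : K} (hx : x ≠ 0) (h : od p x = 0) :
    ∃ w : K, w ≠ 0 ∧ od p w = 0 ∧ x - w ^ 2 ∈ PW p 1 := by
  have := p.isMaximal
  let _ : Field (𝓞 K ⧸ p.asIdeal) := Ideal.Quotient.field _
  have : Finite (𝓞 K ⧸ p.asIdeal) := Ideal.finiteQuotientOfFreeOfNeBot _ p.ne_bot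
  have : CharP (𝓞 K ⧸ p.asIdeal) 2 := by
    refine CharTwo.of_one_ne_zero_of_two_eq_zero one_ne_zero ?_
    have : Ideal.Quotient.mk p.asIdeal 2 = 0 := by
      rw [Ideal.Quotient.eq_zero_iff_mem, ← pow_one p.asIdeal, ← int_mem_PW,
        RingOfIntegers.coe_eq_algebraMap, map_ofNat, mem_PW p two_ne_zero]
      push_cast; omega
    rwa [map_ofNat] at this
  obtain ⟨r, hr, hr'⟩ := unit_int p hx h 0
  cases nonempty_fintype (𝓞 K ⧸ p.asIdeal)
  obtain ⟨s', hs⟩ : IsSquare (Ideal.Quotient.mk p.asIdeal r) := FiniteField.isSquare_of_char_two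
    (ringChar.eq _ 2) _
  obtain ⟨s, rfl⟩ := Ideal.Quotient.mk_surjective s'
  rw [← map_mul, Ideal.Quotient.mk_eq_mk_iff_sub_mem] at hs
  have h1 := hs
  rw [← pow_one p.asIdeal, ← int_mem_PW] at h1
  have hs' : s ∉ p.asIdeal := fun h => hr (by
    have := add_mem hs (p.asIdeal.mul_mem_left s h); simpa using this)
  have hs1 := hs'
  rw [← pow_one p.asIdeal, ← int_mem_PW] at hs1
  obtain ⟨h3, h4⟩ := od_unit_iff p (int_PW p s) (by simpa using hs1)
  refine ⟨s, h3, h4, ?_⟩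
  have := add_mem hr' h1
  convert this using 1
  · simp
  · simp only [RingOfIntegers.coe_eq_algebraMap, map_sub, map_mul]; ring

theorem unit_red {a : K} (ha : a ≠ 0) (h : od p a = 0) : ∃ t : K, t ≠ 0 ∧ od p t = 0 ∧
    (a * t ^ 2 - 1 ∈ PW p (2 * od p (2 : K)) ∨ (a * t ^ 2 - 1 ≠ 0 ∧ ∃ k : ℤ, 0 ≤ k ∧
      od p (a * t ^ 2 - 1) = 2 * k + 1 ∧ 2 * k + 1 < 2 * od p (2 : K))) := by
  by_contra hcon
  push Not at hcon
  set e := od p (2 : K)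
  obtain ⟨π, hπ0, hπ⟩ := exists_unif p
  have he0 : 0 ≤ e := od2 p
  have he : 0 < e := by
    by_contra hh
    refine (hcon 1 one_ne_zero (od_one p)).1 ?_
    rw [show 2 * e = 0 by omega]
    refine sub_mem ?_ (one_PW p)
    simpa using (mem_PW p ha).2 h.ge
  have key : ∀ n : ℕ, (n : ℤ) + 1 ≤ 2 * e → ∃ t : K, t ≠ 0 ∧ od p t = 0 ∧
      a * t ^ 2 - 1 ∈ PW p (n + 1) := by
    intro n
    induction n with
    | zero =>
      intro _
      obtain ⟨w, hw, hw', hh⟩ := unit_step p he ha h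
      refine ⟨w⁻¹, inv_ne_zero hw, by simp [hw'], ?_⟩
      have := mul_PW' p hh ((mem_PW p (x := (w⁻¹) ^ 2) (n := 0)
        (pow_ne_zero 2 (inv_ne_zero hw))).2 (by simp [hw'])) (k := 1) (by simp)
      convert this using 1
      · simp
      · field_simp
    | succ n ih =>
      intro hn
      push_cast at hn
      obtain ⟨t, ht, ht', hc⟩ := ih (by omega)
      push_cast
      by_cases hc1 : a * t ^ 2 - 1 ∈ PW p (n + 1 + 1)
      · exact ⟨t, ht, ht', hc1⟩
      obtain ⟨c, hcd⟩ : ∃ c, c = a * t ^ 2 - 1 := ⟨_, rfl⟩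
      have hcon1 := (hcon t ht ht').2
      rw [← hcd] at hc hc1 hcon1
      have hc0 : c ≠ 0 := by rintro rfl; exact hc1 (zero_mem _)
      rw [mem_PW p hc0] at hc hc1
      have hoc : od p c = n + 1 := by omega
      obtain ⟨k, hk⟩ : ∃ k : ℕ, (n : ℤ) + 1 = 2 * k := by
        rcases Nat.even_or_odd' n with ⟨k, hk | hk⟩
        · have := hcon1 hc0 k (by omega) (by omega)
          omega
        · exact ⟨k + 1, by omega⟩
      have hpk := pow_ne_zero k hπ0
      obtain ⟨w, hw0, hw, hw'⟩ := unit_step p he (x := c / (π ^ k) ^ 2)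
        (div_ne_zero hc0 (pow_ne_zero 2 hpk)) (by
          rw [od_div p hc0 (pow_ne_zero 2 hpk)]; simp [hπ]; omega)
      have hpkP : π ^ k ∈ PW p k := (mem_PW p hpk).2 (by simp [hπ])
      have hpw : π ^ k * w ∈ PW p k := mul_PW' p hpkP (self_PW p w) (by omega)
      obtain ⟨h1, h2⟩ := unit_of_PW p (PW_mono p (m := 1) (by omega) hpw)
      refine ⟨t / (1 + π ^ k * w), div_ne_zero ht h1, by rw [od_div p ht h1]; omega, ?_⟩
      have h3 : c - (π ^ k) ^ 2 * w ^ 2 ∈ PW p (n + 1 + 1) := by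
        have := mul_PW' p (sq_PW p hpkP le_rfl) hw' (k := n + 1 + 1) (by omega)
        convert this using 1; field_simp
      have h4 := sub_mem h3 (mul_PW' p (self_PW p (2 : K)) hpw (k := n + 1 + 1) (by omega))
      have := mul_PW' p h4 ((mem_PW p (x := ((1 + π ^ k * w)⁻¹) ^ 2) (n := 0)
        (pow_ne_zero 2 (inv_ne_zero h1))).2 (by simp [h2])) (k := n + 1 + 1) (by simp)
      convert this using 1
      rw [hcd]
      field_simp
      ring
  obtain ⟨t, ht, ht', hh⟩ := key (2 * e - 1).toNat (by omega)
  exact (hcon t ht ht').1 (PW_mono p (by omega) hh)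

theorem Nm_sq {F : Type*} [Field F] (a : F) {t : F} (ht : t ≠ 0) : Nm (a * t ^ 2) = Nm a := by
  ext b
  constructor
  · rintro ⟨x, y, h⟩; exact ⟨x, t * y, by rw [h]; ring⟩
  · rintro ⟨x, y, h⟩; exact ⟨x, y / t, by rw [h]; field_simp⟩

theorem NV_sq {F : Type*} [Field F] (v : AbsoluteValue F ℝ) (a : F) {t : F} (ht : t ≠ 0) :
    NV v (a * t ^ 2) = NV v a := by rw [NV, NV, Nm_sq a ht]

theorem LNfin {a : K} (ha : a ≠ 0) (hs : ¬ Sq (ab p) a) : ∃ b : Kˣ, b ∉ NV (ab p) a := by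
  obtain ⟨π, hπ0, hπ⟩ := exists_unif p
  have h20 : (2 : K) ≠ 0 := two_ne_zero
  have h40 : (4 : K) ≠ 0 := by norm_num
  have h4 : od p (4 : K) = 2 * od p (2 : K) := by
    rw [show (4 : K) = 2 ^ 2 by norm_num, od_pow]; rfl
  have he := od2 p
  rcases Int.even_or_odd' (od p a) with ⟨k, hk | hk⟩
  · have hpk := zpow_ne_zero (-k) hπ0
    obtain ⟨t, ht, ht', hc⟩ := unit_red p (a := a * (π ^ (-k)) ^ 2)
      (mul_ne_zero ha (pow_ne_zero 2 hpk)) (by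
        rw [od_mul p ha (pow_ne_zero 2 hpk)]; simp [hπ]; omega)
    obtain ⟨c, hcd⟩ : ∃ c, c = a * (π ^ (-k)) ^ 2 * t ^ 2 - 1 := ⟨_, rfl⟩
    have e1 : a * (π ^ (-k)) ^ 2 * t ^ 2 = 1 + c := by rw [hcd]; ring
    have e2 : NV (ab p) a = NV (ab p) (1 + c) := by rw [← e1, NV_sq _ _ ht, NV_sq _ _ hpk]
    have hA : 1 + c ≠ 0 := by
      rw [← e1]; exact mul_ne_zero (mul_ne_zero ha (pow_ne_zero 2 hpk)) (pow_ne_zero 2 ht)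
    have hA' : od p (1 + c) = 0 := by
      rw [← e1, od_mul p (mul_ne_zero ha (pow_ne_zero 2 hpk)) (pow_ne_zero 2 ht),
        od_mul p ha (pow_ne_zero 2 hpk)]; simp [hπ, ht']; omega
    rw [← hcd] at hc
    rw [e2]
    rcases hc with hc | ⟨hc0, k', hk0, hk1, hk2⟩
    · obtain ⟨ρ, hρ⟩ : ∃ ρ, ρ = c / 4 := ⟨_, rfl⟩
      have hcρ : c = 4 * ρ := by rw [hρ]; field_simp
      have hρP : ρ ∈ PW p 0 := by
        rw [hρ, div_eq_mul_inv]
        exact mul_PW' p hc (self_PW p _) (by rw [od_inv]; omega)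
      have hnr : ∀ x ∈ PW p 0, x + x ^ 2 - ρ ∉ PW p 1 := by
        intro x hx hh
        have h5 : (1 + 2 * x) ^ 2 - (1 + c) ∈ PW p (2 * od p (2 : K) + 1) := by
          have := mul_PW' p (self_PW p (4 : K)) hh (k := 2 * od p (2 : K) + 1) (by omega)
          convert this using 1
          rw [hcρ]; ring
        obtain ⟨h6, h7⟩ := od_add p hA (PW_mono p (by omega) h5)
        rw [add_sub_cancel] at h6 h7
        have h8 : 1 + 2 * x ≠ 0 := by intro h0; rw [h0] at h6; simp at h6
        have h9 : Sq (ab p) ((1 + c) * ((1 + 2 * x)⁻¹) ^ 2) := by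
          apply hensel p
          have := mul_PW' p (neg_mem h5) (self_PW p (((1 + 2 * x) ^ 2)⁻¹))
            (k := 2 * od p (2 : K) + 1) (by rw [od_inv]; omega)
          convert this using 1
          field_simp; ring
        apply hs
        have := h9.mul (Sq.sq (ab p) ((1 + 2 * x) / (π ^ (-k) * t)))
        convert this using 1
        rw [← e1]
        field_simp
      refine ⟨Units.mk0 π hπ0, fun hN => ?_⟩
      rw [hcρ] at hN
      have := even_of_norm p hρP hnr _ hN
      rw [Units.val_mk0, hπ] at this
      simp at this
    · exact caseD p hc0 hk0 hk1 hk2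
  · have h1 : (1 : 𝓞 K) ∉ p.asIdeal := fun h => p.isPrime.ne_top ((Ideal.eq_top_iff_one _).2 h)
    obtain ⟨ρ, hρ⟩ := nonsurj p 1 1 h1 h1
    simp only [RingOfIntegers.coe_eq_algebraMap, map_one, one_mul] at hρ
    have hρP := int_PW p ρ
    rw [RingOfIntegers.coe_eq_algebraMap] at hρP
    set r := algebraMap (𝓞 K) K ρ
    have hb : 1 + 4 * r ≠ 0 := by
      intro h0
      have hr : r = -(4⁻¹) := by field_simp; linear_combination h0
      have hr0 : r ≠ 0 := by rw [hr]; exact neg_ne_zero.2 (inv_ne_zero h40)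
      have h5 := hρP
      rw [mem_PW p hr0, hr, od_neg, od_inv] at h5
      refine hρ (-(2⁻¹)) ((mem_PW p (neg_ne_zero.2 (inv_ne_zero h20))).2 ?_) ?_
      · rw [od_neg, od_inv]; omega
      · rw [hr]; norm_num
    refine ⟨Units.mk0 _ hb, fun hN => ?_⟩
    have h6 := NV_symm (a := Units.mk0 a ha) (b := Units.mk0 _ hb) hN
    rw [Units.val_mk0] at h6
    have := even_of_norm p hρP hρ (Units.mk0 a ha) h6
    rw [Units.val_mk0, hk] at this
    obtain ⟨j, hj⟩ := this
    omega

end local4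
end QC

namespace QC
section local5
open NumberField IsDedekindDomain
variable {K : Type*} [Field K] [NumberField K] (p : HeightOneSpectrum (𝓞 K))

/-- unit part classes: if residues mod `p^(2e+1)` differ by a square the classes agree -/
theorem sq_of_res {x y : K} (hx : x ≠ 0) (hy : y ≠ 0) (hxy : od p x = 0) {z : K}
    (hz : x - y * z ^ 2 ∈ PW p (2 * od p (2 : K) + 1)) : Sq (ab p) (x * y) := by
  have he := od2 p
  obtain ⟨h1, h2⟩ := od_add p hx (neg_mem (PW_mono p (by omega) hz))
  rw [show x + -(x - y * z ^ 2) = y * z ^ 2 by ring] at h1 h2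
  have hz0 : z ≠ 0 := by rintro rfl; simp at h1
  have := hensel p (x := x / (y * z ^ 2)) (by
    have := mul_PW' p hz (self_PW p (y * z ^ 2)⁻¹) (k := 2 * od p (2 : K) + 1)
      (by rw [od_inv]; omega)
    convert this using 1
    field_simp)
  have := this.mul (Sq.sq _ (y * z))
  convert this using 1
  field_simp

theorem card_pow (n : ℕ) : Nat.card (𝓞 K ⧸ p.asIdeal ^ n) = Ideal.absNorm p.asIdeal ^ n := by
  rw [← map_pow, Ideal.absNorm_apply, Submodule.cardQuot_apply]

theorem fin_pow (n : ℕ) : Finite (𝓞 K ⧸ p.asIdeal ^ n) :=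
  Ideal.finiteQuotientOfFreeOfNeBot _ (pow_ne_zero n p.ne_bot)

theorem cok_bound {R R' : Type*} [CommRing R] [CommRing R'] [Finite R] (fa : R →+* R') {N : ℕ}
    (hI : Nat.card fa.toAddMonoidHom.ker = N)
    (hker : ∀ u : Rˣ, u ∈ (powMonoidHom 2 : Rˣ →* Rˣ).ker → fa (u - 1) = 0 ∨ fa (u + 1) = 0) :
    Nat.card (Rˣ ⧸ (powMonoidHom 2 : Rˣ →* Rˣ).range) ≤ 2 * N := by
  classical
  set sq : Rˣ →* Rˣ := powMonoidHom 2
  have hk : Nat.card sq.ker ≤ 2 * N := by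
    have : Nat.card (Bool × fa.toAddMonoidHom.ker) = 2 * N := by
      rw [Nat.card_prod, hI]; simp
    rw [← this]
    refine Nat.card_le_card_of_injective (fun u : sq.ker => if h : fa ((u : Rˣ) - 1) = 0 then
      (true, (⟨_, h⟩ : fa.toAddMonoidHom.ker)) else
      (false, ⟨_, (hker u u.2).resolve_left h⟩)) ?_
    intro u u' huu
    simp only at huu
    split_ifs at huu <;> simp only [Prod.mk.injEq, true_and, reduceCtorEq,
      false_and] at huu
    · exact Subtype.ext (Units.ext (sub_left_injective (congrArg Subtype.val huu)))
    · exact Subtype.ext (Units.ext (add_left_injective _ (congrArg Subtype.val huu)))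
  have h1 := Subgroup.card_mul_index sq.ker
  have h2 := Subgroup.card_mul_index sq.range
  rw [Subgroup.index_ker] at h1
  rw [mul_comm, ← h1] at h2
  rwa [← Subgroup.index_eq_card, Nat.eq_of_mul_eq_mul_right Nat.card_pos h2]

theorem cok_bd (e : ℕ) : Nat.card ((𝓞 K ⧸ p.asIdeal ^ (2 * e + 1))ˣ ⧸ (powMonoidHom 2 :
    (𝓞 K ⧸ p.asIdeal ^ (2 * e + 1))ˣ →* (𝓞 K ⧸ p.asIdeal ^ (2 * e + 1))ˣ).range) ≤
      2 * Ideal.absNorm p.asIdeal ^ e := by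
  set q := Ideal.absNorm p.asIdeal
  have hq : 0 < q := (NumberField.HeightOneSpectrum.one_lt_absNorm p).le
  let R := 𝓞 K ⧸ p.asIdeal ^ (2 * e + 1)
  have := fin_pow p (2 * e + 1)
  have := fin_pow p (e + 1)
  let sq : Rˣ →* Rˣ := powMonoidHom 2
  let fa : R →+* (𝓞 K ⧸ p.asIdeal ^ (e + 1)) := Ideal.Quotient.factor
    (Ideal.pow_le_pow_right (by omega))
  have hI : Nat.card fa.toAddMonoidHom.ker = q ^ e := by
    have h1 := AddSubgroup.card_mul_index fa.toAddMonoidHom.ker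
    have h2 : fa.toAddMonoidHom.ker.index = q ^ (e + 1) := by
      rw [AddSubgroup.index_ker, AddMonoidHom.range_eq_top.2, AddSubgroup.card_top, card_pow]
      exact Ideal.Quotient.factor_surjective (Ideal.pow_le_pow_right (by omega))
    rw [h2, card_pow, show q ^ (2 * e + 1) = q ^ e * q ^ (e + 1) by rw [← pow_add]; congr 1; ring]
      at h1
    exact Nat.eq_of_mul_eq_mul_right (by positivity) h1
  have hker : ∀ u : Rˣ, u ∈ sq.ker → fa (u - 1) = 0 ∨ fa (u + 1) = 0 := by
    intro u hu
    obtain ⟨r, hr⟩ := Ideal.Quotient.mk_surjective (u : R)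
    have h1 : Ideal.Quotient.mk (p.asIdeal ^ (2 * e + 1)) ((r - 1) * (r + 1)) = 0 := by
      have : (u : R) ^ 2 = 1 := by
        have := congrArg Units.val (show u ^ 2 = 1 from hu)
        simpa using this
      rw [show (r - 1) * (r + 1) = r ^ 2 - 1 by ring, map_sub, map_pow, hr]
      rw [this]; simp
    rw [Ideal.Quotient.eq_zero_iff_mem, ← int_mem_PW] at h1
    rw [← hr]
    change fa (Ideal.Quotient.mk _ r - Ideal.Quotient.mk _ 1) = 0 ∨
      fa (Ideal.Quotient.mk _ r + Ideal.Quotient.mk _ 1) = 0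
    rw [← map_sub, ← map_add]
    change Ideal.Quotient.mk (p.asIdeal ^ (e + 1)) (r - 1) = 0 ∨
      Ideal.Quotient.mk (p.asIdeal ^ (e + 1)) (r + 1) = 0
    rw [Ideal.Quotient.eq_zero_iff_mem, Ideal.Quotient.eq_zero_iff_mem, ← int_mem_PW, ← int_mem_PW]
    by_contra hcon
    push Not at hcon
    obtain ⟨h2, h3⟩ := hcon
    have h4 : ((r - 1 : 𝓞 K) : K) ≠ 0 := by intro h; rw [h] at h2; exact h2 (zero_mem _)
    have h5 : ((r + 1 : 𝓞 K) : K) ≠ 0 := by intro h; rw [h] at h3; exact h3 (zero_mem _)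
    rw [mem_PW p h4] at h2
    rw [mem_PW p h5] at h3
    have e1 : (((r - 1) * (r + 1) : 𝓞 K) : K) = ((r - 1 : 𝓞 K) : K) * ((r + 1 : 𝓞 K) : K) := by
      rw [RingOfIntegers.coe_eq_algebraMap, map_mul]
    rw [e1, mem_PW p (mul_ne_zero h4 h5), od_mul p h4 h5] at h1
    push_cast at h1 h2 h3
    omega
  exact cok_bound fa hI hker

theorem unit_mk (n : ℕ) {r : 𝓞 K} (hr : r ∉ p.asIdeal) :
    IsUnit (Ideal.Quotient.mk (p.asIdeal ^ (n + 1)) r) := by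
  have := p.isMaximal
  obtain ⟨s, hs⟩ := Ideal.Quotient.exists_inv (I := p.asIdeal) (a := Ideal.Quotient.mk _ r)
    (by rwa [Ne, Ideal.Quotient.eq_zero_iff_mem])
  obtain ⟨s, rfl⟩ := Ideal.Quotient.mk_surjective s
  rw [← map_mul, ← map_one (Ideal.Quotient.mk _), Ideal.Quotient.mk_eq_mk_iff_sub_mem] at hs
  have h2 := Ideal.pow_mem_pow hs (n + 1)
  have h3 : IsNilpotent (Ideal.Quotient.mk (p.asIdeal ^ (n + 1)) (r * s - 1)) :=
    ⟨n + 1, by rw [← map_pow]; exact Ideal.Quotient.eq_zero_iff_mem.2 h2⟩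
  have h4 := h3.isUnit_one_add
  rw [map_sub, map_one, add_sub_cancel, map_mul] at h4
  exact isUnit_of_mul_isUnit_left h4

theorem LSfin : (SqG (ab p)).FiniteIndex ∧
    (SqG (ab p)).index ≤ 4 * Ideal.absNorm p.asIdeal ^ (od p (2 : K)).toNat := by
  obtain ⟨e, he⟩ : ∃ e : ℕ, od p (2 : K) = e := ⟨_, (Int.toNat_of_nonneg (od2 p)).symm⟩
  rw [he, Int.toNat_natCast]
  have hcok' := cok_bd p e
  have := fin_pow p (2 * e + 1)
  set R := 𝓞 K ⧸ p.asIdeal ^ (2 * e + 1)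
  set q := Ideal.absNorm p.asIdeal
  set sq : Rˣ →* Rˣ := powMonoidHom 2
  have hcok : Nat.card (Rˣ ⧸ sq.range) ≤ 2 * q ^ e := hcok'
  -- the invariant
  obtain ⟨π, hπ0, hπ⟩ := exists_unif p
  have hu : ∀ x : Kˣ, ∃ u : Rˣ, ∃ r : 𝓞 K, Ideal.Quotient.mk (p.asIdeal ^ (2 * e + 1)) r = u ∧
      (x : K) * π ^ (- od p (x : K)) - r ∈ PW p (2 * e + 1) := by
    intro x
    have hz := zpow_ne_zero (- od p (x : K)) hπ0
    obtain ⟨r, hr, hr'⟩ := unit_int p (mul_ne_zero x.ne_zero hz)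
      (by rw [od_mul p x.ne_zero hz, od_zpow, hπ]; ring) (2 * e)
    obtain ⟨u, hu⟩ := unit_mk p (2 * e) hr
    exact ⟨u, r, hu.symm, by exact_mod_cast hr'⟩
  choose u r hur hr using hu
  let f : Kˣ → Bool × (Rˣ ⧸ sq.range) := fun x =>
    (decide (Even (od p (x : K))), QuotientGroup.mk (u x))
  have hf : ∀ x y, f x = f y → x⁻¹ * y ∈ SqG (ab p) := by
    intro x y hxy
    simp only [f, Prod.mk.injEq, decide_eq_decide] at hxy
    obtain ⟨h1, h2⟩ := hxy
    rw [QuotientGroup.eq] at h2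
    obtain ⟨s, hs⟩ := h2
    obtain ⟨t, ht⟩ := Ideal.Quotient.mk_surjective (s : R)
    have hx0 := x.ne_zero
    have hy0 := y.ne_zero
    have hzx := zpow_ne_zero (- od p (x : K)) hπ0
    have hzy := zpow_ne_zero (- od p (y : K)) hπ0
    have h3 : r y - r x * t ^ 2 ∈ p.asIdeal ^ (2 * e + 1) := by
      rw [← Ideal.Quotient.mk_eq_mk_iff_sub_mem, map_mul, map_pow, hur, hur, ht]
      have : s ^ 2 = (u x)⁻¹ * u y := hs
      rw [← Units.val_pow_eq_pow_val, this, ← Units.val_mul, mul_inv_cancel_left]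
    rw [← int_mem_PW] at h3
    have h4 : (y : K) * π ^ (- od p (y : K)) - (x * π ^ (- od p (x : K))) * (t : K) ^ 2 ∈
        PW p (2 * e + 1) := by
      have h5 := mul_PW' p (hr x) (sq_PW p (int_PW p t) (k := 0) (by simp)) (k := 2 * e + 1)
        (by simp)
      push_cast at h3
      convert sub_mem (add_mem (hr y) h3) h5 using 1
      simp only [RingOfIntegers.coe_eq_algebraMap, map_sub, map_mul, map_pow]
      ring
    have h6 := sq_of_res p (mul_ne_zero hy0 hzy) (mul_ne_zero hx0 hzx)
      (by rw [od_mul p hy0 hzy, od_zpow, hπ]; ring) (he ▸ h4)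
    obtain ⟨j, hj⟩ : ∃ j, od p (x : K) + od p (y : K) = 2 * j := by
      rcases Int.even_or_odd' (od p (x : K)) with ⟨i, hi | hi⟩ <;>
      rcases Int.even_or_odd' (od p (y : K)) with ⟨j, hj | hj⟩ <;>
      simp only [hi, hj, Int.even_add_one, even_two, Even.mul_right, not_true, not_false_iff,
        true_iff, iff_true, false_iff, iff_false] at h1
      · exact ⟨i + j, by omega⟩
      · exact ⟨i + j + 1, by omega⟩
    rw [mem_SqG, Units.val_mul, Units.val_inv_eq_inv_val]
    have := h6.mul (Sq.sq (ab p) (π ^ j * (x : K)⁻¹))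
    convert this using 1
    have e3 : π ^ (- od p (y : K)) * π ^ (- od p (x : K)) * (π ^ j) ^ 2 = 1 := by
      rw [← zpow_natCast, ← zpow_mul, ← zpow_add₀ hπ0, ← zpow_add₀ hπ0]
      rw [show - od p (y : K) + - od p (x : K) + j * ((2 : ℕ) : ℤ) = 0 by push_cast; omega, zpow_zero]
    calc (x : K)⁻¹ * y = (x * (x : K)⁻¹) * ((x : K)⁻¹ * y) * 1 := by
          rw [mul_inv_cancel₀ hx0, one_mul, mul_one]
      _ = _ := by rw [← e3]; ring
  let g : Kˣ ⧸ SqG (ab p) → Bool × (Rˣ ⧸ sq.range) := fun x => f x.out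
  have hg : Function.Injective g := by
    intro x y hxy
    have := hf _ _ hxy
    rw [← QuotientGroup.eq] at this
    simpa using this
  have hfin : Finite (Kˣ ⧸ SqG (ab p)) := Finite.of_injective g hg
  refine ⟨Subgroup.finiteIndex_of_finite_quotient, ?_⟩
  rw [Subgroup.index_eq_card]
  refine (Nat.card_le_card_of_injective g hg).trans ?_
  rw [Nat.card_prod]
  rw [Nat.card_eq_fintype_card, Fintype.card_bool]
  omega

end local5
end QC

namespace QC
section grp
variable {Γ : Type*} [CommGroup Γ]

/-- squares -/
def KSq (Γ : Type*) [CommGroup Γ] : Subgroup Γ := (powMonoidHom 2 : Γ →* Γ).range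

theorem mem_KSq {x : Γ} : x ∈ KSq Γ ↔ ∃ y, y ^ 2 = x := Iff.rfl

theorem double (f : Γ →* Multiplicative ℤ) (G H : Subgroup Γ) (hH : ∀ x, x ∈ H ↔ x ∈ G ∧ f x = 1)
    (pure : ∀ x, x ^ 2 ∈ G → x ∈ G) {g : Γ} (hg : g ∈ G) (hfg : f g ≠ 1) :
    (KSq Γ).relIndex G = 2 * (KSq Γ).relIndex H := by
  classical
  set F : Γ → ℤ := fun x => (f x).toAdd
  have Fmul : ∀ x y, F (x * y) = F x + F y := fun x y => by simp [F]
  have Fpow : ∀ x (n : ℤ), F (x ^ n) = n * F x := fun x n => by simp [F]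
  have Fpow2 : ∀ x, F (x ^ 2) = 2 * F x := fun x => by simp [F]
  have Finv : ∀ x, F (x⁻¹) = - F x := fun x => by simp [F]
  have hF : ∀ x, f x = 1 ↔ F x = 0 := fun x => by simp [F]
  have hex : ∃ k : ℕ, 0 < k ∧ ∃ g ∈ G, F g = k := by
    rw [Ne, hF] at hfg
    rcases lt_or_gt_of_ne hfg with h | h
    · exact ⟨(F g).natAbs, by omega, g⁻¹, inv_mem hg, by rw [Finv]; omega⟩
    · exact ⟨(F g).natAbs, by omega, g, hg, by omega⟩
  obtain ⟨hk, g1, hg1, hFk⟩ := Nat.find_spec hex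
  have hmin := fun m => Nat.find_min hex (m := m)
  set k := Nat.find hex
  have hdvd : ∀ b ∈ G, ∃ j, F b = k * j := by
    intro b hb
    refine ⟨F b / k, ?_⟩
    have h1 : F (b * g1 ^ (-(F b / k))) = F b % k := by
      rw [Fmul, Fpow, hFk, Int.emod_def]; ring
    have h2 := Int.emod_nonneg (F b) (show (k : ℤ) ≠ 0 by omega)
    have h3 := Int.emod_lt_of_pos (F b) (show 0 < (k : ℤ) by omega)
    by_contra hcon
    have h4 : F b % k ≠ 0 := by
      intro h
      exact hcon (Int.mul_ediv_cancel' (Int.dvd_of_emod_eq_zero h)).symm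
    exact hmin (F b % k).toNat (by omega) ⟨by omega, _, mul_mem hb (zpow_mem hg1 _), by rw [h1]; omega⟩
  set A := (KSq Γ ⊓ G) ⊔ H
  have hHG : H ≤ G := fun x hx => ((hH x).1 hx).1
  have hA : ∀ b ∈ G, ∀ j, F b = k * j → (b ∈ A ↔ Even j) := by
    intro b hb j hj
    constructor
    · intro h
      obtain ⟨y, ⟨⟨z, hz⟩, hy⟩, h', hh, rfl⟩ := Subgroup.mem_sup.1 h
      change z ^ 2 = y at hz
      subst hz
      obtain ⟨i, hi⟩ := hdvd z (pure z hy)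
      rw [Fmul, (hF h').1 ((hH h').1 hh).2, Fpow2, hi] at hj
      refine ⟨i, ?_⟩
      have : (k : ℤ) * (i + i) = k * j := by linarith
      exact (mul_left_cancel₀ (by omega) this).symm
    · rintro ⟨i, rfl⟩
      have hm := zpow_mem hg1 i
      refine Subgroup.mem_sup.2 ⟨(g1 ^ i) ^ 2, ⟨⟨_, rfl⟩, pow_mem hm 2⟩, b * ((g1 ^ i) ^ 2)⁻¹, ?_, ?_⟩
      · rw [hH, hF, Fmul, Finv, Fpow2, Fpow, hFk, hj]
        exact ⟨mul_mem hb (inv_mem (pow_mem hm 2)), by ring⟩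
      · rw [mul_comm, inv_mul_cancel_right]
  have h2 : A.relIndex G = 2 := by
    rw [Subgroup.relIndex_eq_two_iff]
    refine ⟨g1, hg1, fun b hb => ?_⟩
    obtain ⟨j, hj⟩ := hdvd b hb
    rw [hA b hb j hj, hA (b * g1) (mul_mem hb hg1) (j + 1) (by rw [Fmul, hj, hFk]; ring)]
    rw [Int.even_add_one]
    by_cases h : Even j <;> simp [h, Xor]
  have h3 := Subgroup.relIndex_mul_relIndex (KSq Γ ⊓ G) A G le_sup_left
    (sup_le inf_le_right hHG)
  rw [Subgroup.inf_relIndex_right, h2, Subgroup.relIndex_sup_left] at h3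
  rw [← h3, mul_comm]
  congr 1
  rw [← Subgroup.inf_relIndex_right, inf_assoc, inf_eq_right.2 hHG, Subgroup.inf_relIndex_right]

end grp

section units
open NumberField IsDedekindDomain
variable (K : Type*) [Field K] [NumberField K]

theorem sq_torsion : (KSq (𝓞 K)ˣ).relIndex (Units.torsion K) = 2 := by
  have h0 : (KSq (𝓞 K)ˣ).relIndex (Units.torsion K) = (KSq (Units.torsion K)).index := by
    rw [Subgroup.relIndex]
    congr 1
    ext x
    rw [Subgroup.mem_subgroupOf, mem_KSq, mem_KSq]
    constructor
    · rintro ⟨y, hy⟩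
      have : y ∈ Units.torsion K := by
        have h := x.2
        rw [← hy] at h
        exact (isOfFinOrder_pow.1 h).resolve_right (by norm_num)
      exact ⟨⟨y, this⟩, Subtype.ext hy⟩
    · rintro ⟨y, hy⟩
      exact ⟨y, congrArg Subtype.val hy⟩
  rw [h0]
  set sq : Units.torsion K →* Units.torsion K := powMonoidHom 2
  have h1 := Subgroup.card_mul_index sq.ker
  have h2 := Subgroup.card_mul_index sq.range
  rw [Subgroup.index_ker] at h1
  rw [mul_comm, ← h1] at h2
  have h3 := Nat.eq_of_mul_eq_mul_right Nat.card_pos h2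
  rw [show KSq (Units.torsion K) = sq.range from rfl, h3]
  have hm : (-1 : (𝓞 K)ˣ) ∈ Units.torsion K := isOfFinOrder_iff_pow_eq_one.2 ⟨2, by norm_num, by simp⟩
  rw [Nat.card_eq_two_iff]
  refine ⟨⟨1, one_mem _⟩, ⟨⟨-1, hm⟩, Subtype.ext (by simp [sq])⟩, ?_, ?_⟩
  · intro h
    have h := congrArg (fun x : sq.ker => (((x : Units.torsion K) : (𝓞 K)ˣ) : 𝓞 K)) h
    simp only [OneMemClass.coe_one, Units.val_one, Units.val_neg] at h
    have : (2 : 𝓞 K) = 0 := by linear_combination h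
    norm_num at this
  · ext x
    simp only [Set.mem_insert_iff, Set.mem_singleton_iff, Set.mem_univ, iff_true]
    have hx := x.2
    have h := congrArg (fun x => (((x : Units.torsion K) : (𝓞 K)ˣ) : 𝓞 K)) (show (x : Units.torsion K) ^ 2 = 1 from hx)
    simp only [SubmonoidClass.coe_pow, Units.val_pow_eq_pow_val, OneMemClass.coe_one, Units.val_one,
      sq_eq_one_iff] at h
    rcases h with h | h
    · left; exact Subtype.ext (Subtype.ext (Units.ext h))
    · right; exact Subtype.ext (Subtype.ext (Units.ext h))

set_option maxSynthPendingDepth 3 in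
theorem sq_units : (KSq (𝓞 K)ˣ).index = 2 ^ (Fintype.card (InfinitePlace K)) := by
  classical
  let b := Units.basisModTorsion K
  let c : Fin (Units.rank K) → (𝓞 K)ˣ →* Multiplicative ℤ := fun i =>
    AddMonoidHom.toMultiplicativeRight
      ((b.coord i).toAddMonoidHom) |>.comp (QuotientGroup.mk' (Units.torsion K))
  have hc : ∀ i x, (c i x).toAdd = b.coord i (Additive.ofMul (QuotientGroup.mk x)) := fun i x => rfl
  have key : ∀ s : Finset (Fin (Units.rank K)),
      (KSq (𝓞 K)ˣ).index = 2 ^ s.card * (KSq (𝓞 K)ˣ).relIndex (⨅ i ∈ s, (c i).ker) := by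
    intro s
    induction s using Finset.induction_on with
    | empty => simp
    | insert i s hi ih =>
      rw [Finset.card_insert_of_notMem hi, ih, pow_succ, mul_assoc]
      congr 1
      refine double (c i) _ _ ?_ ?_ (g := Units.fundSystem K i) ?_ ?_
      · intro x
        rw [Finset.iInf_insert, Subgroup.mem_inf, and_comm]; rfl
      · intro x hx
        simp only [Subgroup.mem_iInf, MonoidHom.mem_ker] at hx ⊢
        intro j hj
        have := hx j hj
        rw [map_pow] at this
        exact (pow_eq_one_iff.1 this).resolve_right (by norm_num)
      · simp only [Subgroup.mem_iInf, MonoidHom.mem_ker]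
        intro j hj
        apply Multiplicative.toAdd.injective
        rw [hc, Units.fundSystem_mk]
        have : i ≠ j := by rintro rfl; exact hi hj
        simp [b, this]
      · intro h
        have := congrArg Multiplicative.toAdd h
        rw [hc, Units.fundSystem_mk] at this
        simp [b] at this
  have h := key Finset.univ
  have h2 : (⨅ i ∈ Finset.univ, (c i).ker) = Units.torsion K := by
    ext x
    simp only [Subgroup.mem_iInf, MonoidHom.mem_ker, Finset.mem_univ, true_imp_iff]
    rw [← QuotientGroup.eq_one_iff, ← ofMul_eq_zero, ← b.forall_coord_eq_zero_iff]
    rfl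
  rw [h2, sq_torsion] at h
  rw [h, Finset.card_univ, Fintype.card_fin, ← pow_succ, Units.rank]
  congr 1
  exact Nat.sub_add_cancel Fintype.card_pos
end units
end QC

namespace QC
section sunits
open NumberField IsDedekindDomain
variable {K : Type*} [Field K] [NumberField K]

theorem odu (p : HeightOneSpectrum (𝓞 K)) (x y : Kˣ) :
    od p ((x * y : Kˣ) : K) = od p (x : K) + od p (y : K) := by
  rw [Units.val_mul, od_mul p x.ne_zero y.ne_zero]

theorem odu_inv (p : HeightOneSpectrum (𝓞 K)) (x : Kˣ) :
    od p ((x⁻¹ : Kˣ) : K) = - od p (x : K) := by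
  rw [Units.val_inv_eq_inv_val, od_inv]

theorem odu_zpow (p : HeightOneSpectrum (𝓞 K)) (x : Kˣ) (n : ℤ) :
    od p ((x ^ n : Kˣ) : K) = n * od p (x : K) := by
  rw [Units.val_zpow_eq_zpow_val, od_zpow]

theorem odu_pow (p : HeightOneSpectrum (𝓞 K)) (x : Kˣ) (n : ℕ) :
    od p ((x ^ n : Kˣ) : K) = n * od p (x : K) := by
  rw [Units.val_pow_eq_pow_val, od_pow]

/-- order as a homomorphism -/
noncomputable def odH (p : HeightOneSpectrum (𝓞 K)) : Kˣ →* Multiplicative ℤ :=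
  MonoidHom.mk' (fun x => Multiplicative.ofAdd (od p (x : K))) fun x y => by rw [odu]; rfl

theorem odH_eq_one (p : HeightOneSpectrum (𝓞 K)) (x : Kˣ) : odH p x = 1 ↔ od p (x : K) = 0 :=
  ofAdd_eq_one

/-- `S`-units -/
def US (S : Set (HeightOneSpectrum (𝓞 K))) : Subgroup Kˣ where
  carrier := {x | ∀ p ∉ S, od p (x : K) = 0}
  mul_mem' := fun {x y} hx hy p hp => by rw [odu, hx p hp, hy p hp, add_zero]
  one_mem' := fun p _ => by simp
  inv_mem' := fun {x} hx p hp => by rw [odu_inv, hx p hp, neg_zero]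

theorem mem_US {S : Set (HeightOneSpectrum (𝓞 K))} {x : Kˣ} :
    x ∈ US S ↔ ∀ p ∉ S, od p (x : K) = 0 := Iff.rfl

theorem US_mono {S T : Set (HeightOneSpectrum (𝓞 K))} (h : S ⊆ T) : US S ≤ US T :=
  fun _ hx p hp => hx p fun h' => hp (h h')

theorem US_pure {S : Set (HeightOneSpectrum (𝓞 K))} {x : Kˣ} (h : x ^ 2 ∈ US S) : x ∈ US S := by
  intro p hp
  have := h p hp
  rw [odu_pow] at this
  push_cast at this
  omega

theorem int_of_od {x : K} (h : ∀ p : HeightOneSpectrum (𝓞 K), 0 ≤ od p x) :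
    ∃ r : 𝓞 K, algebraMap (𝓞 K) K r = x := by
  by_cases hx : x = 0
  · exact ⟨0, by rw [hx, map_zero]⟩
  · refine HeightOneSpectrum.mem_integers_of_valuation_le_one K x fun p => ?_
    have := (mem_PW p hx).2 (h p)
    rw [mem_PW'] at this
    simpa using this

theorem int_od (p : HeightOneSpectrum (𝓞 K)) {r : 𝓞 K} (hr : r ≠ 0) (n : ℕ) :
    (n : ℤ) ≤ od p (algebraMap (𝓞 K) K r) ↔ r ∈ p.asIdeal ^ n := by
  rw [← int_mem_PW, mem_PW]
  simpa using hr

theorem int_od_nonneg (p : HeightOneSpectrum (𝓞 K)) {r : 𝓞 K} (hr : r ≠ 0) :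
    0 ≤ od p (algebraMap (𝓞 K) K r) := by
  have := (int_od p hr 0).2 (by simp)
  simpa using this

theorem int_od_zero (p : HeightOneSpectrum (𝓞 K)) {r : 𝓞 K} (hr : r ≠ 0) :
    od p (algebraMap (𝓞 K) K r) = 0 ↔ r ∉ p.asIdeal := by
  have h1 := int_od_nonneg p hr
  have h2 := int_od p hr 1
  rw [pow_one] at h2
  rw [← h2]
  push_cast
  omega

theorem US_empty : US (∅ : Set (HeightOneSpectrum (𝓞 K))) =
    (⊤ : Subgroup (𝓞 K)ˣ).map (Units.map (algebraMap (𝓞 K) K).toMonoidHom) := by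
  ext x
  simp only [Subgroup.mem_map, Subgroup.mem_top, true_and]
  constructor
  · intro hx
    obtain ⟨r, hr⟩ := int_of_od (x := (x : K)) fun p => (hx p (by simp)).ge
    obtain ⟨s, hs⟩ := int_of_od (x := ((x⁻¹ : Kˣ) : K)) fun p => by rw [odu_inv, hx p (by simp)]; simp
    have : r * s = 1 := by
      apply FaithfulSMul.algebraMap_injective (𝓞 K) K
      rw [map_mul, hr, hs, map_one, Units.mul_inv]
    exact ⟨⟨r, s, this, by rw [mul_comm, this]⟩, Units.ext hr⟩
  · rintro ⟨u, rfl⟩ p _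
    have : od p (algebraMap (𝓞 K) K u) = 0 := by
      rw [int_od_zero p u.ne_zero]
      intro h
      exact p.isPrime.ne_top (Ideal.eq_top_of_isUnit_mem _ h u.isUnit)
    exact this

theorem sq_US_empty : (KSq Kˣ).relIndex (US (∅ : Set (HeightOneSpectrum (𝓞 K)))) =
    2 ^ Fintype.card (InfinitePlace K) := by
  rw [US_empty, ← Subgroup.relIndex_comap, Subgroup.relIndex_top_right, ← sq_units]
  congr 1
  ext u
  rw [Subgroup.mem_comap, mem_KSq, mem_KSq]
  constructor
  · rintro ⟨y, hy⟩
    have h1 : y ∈ US (∅ : Set (HeightOneSpectrum (𝓞 K))) := by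
      apply US_pure
      rw [hy, US_empty]
      exact ⟨u, trivial, rfl⟩
    rw [US_empty] at h1
    obtain ⟨w, -, rfl⟩ := h1
    refine ⟨w, Units.map_injective (f := (algebraMap (𝓞 K) K).toMonoidHom)
      (FaithfulSMul.algebraMap_injective (𝓞 K) K) ?_⟩
    rw [map_pow, hy]
  · rintro ⟨y, rfl⟩
    exact ⟨Units.map (algebraMap (𝓞 K) K).toMonoidHom y, by rw [map_pow]⟩

theorem prime_le {p q : HeightOneSpectrum (𝓞 K)} (h : p.asIdeal ≤ q.asIdeal) : p = q := by
  apply HeightOneSpectrum.ext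
  have := p.isMaximal
  exact this.eq_of_le q.isPrime.ne_top h

theorem exists_gen (p : HeightOneSpectrum (𝓞 K)) : ∃ g : Kˣ, od p (g : K) ≠ 0 ∧
    ∀ q, q ≠ p → od q (g : K) = 0 := by
  set h := Fintype.card (ClassGroup (𝓞 K))
  have hh : h ≠ 0 := Fintype.card_ne_zero
  let I : nonZeroDivisors (Ideal (𝓞 K)) := ⟨p.asIdeal, mem_nonZeroDivisors_of_ne_zero p.ne_bot⟩
  have h1 : ClassGroup.mk0 (I ^ h) = 1 := by rw [map_pow, pow_card_eq_one]
  rw [ClassGroup.mk0_eq_one_iff] at h1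
  obtain ⟨g, hg⟩ := h1
  have hg : p.asIdeal ^ h = Ideal.span {g} := hg
  have hg0 : g ≠ 0 := by
    rintro rfl
    rw [Ideal.span_singleton_eq_bot.2 rfl] at hg
    exact pow_ne_zero h p.ne_bot hg
  have hgK : algebraMap (𝓞 K) K g ≠ 0 := by simpa using hg0
  refine ⟨Units.mk0 _ hgK, ?_, fun q hq => ?_⟩
  · have := (int_od p hg0 h).2 (by rw [hg]; exact Ideal.mem_span_singleton_self g)
    rw [Units.val_mk0]
    omega
  · rw [Units.val_mk0, int_od_zero q hg0]
    intro hgq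
    rw [← Ideal.span_singleton_le_iff_mem, ← hg] at hgq
    exact hq (prime_le (q.isPrime.le_of_pow_le hgq)).symm

theorem SU {S : Set (HeightOneSpectrum (𝓞 K))} (hS : S.Finite) :
    (KSq Kˣ).relIndex (US S) = 2 ^ (S.ncard + Fintype.card (InfinitePlace K)) := by
  induction S, hS using Set.Finite.induction_on with
  | empty => rw [sq_US_empty]; simp
  | @insert p S hp hS ih =>
    obtain ⟨g, hg, hg'⟩ := exists_gen p
    rw [double (odH p) (US (insert p S)) (US S) ?_ ?_ (g := g) ?_ ?_, ih, Set.ncard_insert_of_notMem hp hS]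
    · ring
    · intro x
      rw [odH_eq_one]
      constructor
      · exact fun h => ⟨US_mono (Set.subset_insert p S) h, h p hp⟩
      · rintro ⟨h1, h2⟩ q hq
        by_cases hqp : q = p
        · rw [hqp, h2]
        · exact h1 q fun h => h.elim hqp hq
    · exact fun x => US_pure
    · exact fun q hq => hg' q fun h => hq (h ▸ Set.mem_insert _ _)
    · rwa [Ne, odH_eq_one]

theorem supp_int {I : Ideal (𝓞 K)} (hI : I ≠ 0) :
    {p : HeightOneSpectrum (𝓞 K) | I ≤ p.asIdeal}.Finite := by
  have := Ideal.finite_factors hI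
  simpa only [Ideal.dvd_iff_le] using this

theorem supp_fin {x : K} (hx : x ≠ 0) : {p : HeightOneSpectrum (𝓞 K) | od p x ≠ 0}.Finite := by
  obtain ⟨r, s, hs, rfl⟩ := IsFractionRing.div_surjective (A := 𝓞 K) x
  have hs0 : s ≠ 0 := nonZeroDivisors.ne_zero hs
  have hr0 : r ≠ 0 := by rintro rfl; simp at hx
  have h1 := supp_int (I := Ideal.span {r}) (by simpa using hr0)
  have h2 := supp_int (I := Ideal.span {s}) (by simpa using hs0)
  refine (h1.union h2).subset fun p hp => ?_
  by_contra hcon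
  simp only [Set.mem_union, Set.mem_setOf_eq, Ideal.span_singleton_le_iff_mem, not_or] at hcon
  apply hp
  rw [od_div p (by simpa using hr0) (by simpa using hs0), (int_od_zero p hr0).2 hcon.1,
    (int_od_zero p hs0).2 hcon.2, sub_zero]

/-- `S` kills the class group -/
def CS (S : Set (HeightOneSpectrum (𝓞 K))) : Prop :=
  ∀ p ∉ S, ∃ x : Kˣ, od p (x : K) = 1 ∧ ∀ q ∉ S, q ≠ p → od q (x : K) = 0

theorem CS.mono {S T : Set (HeightOneSpectrum (𝓞 K))} (h : S ⊆ T) (hS : CS S) : CS T := by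
  intro p hp
  obtain ⟨x, h1, h2⟩ := hS p fun h' => hp (h h')
  exact ⟨x, h1, fun q hq => h2 q fun h' => hq (h h')⟩

theorem CS_exists (K : Type*) [Field K] [NumberField K] :
    ∃ S : Set (HeightOneSpectrum (𝓞 K)), S.Finite ∧ CS S := by
  choose I hI using fun c : ClassGroup (𝓞 K) => ClassGroup.mk0_surjective c
  refine ⟨⋃ c, {p | (I c : Ideal (𝓞 K)) ≤ p.asIdeal}, ?_, ?_⟩
  · exact Set.finite_iUnion fun c => supp_int (nonZeroDivisors.ne_zero (I c).2)
  · intro p hp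
    let P : nonZeroDivisors (Ideal (𝓞 K)) := ⟨p.asIdeal, mem_nonZeroDivisors_of_ne_zero p.ne_bot⟩
    obtain ⟨c, hc⟩ : ∃ c, c = (ClassGroup.mk0 P)⁻¹ := ⟨_, rfl⟩
    have h1 : ClassGroup.mk0 (P * I c) = 1 := by rw [map_mul, hI, hc, mul_inv_cancel]
    rw [ClassGroup.mk0_eq_one_iff] at h1
    obtain ⟨g, hg⟩ := h1
    have hg : p.asIdeal * (I c : Ideal (𝓞 K)) = Ideal.span {g} := hg
    have hgm : g ∈ p.asIdeal * (I c : Ideal (𝓞 K)) := by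
      rw [hg]; exact Ideal.mem_span_singleton_self g
    have hI0 : (I c : Ideal (𝓞 K)) ≠ 0 := nonZeroDivisors.ne_zero (I c).2
    have hg0 : g ≠ 0 := by
      rintro rfl
      rw [Ideal.span_singleton_eq_bot.2 rfl] at hg
      exact mul_ne_zero p.ne_bot hI0 hg
    have hgK : algebraMap (𝓞 K) K g ≠ 0 := by simpa using hg0
    refine ⟨Units.mk0 _ hgK, ?_, fun q hqS hq => ?_⟩
    · rw [Units.val_mk0]
      have h1 := (int_od p hg0 1).2 (by
        rw [pow_one]; exact Ideal.mul_le_left (I := p.asIdeal) (J := (I c : Ideal (𝓞 K))) hgm)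
      have h2 : ¬ ((2 : ℕ) : ℤ) ≤ od p (algebraMap (𝓞 K) K g) := by
        rw [int_od p hg0, ← Ideal.span_singleton_le_iff_mem, ← hg, ← Ideal.dvd_iff_le, pow_two,
          mul_dvd_mul_iff_left p.ne_bot, Ideal.dvd_iff_le]
        exact fun h => hp (Set.mem_iUnion.2 ⟨c, h⟩)
      push_cast at h1 h2
      omega
    · rw [Units.val_mk0, int_od_zero q hg0, ← Ideal.span_singleton_le_iff_mem, ← hg]
      intro h
      rcases q.isPrime.mul_le.1 h with h | h
      · exact hq (prime_le h).symm
      · exact hqS (Set.mem_iUnion.2 ⟨c, h⟩)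

theorem CS.adj {S : Set (HeightOneSpectrum (𝓞 K))} (hS : CS S) (n : HeightOneSpectrum (𝓞 K) → ℤ)
    (hn : {p | p ∉ S ∧ n p ≠ 0}.Finite) : ∃ z : Kˣ, ∀ p ∉ S, od p (z : K) = n p := by
  classical
  choose x hx hx' using hS
  have key : ∀ T : Finset (HeightOneSpectrum (𝓞 K)), ∃ z : Kˣ, ∀ p ∉ S,
      od p (z : K) = if p ∈ T then n p else 0 := by
    intro T
    induction T using Finset.induction_on with
    | empty => exact ⟨1, by simp⟩
    | insert q T hq ih =>
      obtain ⟨z, hz⟩ := ih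
      by_cases hqS : q ∈ S
      · refine ⟨z, fun p hp => ?_⟩
        have : p ≠ q := by rintro rfl; exact hp hqS
        rw [hz p hp]; simp [this]
      · refine ⟨z * x q hqS ^ n q, fun p hp => ?_⟩
        rw [odu, odu_zpow, hz p hp]
        by_cases hpq : p = q
        · subst hpq; simp [hq, hx p hp]
        · simp [hpq, hx' q hqS p hp hpq]
  obtain ⟨z, hz⟩ := key hn.toFinset
  refine ⟨z, fun p hp => ?_⟩
  rw [hz p hp]
  by_cases h : n p = 0 <;> simp [h, hp]

theorem CS.even {S : Set (HeightOneSpectrum (𝓞 K))} (hS : CS S) (y : Kˣ)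
    (hy : ∀ p ∉ S, Even (od p (y : K))) : ∃ z : Kˣ, y * z ^ 2 ∈ US S := by
  obtain ⟨z, hz⟩ := hS.adj (fun p => - (od p (y : K) / 2)) ((supp_fin y.ne_zero).subset fun p hp => by
    rintro h; apply hp.2; rw [h]; rfl)
  refine ⟨z, fun p hp => ?_⟩
  obtain ⟨j, hj⟩ := hy p hp
  rw [odu, odu_pow, hz p hp]
  push_cast
  omega
end sunits
end QC

namespace QC
section places
open NumberField IsDedekindDomain
variable {K : Type*} [Field K] [NumberField K]

theorem ab_lt (p : HeightOneSpectrum (𝓞 K)) {x : K} (hx : x ≠ 0) : ab p x < 1 ↔ 0 < od p x := by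
  have h := (ab_le p 0 x⁻¹)
  rw [mem_PW p (inv_ne_zero hx), od_inv, neg_zero, zpow_zero, map_inv₀,
    inv_le_one₀ ((ab p).pos hx)] at h
  rw [← not_le, ← h]
  omega

variable (K) in
/-- places -/
abbrev Pl := HeightOneSpectrum (𝓞 K) ⊕ InfinitePlace K

/-- absolute value of a place -/
noncomputable def av : Pl K → AbsoluteValue K ℝ := Sum.elim ab fun w => w.1

theorem inf_nat (w : InfinitePlace K) (n : ℕ) : w.1 (n : K) = n := by
  have := w.norm_embedding_eq (n : K)
  rw [map_natCast] at this
  change w (n : K) = n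
  rw [← this]; simp

theorem av_nontriv (v : Pl K) : (av v).IsNontrivial := by
  rcases v with p | w
  · obtain ⟨g, hg, -⟩ := exists_gen p
    rcases lt_or_gt_of_ne hg with h | h
    · exact ⟨(g : K)⁻¹, by simp, ((ab_lt p (by simp)).2 (by rw [od_inv]; omega)).ne⟩
    · exact ⟨g, by simp, ((ab_lt p (by simp)).2 h).ne⟩
  · exact w.isNontrivial

theorem av_ne {v w : Pl K} (h : v ≠ w) : ¬ (av v).IsEquiv (av w) := by
  intro hh
  have key : ∀ (p : HeightOneSpectrum (𝓞 K)) (w : InfinitePlace K), ¬ (ab p).IsEquiv w.1 := by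
    intro p w hh
    rw [AbsoluteValue.isEquiv_iff_lt_one_iff] at hh
    have h1 := (hh (2 : K)⁻¹).2 (by
      rw [map_inv₀, show (2 : K) = ((2 : ℕ) : K) by norm_num, inf_nat]; norm_num)
    rw [ab_lt p (by norm_num), od_inv] at h1
    have := od2 p
    omega
  rcases v with p | v <;> rcases w with q | w
  · obtain ⟨g, hg, hg'⟩ := exists_gen p
    have hq := hg' q (by rintro rfl; exact h rfl)
    have h2 : ab q (g : K) < 1 ↔ ab p (g : K) < 1 := ((AbsoluteValue.isEquiv_iff_lt_one_iff.1 hh) g).symm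
    have h3 : ab q ((g⁻¹ : Kˣ) : K) < 1 ↔ ab p ((g⁻¹ : Kˣ) : K) < 1 :=
      ((AbsoluteValue.isEquiv_iff_lt_one_iff.1 hh) ((g⁻¹ : Kˣ) : K)).symm
    rw [ab_lt _ (by simp), ab_lt _ (by simp)] at h2 h3
    rw [odu_inv, odu_inv] at h3
    omega
  · exact key p w hh
  · exact key q v hh.symm
  · exact h (congrArg _ (InfinitePlace.eq_iff_isEquiv.2 hh))

theorem sq_real {w : InfinitePlace K} (hw : w.IsReal) {x : K} :
    Sq w.1 x ↔ 0 ≤ InfinitePlace.embedding_of_isReal hw x := by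
  have hn : ∀ x, w.1 x = |InfinitePlace.embedding_of_isReal hw x| := fun x =>
    (InfinitePlace.norm_embedding_of_isReal hw x).symm
  set φ := InfinitePlace.embedding_of_isReal hw
  constructor
  · intro h
    by_contra hcon
    push Not at hcon
    obtain ⟨y, hy⟩ := h (-φ x) (by linarith)
    rw [hn, map_sub, map_pow, abs_lt] at hy
    nlinarith [sq_nonneg (φ y)]
  · intro h ε hε
    obtain ⟨r, hr⟩ : ∃ r : ℚ, |φ x - (r : ℝ) ^ 2| < ε := by
      have hc : Continuous fun t : ℝ => |φ x - t ^ 2| := by fun_prop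
      have ho : IsOpen {t : ℝ | |φ x - t ^ 2| < ε} := isOpen_lt hc continuous_const
      obtain ⟨r, hr⟩ := Rat.denseRange_cast (𝕜 := ℝ).exists_mem_open ho
        ⟨√(φ x), by simp [Real.sq_sqrt h, hε]⟩
      exact ⟨r, hr⟩
    exact ⟨r, by rw [hn]; simpa using hr⟩

theorem Sq_of_dense {K C : Type*} [Field K] [NormedField C] {v : AbsoluteValue K ℝ} (i : K →+* C)
    (hd : DenseRange i) (hi : ∀ x, ‖i x‖ = v x) {x : K} {y : C} (hy : y ^ 2 = i x) : Sq v x := by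
  intro ε hε
  have ho : IsOpen {t : C | ‖i x - t ^ 2‖ < ε} := isOpen_lt (by fun_prop) continuous_const
  obtain ⟨r, hr⟩ := hd.exists_mem_open ho ⟨y, by simp [hy, hε]⟩
  refine ⟨r, ?_⟩
  rw [← hi, map_sub, map_pow]
  exact hr

theorem inf_dense (w : InfinitePlace K) : DenseRange (algebraMap K w.Completion) := by
  have := (InfinitePlace.Completion.denseRange_coe w)
  have h2 : Set.range (algebraMap K w.Completion) = Set.range ((↑) : WithAbs w.1 → w.Completion) := by
    ext x
    constructor
    · rintro ⟨y, rfl⟩; exact ⟨WithAbs.toAbs _ y, rfl⟩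
    · rintro ⟨y, rfl⟩; exact ⟨WithAbs.equiv _ y, rfl⟩
  rwa [DenseRange, h2]

theorem inf_norm (w : InfinitePlace K) (x : K) : ‖algebraMap K w.Completion x‖ = w.1 x :=
  InfinitePlace.Completion.norm_coe w (WithAbs.toAbs _ x)

theorem sq_cx {w : InfinitePlace K} (hw : w.IsComplex) (x : K) : Sq w.1 x := by
  obtain ⟨z, hz⟩ := IsAlgClosed.exists_pow_nat_eq
    (InfinitePlace.Completion.extensionEmbedding w (algebraMap K w.Completion x)) (n := 2) (by norm_num)
  obtain ⟨y, rfl⟩ := InfinitePlace.Completion.surjective_extensionEmbedding_of_isComplex hw z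
  rw [← map_pow] at hz
  exact Sq_of_dense (algebraMap K w.Completion) (inf_dense w) (inf_norm w) (RingHom.injective _ hz)

/-- nontriviality of local norms -/
theorem LN (v : Pl K) {a : K} (ha : a ≠ 0) (h : ¬ Sq (av v) a) : ∃ b : Kˣ, b ∉ NV (av v) a := by
  rcases v with p | w
  · exact LNfin p ha h
  · have h : ¬ Sq w.1 a := h
    by_cases hw : w.IsReal
    · rw [sq_real hw] at h
      refine ⟨-1, fun hb => ?_⟩
      obtain ⟨n, ⟨x, y, hn⟩, s, hs, hns⟩ := mem_NV.1 hb
      have hs := (sq_real hw).1 hs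
      set φ := InfinitePlace.embedding_of_isReal hw
      have h1 : φ n = φ x ^ 2 - φ a * φ y ^ 2 := by rw [hn]; simp
      have h2 : φ n * φ s = -1 := by rw [← map_mul, ← Units.val_mul, hns]; simp
      have h3 : 0 ≤ φ n := by rw [h1]; nlinarith [sq_nonneg (φ x), sq_nonneg (φ y)]
      nlinarith [mul_nonneg h3 hs]
    · exact (h (sq_cx (InfinitePlace.not_isReal_iff_isComplex.1 hw) a)).elim

theorem LSinf (w : InfinitePlace K) : (SqG w.1).index ≠ 0 ∧ (SqG w.1).index * 2 ^ w.mult ≤ 4 := by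
  by_cases hw : w.IsReal
  · have : (SqG w.1).index ∣ 2 := by
      set φ := InfinitePlace.embedding_of_isReal hw
      have h : ∀ x y : Kˣ, x ∉ SqG w.1 → y ∉ SqG w.1 → x * y ∈ SqG w.1 := by
        intro x y hx hy
        rw [mem_SqG, sq_real hw, not_le] at hx hy
        rw [mem_SqG, sq_real hw, Units.val_mul, map_mul]
        exact (mul_pos_of_neg_of_neg hx hy).le
      by_cases ht : ∃ a, a ∉ SqG w.1
      · obtain ⟨a, ha⟩ := ht
        rw [Subgroup.index_eq_two_iff.2 ⟨a, fun b => ?_⟩]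
        by_cases hb : b ∈ SqG w.1
        · right; exact ⟨hb, fun h' => ha ((Subgroup.mul_mem_cancel_left _ hb).1 h')⟩
        · left; exact ⟨h b a hb ha, hb⟩
      · push Not at ht
        rw [Subgroup.index_eq_one.2 (eq_top_iff.2 fun x _ => ht x)]
        simp
    have h1 := Nat.le_of_dvd (by norm_num) this
    rw [InfinitePlace.mult_isReal ⟨w, hw⟩]
    refine ⟨?_, by omega⟩
    rintro h; rw [h] at this; simp at this
  · have hw := (InfinitePlace.not_isReal_iff_isComplex.1 hw)
    have h1 : SqG w.1 = ⊤ := eq_top_iff.2 fun x _ => sq_cx hw x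
    rw [Subgroup.index_eq_one.2 h1, InfinitePlace.mult_isComplex ⟨w, hw⟩]
    simp

theorem SqG_fin (v : Pl K) : (SqG (av v)).FiniteIndex := by
  rcases v with p | w
  · exact (LSfin p).1
  · exact ⟨(LSinf w).1⟩

theorem NV_fin (v : Pl K) (a : K) : (NV (av v) a).FiniteIndex := by
  have := SqG_fin v
  exact Subgroup.finiteIndex_of_le (H := SqG (av v)) le_sup_right

/-- places in `S` and infinite places -/
def PS (S : Set (HeightOneSpectrum (𝓞 K))) : Set (Pl K) := Sum.inl '' S ∪ Set.range Sum.inr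

theorem PS_inl {S : Set (HeightOneSpectrum (𝓞 K))} {p} : (Sum.inl p : Pl K) ∈ PS S ↔ p ∈ S := by
  simp [PS]

theorem PS_inr {S : Set (HeightOneSpectrum (𝓞 K))} (w) : (Sum.inr w : Pl K) ∈ PS S := by
  simp [PS]

theorem PS_fin {S : Set (HeightOneSpectrum (𝓞 K))} (hS : S.Finite) : (PS S).Finite :=
  (hS.image _).union (Set.finite_range _)

theorem PS_card {S : Set (HeightOneSpectrum (𝓞 K))} (hS : S.Finite) :
    (PS S).ncard = S.ncard + Fintype.card (InfinitePlace K) := by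
  rw [PS, Set.ncard_union_eq _ (hS.image _) (Set.finite_range _), Set.ncard_image_of_injective _ Sum.inl_injective,
    ← Set.image_univ, Set.ncard_image_of_injective _ Sum.inr_injective, Set.ncard_univ, Nat.card_eq_fintype_card]
  rw [Set.disjoint_left]
  rintro _ ⟨x, _, rfl⟩ ⟨y, hy⟩
  cases hy

theorem approx_Pl {B : Set (Pl K)} (hB : B.Finite) (x : Pl K → Kˣ) :
    ∃ y : Kˣ, ∀ v ∈ B, x v * y ∈ SqG (av v) := by
  have := hB.to_subtype
  obtain ⟨y, hy⟩ := weak_approx_unit (v := fun v : B => av v.1) (fun i => av_nontriv _)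
    (fun i j h => av_ne fun h' => h (Subtype.ext h')) fun v => x v.1
  exact ⟨y, fun v hv => hy ⟨v, hv⟩⟩

theorem index_pi {G ι : Type*} [CommGroup G] [Fintype ι] (N : ι → Subgroup G)
    (h : ∀ x : ι → G, ∃ y, ∀ i, (x i)⁻¹ * y ∈ N i) : (⨅ i, N i).index = ∏ i, (N i).index := by
  let f : G →* ∀ i, G ⧸ N i := Pi.monoidHom fun v => QuotientGroup.mk' _
  have hk : f.ker = ⨅ i, N i := by
    ext x
    simp only [MonoidHom.mem_ker, Subgroup.mem_iInf, funext_iff]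
    exact forall_congr' fun v => QuotientGroup.eq_one_iff x
  have hs : Function.Surjective f := by
    intro g
    choose x hx using fun v => QuotientGroup.mk_surjective (g v)
    obtain ⟨y, hy⟩ := h x
    refine ⟨y, funext fun v => ?_⟩
    rw [← hx v]
    exact (QuotientGroup.eq.2 (hy v)).symm
  rw [← hk, Subgroup.index_eq_card]
  simp only [Subgroup.index_eq_card]
  rw [← Nat.card_pi]
  exact Nat.card_congr (QuotientGroup.quotientKerEquivOfSurjective f hs).toEquiv

theorem LB {B : Set (Pl K)} (hB : B.Finite) {a : K} (ha : a ≠ 0) (h : ∀ v ∈ B, ¬ Sq (av v) a) :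
    2 ^ B.ncard ≤ (⨅ v ∈ B, NV (av v) a).index := by
  classical
  have := hB.fintype
  rw [iInf_subtype', index_pi (fun v : B => NV (av v.1) a), Set.ncard_eq_toFinset_card',
    Set.toFinset_card, ← Finset.card_univ, ← Finset.prod_const]
  swap
  · intro x
    obtain ⟨y, hy⟩ := approx_Pl hB fun v => if hv : v ∈ B then (x ⟨v, hv⟩)⁻¹ else 1
    refine ⟨y, fun v => ?_⟩
    have := hy v v.2
    rw [dif_pos v.2] at this
    exact (le_sup_right : SqG (av v.1) ≤ NV (av v.1) a) this
  refine Finset.prod_le_prod' fun v _ => ?_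
  have h0 := (NV_fin v.1 a).index_ne_zero
  have h1 : (NV (av v.1) a).index ≠ 1 := by
    rw [Ne, Subgroup.index_eq_one]
    intro ht
    obtain ⟨b, hb⟩ := LN v.1 ha (h v.1 v.2)
    exact hb (ht ▸ Subgroup.mem_top b)
  omega

theorem norm_two {S : Set (HeightOneSpectrum (𝓞 K))} [Fintype S] :
    ∏ p : S, Ideal.absNorm p.1.asIdeal ^ (od p.1 (2 : K)).toNat ≤ 2 ^ Module.finrank ℚ K := by
  have h1 : ∏ p : S, p.1.asIdeal ^ (od p.1 (2 : K)).toNat ∣ Ideal.span {(2 : 𝓞 K)} := by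
    refine Finset.prod_dvd_of_coprime ?_ ?_
    · intro p _ q _ hpq
      refine IsCoprime.pow ?_
      have := p.1.isMaximal
      rw [Ideal.isCoprime_iff_sup_eq]
      exact Ideal.IsMaximal.coprime_of_ne p.1.isMaximal q.1.isMaximal fun h =>
        hpq (Subtype.ext (HeightOneSpectrum.ext h))
    · intro p _
      rw [Ideal.dvd_iff_le, Ideal.span_singleton_le_iff_mem, ← int_od p.1 two_ne_zero,
        Int.toNat_of_nonneg (od2 p.1), map_ofNat]
  have h2 := map_dvd Ideal.absNorm h1
  rw [map_prod] at h2
  simp only [map_pow] at h2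
  have h3 : Ideal.absNorm (Ideal.span {(2 : 𝓞 K)}) = 2 ^ Module.finrank ℚ K := by
    rw [Ideal.absNorm_span_singleton, show (2 : 𝓞 K) = algebraMap ℤ (𝓞 K) 2 by simp,
      Algebra.norm_algebraMap, Int.natAbs_pow, RingOfIntegers.rank]
    rfl
  rw [h3] at h2
  exact Nat.le_of_dvd (by positivity) h2

theorem LS {S : Set (HeightOneSpectrum (𝓞 K))} (hS : S.Finite) :
    (⨅ v ∈ PS S, SqG (av v)).FiniteIndex ∧
    (⨅ v ∈ PS S, SqG (av v)).index ≤ 4 ^ (S.ncard + Fintype.card (InfinitePlace K)) := by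
  classical
  have := hS.fintype
  have e : (⨅ v ∈ PS S, SqG (av v)) =
      ⨅ i : S ⊕ InfinitePlace K, SqG (av (Sum.map (fun p : S => p.1) id i)) := by
    ext x
    simp only [Subgroup.mem_iInf, Sum.forall, Sum.map_inl, Sum.map_inr, PS_inl, Subtype.forall, id]
    simp [PS_inr]
  rw [e]
  refine ⟨Subgroup.finiteIndex_iInf fun i => SqG_fin _, (Subgroup.index_iInf_le _).trans ?_⟩
  rw [Fintype.prod_sum_type]
  have h1 : ∏ p : S, (SqG (ab p.1)).index ≤ 4 ^ S.ncard * 2 ^ Module.finrank ℚ K := by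
    refine (Finset.prod_le_prod' fun p _ => (LSfin p.1).2).trans ?_
    rw [Finset.prod_mul_distrib, Finset.prod_const, Finset.card_univ, Set.ncard_eq_toFinset_card',
      Set.toFinset_card]
    exact Nat.mul_le_mul_left _ norm_two
  have h2 : (∏ w : InfinitePlace K, (SqG w.1).index) * 2 ^ Module.finrank ℚ K ≤
      4 ^ Fintype.card (InfinitePlace K) := by
    rw [← InfinitePlace.sum_mult_eq, ← Finset.prod_pow_eq_pow_sum, ← Finset.prod_mul_distrib,
      ← Finset.card_univ, ← Finset.prod_const]
    exact Finset.prod_le_prod' fun w _ => (LSinf w).2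
  calc _ ≤ (4 ^ S.ncard * 2 ^ Module.finrank ℚ K) * (∏ w : InfinitePlace K, (SqG w.1).index) :=
        Nat.mul_le_mul_right _ h1
    _ = 4 ^ S.ncard * ((∏ w : InfinitePlace K, (SqG w.1).index) * 2 ^ Module.finrank ℚ K) := by ring
    _ ≤ _ := by rw [pow_add]; exact Nat.mul_le_mul_left _ h2
end places
end QC

namespace QC
section above
open NumberField IsDedekindDomain
variable {K : Type*} [Field K] [NumberField K]

theorem wa {B : Set (Pl K)} (hB : B.Finite) (x : Pl K → K) (ε : Pl K → ℝ) (hε : ∀ v, 0 < ε v) :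
    ∃ y : K, ∀ v ∈ B, av v (y - x v) < ε v := by
  have := hB.to_subtype
  obtain ⟨y, hy⟩ := weak_approx (v := fun v : B => av v.1) (fun i => av_nontriv _)
    (fun i j hij => av_ne fun h => hij (Subtype.ext h)) (fun v => x v) (fun v => ε v) fun v => hε v
  exact ⟨y, fun v hv => hy ⟨v, hv⟩⟩

variable {L : Type*} [Field L] [NumberField L] [Algebra K L]

noncomputable def pi (K : Type*) [Field K] [NumberField K] [Algebra K L] : Pl L → Pl K :=
  Sum.map (fun P => P.under (𝓞 K)) fun w => w.comap (algebraMap K L)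

theorem od_over (P : HeightOneSpectrum (𝓞 L)) : ∃ e : ℕ, 0 < e ∧ ∀ x : K,
    od P (algebraMap K L x) = e * od (P.under (𝓞 K)) x := by
  have : P.asIdeal.LiesOver (P.under (𝓞 K)).asIdeal := ⟨rfl⟩
  refine ⟨_, pos_of_ne_zero (Ideal.IsDedekindDomain.ramificationIdx'_ne_zero_of_liesOver P.asIdeal
    (P.under (𝓞 K)).ne_bot), fun x => ?_⟩
  rw [od, ← HeightOneSpectrum.valuation_liesOver L (P.under (𝓞 K)) P x, WithZero.log_pow, od]
  simp

theorem pi_av (w : Pl L) : ∃ t : ℝ, 0 < t ∧ ∀ x : K, av (pi K w) x ^ t = av w (algebraMap K L x) := by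
  rcases w with P | w
  · have : (ab (P.under (𝓞 K))).IsEquiv ((ab P).comp (algebraMap K L).injective) := by
      rw [AbsoluteValue.isEquiv_iff_lt_one_iff]
      intro x
      obtain ⟨e, he, h⟩ := od_over (K := K) P
      by_cases hx : x = 0
      · simp [hx]
      rw [ab_lt _ hx]
      change _ ↔ ab P (algebraMap K L x) < 1
      rw [ab_lt _ (by simpa using hx), h]
      have : (0 : ℤ) < e := by exact_mod_cast he
      constructor
      · intro h; positivity
      · intro h; exact pos_of_mul_pos_right h this.le
    obtain ⟨t, ht, h⟩ := AbsoluteValue.isEquiv_iff_exists_rpow_eq.1 this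
    exact ⟨t, ht, fun x => congrFun h x⟩
  · exact ⟨1, one_pos, fun x => by rw [Real.rpow_one]; rfl⟩

theorem pi_surj (v : Pl K) : ∃ w : Pl L, pi K w = v := by
  rcases v with p | v
  · obtain ⟨Q, hQ, h⟩ := p.asIdeal.exists_ideal_over_prime_of_isIntegral_of_isDomain (S := 𝓞 L) (by simp)
    refine ⟨Sum.inl ⟨Q, hQ, ?_⟩, ?_⟩
    · rintro rfl
      apply p.ne_bot
      rw [← h, ← RingHom.ker_eq_comap_bot, RingHom.ker_eq_bot_iff_eq_zero]
      simp
    · simp only [pi, Sum.map_inl]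
      congr 1
      exact HeightOneSpectrum.ext h
  · obtain ⟨w, hw⟩ := InfinitePlace.comap_surjective (K := L) v
    exact ⟨Sum.inr w, by simp [pi, hw]⟩

theorem od_tau (τ : L ≃ₐ[K] L) (P : HeightOneSpectrum (𝓞 L)) : ∃ Q : HeightOneSpectrum (𝓞 L),
    (∀ x, od Q x = od P (τ x)) ∧ ∀ x, ab Q x = ab P (τ x) := by
  let e : 𝓞 L ≃+* 𝓞 L := RingOfIntegers.mapRingEquiv τ.toRingEquiv
  have he : ∀ r : 𝓞 L, algebraMap (𝓞 L) L (e r) = τ (algebraMap (𝓞 L) L r) := fun r => rfl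
  let Q := HeightOneSpectrum.comap (e : 𝓞 L →+* 𝓞 L) e.surjective P
  have hQ : P.asIdeal = Q.asIdeal.map (e : 𝓞 L →+* 𝓞 L) :=
    (Ideal.map_comap_of_surjective _ e.surjective _).symm
  have hm : ∀ r n, e r ∈ P.asIdeal ^ n ↔ r ∈ Q.asIdeal ^ n := by
    intro r n
    rw [hQ, ← Ideal.map_pow]
    change _ ∈ Ideal.map e _ ↔ _
    rw [← Ideal.comap_symm, Ideal.mem_comap]
    simp
  have h1 : ∀ r : 𝓞 L, r ≠ 0 → od Q (algebraMap (𝓞 L) L r) = od P (τ (algebraMap (𝓞 L) L r)) := by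
    intro r hr
    have hr' : e r ≠ 0 := by simpa using hr
    have a1 := int_od_nonneg Q hr
    have a2 := int_od_nonneg P hr'
    rw [← he]
    have key : ∀ n : ℕ, (n : ℤ) ≤ od Q (algebraMap (𝓞 L) L r) ↔ (n : ℤ) ≤ od P (algebraMap (𝓞 L) L (e r)) := by
      intro n; rw [int_od Q hr, int_od P hr', hm]
    have k1 := (key (od Q (algebraMap (𝓞 L) L r)).toNat)
    have k2 := (key (od P (algebraMap (𝓞 L) L (e r))).toNat)
    omega
  have h2 : ∀ x, od Q x = od P (τ x) := by
    intro x
    obtain ⟨r, s, hs, rfl⟩ := IsFractionRing.div_surjective (A := 𝓞 L) x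
    have hs0 : s ≠ 0 := nonZeroDivisors.ne_zero hs
    by_cases hr : r = 0
    · simp [hr, od]
    rw [map_div₀, od_div, od_div, h1 _ hr, h1 _ hs0] <;> simpa
  have h3 : Ideal.absNorm Q.asIdeal = Ideal.absNorm P.asIdeal := by
    rw [Ideal.absNorm_apply, Ideal.absNorm_apply, Submodule.cardQuot_apply, Submodule.cardQuot_apply]
    exact Nat.card_congr (Ideal.quotientEquiv _ _ e hQ).toEquiv
  refine ⟨Q, h2, fun x => ?_⟩
  by_cases hx : x = 0
  · simp [hx]
  have hab : ∀ (Q : HeightOneSpectrum (𝓞 L)) x, x ≠ 0 → ab Q x = ((Ideal.absNorm Q.asIdeal : ℕ) : ℝ) ^ (- od Q x) := by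
    intro Q x hx
    have b1 := (ab_le Q (od Q x) x).1 ((mem_PW Q hx).2 le_rfl)
    have b2 := (ab_le Q (od Q x⁻¹) x⁻¹).1 ((mem_PW Q (inv_ne_zero hx)).2 le_rfl)
    rw [od_inv, neg_neg, map_inv₀] at b2
    refine le_antisymm b1 ?_
    have hp := (ab Q).pos hx
    rw [zpow_neg]
    exact inv_le_of_inv_le₀ hp b2
  rw [hab _ _ hx, hab _ _ (by simpa), h2, h3]

theorem exists_tau (τ : L ≃ₐ[K] L) (w : Pl L) : ∃ w' : Pl L, ∀ x, av w' x = av w (τ x) := by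
  rcases w with P | w
  · obtain ⟨Q, -, h⟩ := od_tau τ P
    exact ⟨Sum.inl Q, h⟩
  · exact ⟨Sum.inr (w.comap (τ : L →+* L)), fun x => rfl⟩

theorem rp1 {x t : ℝ} (hx : 0 ≤ x) (ht : 0 < t) : x ^ t < 1 ↔ x < 1 := by
  constructor
  · intro h
    by_contra h'
    exact absurd (Real.one_le_rpow (not_lt.1 h') ht.le) (not_le.2 h)
  · intro h; exact Real.rpow_lt_one hx h ht

theorem pl_eq {v w : Pl K} {s t : ℝ} (hs : 0 < s) (ht : 0 < t)
    (h : ∀ x, av v x ^ s = av w x ^ t) : v = w := by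
  by_contra hn
  refine av_ne hn (AbsoluteValue.isEquiv_iff_lt_one_iff.2 fun x => ?_)
  rw [← rp1 ((av v).nonneg x) hs, h, rp1 ((av w).nonneg x) ht]

/-- quadratic extension data -/
structure QE (K L : Type*) [Field K] [Field L] [Algebra K L] (a : K) where
  α : L
  τ : L ≃ₐ[K] L
  hα : α ^ 2 = algebraMap K L a
  hτ : τ α = -α
  gen : ∀ z, ∃ x y : K, z = algebraMap K L x + algebraMap K L y * α

namespace QE
variable {K L : Type*} [Field K] [Field L] [Algebra K L] {a : K} (q : QE K L a)
include q

theorem tt (z : L) : q.τ (q.τ z) = z := by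
  obtain ⟨x, y, rfl⟩ := q.gen z
  simp [q.hτ]

theorem nrm (x y : K) : (algebraMap K L x + algebraMap K L y * q.α) *
    q.τ (algebraMap K L x + algebraMap K L y * q.α) = algebraMap K L (x ^ 2 - a * y ^ 2) := by
  simp only [map_add, map_mul, AlgEquiv.commutes, q.hτ, map_sub, map_pow, ← q.hα]
  ring

theorem ex_n (z : L) : ∃ c : K, algebraMap K L c = z * q.τ z := by
  obtain ⟨x, y, rfl⟩ := q.gen z
  exact ⟨_, (q.nrm x y).symm⟩

theorem ex_fix {z : L} (h : q.τ z = z) (h2 : (2 : L) * q.α ≠ 0) : ∃ c : K, algebraMap K L c = z := by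
  obtain ⟨x, y, rfl⟩ := q.gen z
  refine ⟨x, ?_⟩
  simp [q.hτ] at h
  have : algebraMap K L y * (2 * q.α) = 0 := by linear_combination -h
  rw [mul_eq_zero, or_iff_left h2] at this
  simp [this]

/-- norm -/
noncomputable def n : Lˣ →* Kˣ := MonoidHom.mk' (fun z => Units.mk0 (q.ex_n z).choose (by
    intro h
    have := (q.ex_n z).choose_spec
    rw [h, map_zero, eq_comm, mul_eq_zero] at this
    simp at this)) (by
  intro z w
  ext
  apply (algebraMap K L).injective
  change algebraMap K L (q.ex_n (z * w : Lˣ)).choose = algebraMap K L ((q.ex_n z).choose * (q.ex_n w).choose)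
  rw [map_mul, (q.ex_n z).choose_spec, (q.ex_n w).choose_spec, (q.ex_n (z * w : Lˣ)).choose_spec, Units.val_mul, map_mul]
  ring)

theorem n_spec (z : Lˣ) : algebraMap K L (q.n z) = z * q.τ z := (q.ex_n z).choose_spec

theorem mem_Nm {b : Kˣ} : b ∈ Nm a ↔ ∃ z, q.n z = b := by
  constructor
  · rintro ⟨x, y, h⟩
    have h1 := q.nrm x y
    rw [← h] at h1
    refine ⟨Units.mk0 (algebraMap K L x + algebraMap K L y * q.α) fun h0 => ?_, ?_⟩
    · rw [h0, zero_mul, eq_comm, map_eq_zero] at h1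
      exact b.ne_zero h1
    · ext
      apply (algebraMap K L).injective
      rw [n_spec, Units.val_mk0, h1]
  · rintro ⟨z, rfl⟩
    obtain ⟨x, y, h⟩ := q.gen z
    refine ⟨x, y, (algebraMap K L).injective ?_⟩
    rw [n_spec, h, q.nrm]

end QE

variable {a : K} (q : QE K L a)

noncomputable def tw (q : QE K L a) (w : Pl L) : Pl L := (exists_tau q.τ w).choose

theorem av_tw (w : Pl L) (x : L) : av (tw q w) x = av w (q.τ x) := (exists_tau q.τ w).choose_spec x

theorem tw_eq {w w' : Pl L} (h : ∀ x, av w' x = av w (q.τ x)) : w' = tw q w :=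
  pl_eq one_pos one_pos fun x => by rw [h, av_tw]

theorem tw_tw (w : Pl L) : tw q (tw q w) = w :=
  (tw_eq q fun x => by rw [av_tw, q.tt]).symm

theorem pi_tw (w : Pl L) : pi K (tw q w) = pi K w := by
  obtain ⟨s, hs, h1⟩ := pi_av (K := K) w
  obtain ⟨t, ht, h2⟩ := pi_av (K := K) (tw q w)
  exact pl_eq ht hs fun x => by rw [h1, h2, av_tw, AlgEquiv.commutes]

theorem pi_lt (w : Pl L) (x : K) : av (pi K w) x < 1 ↔ av w (algebraMap K L x) < 1 := by
  obtain ⟨s, hs, h1⟩ := pi_av (K := K) w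
  rw [← h1, rp1 ((av _).nonneg x) hs]

theorem fibre {w w' : Pl L} (h : pi K w' = pi K w) : w' = w ∨ w' = tw q w := by
  classical
  by_contra hn
  push Not at hn
  have hbig : ∀ w : Pl L, ∃ x, 1 < av w x := by
    intro w
    obtain ⟨x, hx, h⟩ := av_nontriv w
    rcases lt_or_gt_of_ne h with h | h
    · exact ⟨x⁻¹, by rw [map_inv₀]; exact (one_lt_inv₀ ((av w).pos hx)).2 h⟩
    · exact ⟨x, h⟩
  choose X hX using hbig
  obtain ⟨z, hz⟩ := wa (B := {w, tw q w, w', tw q w'}) (by simp)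
    (fun u => if u = w ∨ u = tw q w then X u else 0)
    (fun u => if u = w ∨ u = tw q w then av u (X u) - 1 else 1)
    (fun u => by split_ifs; · linarith [hX u]
                 · norm_num)
  have hb : ∀ u, u = w ∨ u = tw q w → 1 < av u z := by
    intro u hu
    have := hz u (by rcases hu with h | h <;> simp [h])
    simp only [if_pos hu] at this
    have h2 := (av u).sub_le (X u) z 0
    rw [sub_zero, sub_zero, (av u).map_sub] at h2
    linarith
  have hs : ∀ u, u = w' ∨ u = tw q w' → av u z < 1 := by
    intro u hu
    have := hz u (by rcases hu with h | h <;> simp [h])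
    rw [if_neg, if_neg, sub_zero] at this
    · exact this
    all_goals
      rintro (rfl | rfl)
      · rcases hu with h | h
        · exact hn.1 h.symm
        · exact hn.2 (by rw [h, tw_tw])
      · rcases hu with h | h
        · exact hn.2 h.symm
        · exact hn.1 (by rw [← tw_tw q w', ← h, tw_tw])
  obtain ⟨c, hc⟩ := q.ex_n z
  have e1 : av w' (algebraMap K L c) < 1 := by
    rw [hc, map_mul, ← av_tw]
    exact mul_lt_one_of_nonneg_of_lt_one_left ((av _).nonneg _) (hs _ (Or.inl rfl)) (hs _ (Or.inr rfl)).le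
  have e2 : 1 < av w (algebraMap K L c) := by
    rw [hc, map_mul, ← av_tw]
    exact one_lt_mul (hb _ (Or.inl rfl)).le (hb _ (Or.inr rfl))
  rw [← pi_lt, h, pi_lt] at e1
  linarith

theorem tw_ne (ha : a ≠ 0) (w : Pl L) : tw q w ≠ w ↔ Sq (av (pi K w)) a := by
  have hα0 : q.α ≠ 0 := by
    intro h; apply ha; apply (algebraMap K L).injective; rw [← q.hα, h]; simp
  have h2 : (0 : ℝ) < av w 2 := (av w).pos two_ne_zero
  have h2α : 0 < av w (2 * q.α) := (av w).pos (by simpa)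
  obtain ⟨t, ht, ht'⟩ := pi_av (K := K) w
  constructor
  · intro hn ε hε
    obtain ⟨δ, hδ, hδ1, hδ2⟩ : ∃ δ > 0, δ < 1 ∧ δ * (1 + av w (2 * q.α)) < ε ^ t := by
      have hp : 0 < ε ^ t := Real.rpow_pos_of_pos hε t
      have h3 : 0 < ε ^ t / (1 + av w (2 * q.α)) := by positivity
      obtain ⟨δ, h0, h1⟩ := exists_between (lt_min one_pos h3)
      refine ⟨δ, h0, h1.trans_le (min_le_left _ _), ?_⟩
      rw [← lt_div_iff₀ (by positivity)]
      exact h1.trans_le (min_le_right _ _)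
    classical
    obtain ⟨y, hy⟩ := wa (B := {w, tw q w}) (by simp) (fun u => if u = w then q.α else - q.α)
      (fun u => δ * av w 2 / 2) (fun u => by positivity)
    have y1 := hy w (by simp)
    have y2 := hy (tw q w) (by simp)
    simp only [if_true, if_neg hn, av_tw, map_sub, map_neg, q.hτ, neg_neg] at y1 y2
    obtain ⟨c, hc⟩ := q.ex_fix (z := (y + q.τ y) / 2) (by rw [map_div₀, map_add, q.tt, add_comm, map_ofNat]) (by simpa)
    have hx : av w (algebraMap K L c - q.α) < δ := by
      have : algebraMap K L c - q.α = ((y - q.α) + (q.τ y - q.α)) / 2 := by rw [hc]; ring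
      rw [this, map_div₀, div_lt_iff₀ h2]
      refine ((av w).add_le _ _).trans_lt ?_
      linarith
    refine ⟨c, ?_⟩
    have h4 : av w (algebraMap K L (a - c ^ 2)) < ε ^ t := by
      have : algebraMap K L (a - c ^ 2) =
          -((algebraMap K L c - q.α) * ((algebraMap K L c - q.α) + 2 * q.α)) := by
        rw [map_sub, map_pow, ← q.hα]; ring
      rw [this, (av w).map_neg, map_mul]
      refine lt_of_le_of_lt ?_ hδ2
      have h5 := (av w).add_le (algebraMap K L c - q.α) (2 * q.α)
      exact mul_le_mul hx.le (by linarith) ((av w).nonneg _) hδ.le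
    rw [← ht'] at h4
    exact lt_of_not_ge fun h => absurd (Real.rpow_le_rpow hε.le h ht.le) (not_le.2 h4)
  · intro hs he
    have hp : 0 < (av w (2 * q.α) / 2) ^ 2 := by positivity
    obtain ⟨x, hx⟩ := hs _ (Real.rpow_pos_of_pos hp t⁻¹)
    have h1 := Real.rpow_lt_rpow ((av _).nonneg _) hx ht
    rw [ht', Real.rpow_inv_rpow hp.le ht.ne'] at h1
    have h3 : av w (algebraMap K L x + q.α) = av w (algebraMap K L x - q.α) := by
      conv_lhs => rw [← he, av_tw]
      rw [map_add, q.hτ, AlgEquiv.commutes, sub_eq_add_neg]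
    have : algebraMap K L (a - x ^ 2) =
          -((algebraMap K L x - q.α) * (algebraMap K L x + q.α)) := by
        rw [map_sub, map_pow, ← q.hα]; ring
    rw [this, (av w).map_neg, map_mul, h3, ← pow_two] at h1
    have h4 := lt_of_pow_lt_pow_left₀ 2 (by positivity) h1
    have h6 : algebraMap K L x + q.α - (algebraMap K L x - q.α) = 2 * q.α := by ring
    have h8 := (av w).add_le (algebraMap K L x + q.α) (-(algebraMap K L x - q.α))
    rw [(av w).map_neg, ← sub_eq_add_neg, h6, h3] at h8
    linarith

end above
end QC

namespace QC
section quad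
open NumberField IsDedekindDomain
variable {K : Type*} [Field K] [NumberField K] {L : Type*} [Field L] [NumberField L] [Algebra K L]
  {a : K} (q : QE K L a)

theorem tw_inl (P : HeightOneSpectrum (𝓞 L)) : ∃ Q, tw q (Sum.inl P) = Sum.inl Q ∧
    ∀ x, od Q x = od P (q.τ x) := by
  obtain ⟨Q, h, h'⟩ := od_tau q.τ P
  exact ⟨Q, (tw_eq q (w := Sum.inl P) (w' := Sum.inl Q) h').symm, h⟩

theorem od_eq_of_PW (P : HeightOneSpectrum (𝓞 L)) {x y : L} (hx : x ≠ 0) (h : y - x ∈ PW P (od P x + 1)) :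
    y ≠ 0 ∧ od P y = od P x := by
  have := od_add P hx h
  rwa [add_sub_cancel] at this

theorem fin_approx {P Q : HeightOneSpectrum (𝓞 L)} (h : Q ≠ P) : ∃ z : L, z ≠ 0 ∧ od P z = 1 ∧ od Q z = 0 := by
  classical
  obtain ⟨π, hπ, h1⟩ := exists_unif P
  obtain ⟨z, hz⟩ := wa (B := {Sum.inl P, Sum.inl Q}) (by simp)
    (fun u => if u = Sum.inl P then π else 1)
    (fun u => Sum.elim (fun P => ((Ideal.absNorm P.asIdeal : ℕ) : ℝ) ^ (-2 : ℤ)) (fun _ => 1) u)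
    (fun u => by
      rcases u with P | u
      · have : 0 < Ideal.absNorm P.asIdeal := (NumberField.HeightOneSpectrum.one_lt_absNorm P).le
        simp only [Sum.elim_inl]; positivity
      · simp)
  have z1 := (hz (Sum.inl P) (by simp)).le
  have z2 := (hz (Sum.inl Q) (by simp)).le
  rw [if_pos rfl] at z1
  rw [if_neg (by simpa using h)] at z2
  have z1 := (ab_le P 2 _).2 z1
  have z2 := (ab_le Q 2 _).2 z2
  have a1 := od_eq_of_PW P hπ (by rw [h1]; exact z1)
  have a2 := od_eq_of_PW Q one_ne_zero (by rw [od_one]; exact PW_mono Q (by norm_num) z2)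
  exact ⟨z, a1.1, a1.2.trans h1, a2.2.trans (od_one Q)⟩

include q in
theorem unram (P : HeightOneSpectrum (𝓞 L)) (ha0 : a ≠ 0) (h2 : od (P.under (𝓞 K)) (2 : K) = 0)
    (ha : od (P.under (𝓞 K)) a = 0) (x : K) : od P (algebraMap K L x) = od (P.under (𝓞 K)) x := by
  obtain ⟨e, he, h⟩ := od_over (K := K) P
  suffices h1 : e = 1 by rw [h, h1]; simp
  obtain ⟨Q, hQ, hQo⟩ := tw_inl q P
  by_cases hPQ : Q = P
  · subst hPQ
    obtain ⟨z, hz0, hz⟩ := exists_unif Q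
    obtain ⟨x, y, hxy⟩ := q.gen z
    have hα0 : q.α ≠ 0 := by
      intro h; apply ha0; apply (algebraMap K L).injective; rw [← q.hα, h]; simp
    have hα : od Q q.α = 0 := by
      have := h a
      rw [← q.hα, od_pow, ha] at this
      push_cast at this; omega
    have h2' : od Q (2 : L) = 0 := by
      have := h 2
      rw [h2, map_ofNat] at this
      simpa using this
    by_contra hne
    have he2 : (2 : ℤ) ≤ e := by omega
    have z1 : z ∈ PW Q 1 := (mem_PW Q hz0).2 hz.ge
    have z2 : q.τ z ∈ PW Q 1 := (mem_PW Q (by simpa)).2 (by rw [← hQo, hz])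
    have key : ∀ c : K, algebraMap K L c ∈ PW Q 1 → algebraMap K L c ∈ PW Q 2 := by
      intro c hc
      by_cases hc0 : c = 0
      · simp [hc0]
      have hc1 : algebraMap K L c ≠ 0 := by simpa
      rw [mem_PW Q hc1, h] at *
      have : 0 < od (HeightOneSpectrum.under (𝓞 K) Q) c :=
        pos_of_mul_pos_right (by omega : 0 < (e : ℤ) * od (HeightOneSpectrum.under (𝓞 K) Q) c) (by positivity)
      nlinarith
    have f1 : (2 : L) * algebraMap K L x ∈ PW Q 2 := by
      rw [← map_ofNat (algebraMap K L) 2, ← map_mul]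
      apply key
      have : algebraMap K L (2 * x) = z + q.τ z := by
        rw [hxy]; simp only [map_mul, map_add, AlgEquiv.commutes, q.hτ, map_ofNat]; ring
      rw [this]; exact add_mem z1 z2
    have f2 : (2 : L) * (algebraMap K L y) ∈ PW Q 2 := by
      rw [← map_ofNat (algebraMap K L) 2, ← map_mul]
      apply key
      have : algebraMap K L (2 * y) = q.α⁻¹ * (z - q.τ z) := by
        rw [hxy]; simp only [map_mul, map_add, AlgEquiv.commutes, q.hτ, map_ofNat]; field_simp; ring
      rw [this]
      exact mul_PW' Q ((mem_PW Q (inv_ne_zero hα0)).2 (by rw [od_inv, hα, neg_zero])) (sub_mem z1 z2) (by norm_num)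
    have f3 : (2 : L) * z ∈ PW Q 2 := by
      have : (2 : L) * z = 2 * algebraMap K L x + 2 * algebraMap K L y * q.α := by rw [hxy]; ring
      rw [this]
      exact add_mem f1 (mul_PW' Q f2 ((mem_PW Q hα0).2 hα.ge) (by norm_num))
    rw [mem_PW Q (by simpa), od_mul Q two_ne_zero hz0] at f3
    omega
  · obtain ⟨z, hz0, hz1, hz2⟩ := fin_approx hPQ
    obtain ⟨c, hc⟩ := q.ex_n z
    have := h c
    rw [hc, od_mul P hz0 (by simpa), ← hQo, hz1, hz2] at this
    have : (e : ℤ) ∣ 1 := ⟨_, this⟩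
    have := Int.eq_one_of_dvd_one (by positivity) this
    exact_mod_cast this

/-- primes above -/
def SL (L : Type*) [Field L] [NumberField L] [Algebra K L] (S : Set (HeightOneSpectrum (𝓞 K))) :
  Set (HeightOneSpectrum (𝓞 L)) := {P | P.under (𝓞 K) ∈ S}

theorem PS_SL (S : Set (HeightOneSpectrum (𝓞 K))) : PS (SL L S) = pi K ⁻¹' PS S := by
  ext w
  rcases w with P | w
  · simp [PS_inl, SL, pi]
  · simp [PS_inr, pi]

include q in
theorem preim_fin {B : Set (Pl K)} (hB : B.Finite) : (pi K ⁻¹' B : Set (Pl L)).Finite := by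
  choose f hf using pi_surj (K := K) (L := L)
  refine ((hB.image f).union (hB.image fun v => tw q (f v))).subset fun w hw => ?_
  rcases fibre q (hf (pi K w)).symm with h | h
  · exact Or.inl ⟨_, hw, h.symm⟩
  · exact Or.inr ⟨_, hw, h.symm⟩

include q in
theorem preim_card (ha : a ≠ 0) {B : Set (Pl K)} (hB : B.Finite) :
    (pi K ⁻¹' B : Set (Pl L)).ncard + {v ∈ B | ¬ Sq (av v) a}.ncard = 2 * B.ncard := by
  induction B, hB using Set.Finite.induction_on with
  | empty => simp
  | @insert v B hv hB ih =>
    have hd : (pi K ⁻¹' insert v B : Set (Pl L)) = pi K ⁻¹' {v} ∪ pi K ⁻¹' B := by ext; simp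
    have hdis : Disjoint (pi K ⁻¹' {v} : Set (Pl L)) (pi K ⁻¹' B) :=
      Disjoint.preimage _ (by simpa using hv)
    rw [hd, Set.ncard_union_eq hdis (preim_fin q (Set.finite_singleton v)) (preim_fin q hB),
      Set.ncard_insert_of_notMem hv hB]
    obtain ⟨w, rfl⟩ := pi_surj (L := L) v
    have hf : (pi K ⁻¹' {pi K w} : Set (Pl L)) = {w, tw q w} := by
      ext u
      simp only [Set.mem_preimage, Set.mem_singleton_iff, Set.mem_insert_iff]
      constructor
      · exact fun h => fibre q h
      · rintro (rfl | rfl)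
        · rfl
        · exact pi_tw q w
    rw [hf]
    by_cases hs : Sq (av (pi K w)) a
    · rw [Set.ncard_pair ((tw_ne q ha w).2 hs).symm]
      have : {v ∈ insert (pi K w) B | ¬ Sq (av v) a} = {v ∈ B | ¬ Sq (av v) a} := by
        ext u; simp only [Set.mem_setOf_eq, Set.mem_insert_iff]
        constructor
        · rintro ⟨rfl | h, h'⟩
          · exact absurd hs h'
          · exact ⟨h, h'⟩
        · exact fun h => ⟨Or.inr h.1, h.2⟩
      rw [this]; omega
    · have h1 : tw q w = w := by
        by_contra h; exact hs ((tw_ne q ha w).1 h)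
      have : {v ∈ insert (pi K w) B | ¬ Sq (av v) a} = insert (pi K w) {v ∈ B | ¬ Sq (av v) a} := by
        ext u; simp only [Set.mem_setOf_eq, Set.mem_insert_iff]
        constructor
        · rintro ⟨rfl | h, h'⟩
          · exact Or.inl rfl
          · exact Or.inr ⟨h, h'⟩
        · rintro (rfl | h)
          · exact ⟨Or.inl rfl, hs⟩
          · exact ⟨Or.inr h.1, h.2⟩
      rw [this, Set.ncard_insert_of_notMem (fun h => hv h.1) (hB.subset (Set.sep_subset _ _)), h1]
      simp
      omega

end quad
end QC

namespace QC
section hc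
open NumberField IsDedekindDomain
variable {K : Type*} [Field K] [NumberField K] {L : Type*} [Field L] [NumberField L] [Algebra K L]
  {a : K} (q : QE K L a)

theorem surj_fin (p : HeightOneSpectrum (𝓞 K)) : ∃ P : HeightOneSpectrum (𝓞 L), P.under (𝓞 K) = p := by
  obtain ⟨w, hw⟩ := pi_surj (L := L) (Sum.inl p)
  rcases w with P | w
  · exact ⟨P, by simpa [pi] using hw⟩
  · simp [pi] at hw

theorem under_tw {P Q : HeightOneSpectrum (𝓞 L)} (h : tw q (Sum.inl P) = Sum.inl Q) :
    Q.under (𝓞 K) = P.under (𝓞 K) := by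
  have := pi_tw q (Sum.inl P)
  rw [h] at this
  simpa [pi] using this

variable (K L) in
noncomputable def jj : Kˣ →* Lˣ := Units.map (algebraMap K L).toMonoidHom

theorem jj_val (u : Kˣ) : (jj K L u : L) = algebraMap K L u := rfl

theorem j_US {S : Set (HeightOneSpectrum (𝓞 K))} {u : Kˣ} : jj K L u ∈ US (SL L S) ↔ u ∈ US S := by
  constructor
  · intro h p hp
    obtain ⟨P, rfl⟩ := surj_fin (L := L) p
    obtain ⟨e, he, h'⟩ := od_over (K := K) P
    have := h P hp
    rw [jj_val, h', mul_eq_zero] at this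
    exact this.resolve_left (by exact_mod_cast he.ne')
  · intro h P hP
    obtain ⟨e, he, h'⟩ := od_over (K := K) P
    rw [jj_val, h', h _ hP, mul_zero]

theorem j_n (z : Lˣ) : jj K L (q.n z) = z * Units.map q.τ.toMonoidHom z := by
  ext; exact q.n_spec z

theorem n_j (u : Kˣ) : q.n (jj K L u) = u ^ 2 := by
  ext; apply (algebraMap K L).injective
  rw [q.n_spec, jj_val, AlgEquiv.commutes]; simp [pow_two]

theorem n_US {S : Set (HeightOneSpectrum (𝓞 K))} {m : Lˣ} (h : m ∈ US (SL L S)) : q.n m ∈ US S := by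
  rw [← j_US (L := L), j_n]
  refine mul_mem h fun P hP => ?_
  obtain ⟨Q, h1, h2⟩ := tw_inl q P
  change od P (q.τ m) = 0
  rw [← h2]
  exact h Q (by rw [SL, Set.mem_setOf_eq, under_tw q h1]; exact hP)

include q in
theorem j_KSq (hns : ¬ IsSquare a) {u a' : Kˣ} (ha' : (a' : K) = a) :
    jj K L u ∈ KSq Lˣ ↔ u ∈ KSq Kˣ ∨ u * a' ∈ KSq Kˣ := by
  have ha0 : a ≠ 0 := ha' ▸ a'.ne_zero
  have hα0 : q.α ≠ 0 := by
    intro h; apply ha0; apply (algebraMap K L).injective; rw [← q.hα, h]; simp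
  constructor
  · rw [mem_KSq]
    rintro ⟨z, hz⟩
    obtain ⟨x, y, hxy⟩ := q.gen z
    have h1 : algebraMap K L (2 * x * y) * q.α = algebraMap K L (u - x ^ 2 - a * y ^ 2) := by
      have := congrArg Units.val hz
      rw [Units.val_pow_eq_pow_val, hxy, jj_val] at this
      simp only [map_sub, map_mul, map_pow, ← this, ← q.hα, map_ofNat]
      ring
    have h2 : 2 * x * y = 0 := by
      by_contra h
      apply hns
      refine ⟨(u - x ^ 2 - a * y ^ 2) / (2 * x * y), (algebraMap K L).injective ?_⟩
      rw [← pow_two, map_pow, map_div₀, ← h1, mul_div_cancel_left₀ _ (by simpa using h), q.hα]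
    rw [h2, map_zero, zero_mul, eq_comm, map_eq_zero] at h1
    have hu := u.ne_zero
    rcases mul_eq_zero.1 h2 with h | h
    · have hx : x = 0 := by simpa using h
      right
      rw [mem_KSq]
      have hy : y ≠ 0 := by rintro rfl; apply hu; linear_combination h1 + x * hx
      refine ⟨a' * Units.mk0 y hy, ?_⟩
      ext
      simp only [Units.val_pow_eq_pow_val, Units.val_mul, Units.val_mk0, ha']
      linear_combination -a * h1 - x * a * hx
    · left
      rw [mem_KSq]
      have hx : x ≠ 0 := by rintro rfl; apply hu; linear_combination h1 + a * y * h
      refine ⟨Units.mk0 x hx, ?_⟩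
      ext
      simp only [Units.val_pow_eq_pow_val, Units.val_mk0]
      linear_combination -h1 - a * y * h
  · have ha : jj K L a' ∈ KSq Lˣ := by
      rw [mem_KSq]
      refine ⟨Units.mk0 q.α hα0, ?_⟩
      ext; simp [jj_val, ha', q.hα]
    have hj : ∀ u ∈ KSq Kˣ, jj K L u ∈ KSq Lˣ := by
      intro u hu
      obtain ⟨y, rfl⟩ := mem_KSq.1 hu
      rw [mem_KSq]; exact ⟨jj K L y, (map_pow _ _ _).symm⟩
    rintro (h | h)
    · exact hj _ h
    · have := hj _ h
      rw [map_mul] at this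
      exact (Subgroup.mul_mem_cancel_right _ ha).1 this

theorem h90 (ha : a ≠ 0) {m : Lˣ} (h : q.n m = 1) : ∃ w : Lˣ, jj K L (q.n w) * m = w ^ 2 := by
  have h1 : (m : L) * q.τ m = 1 := by rw [← q.n_spec, h]; simp
  have hα0 : q.α ≠ 0 := by
    intro h; apply ha; apply (algebraMap K L).injective; rw [← q.hα, h]; simp
  by_cases hm : 1 + (m : L) = 0
  · refine ⟨Units.mk0 q.α hα0, ?_⟩
    rw [j_n]; ext
    have : (m : L) = -1 := by linear_combination hm
    change q.α * q.τ q.α * m = q.α ^ 2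
    rw [q.hτ, this]; ring
  · refine ⟨Units.mk0 _ hm, ?_⟩
    rw [j_n]; ext
    change (1 + (m : L)) * q.τ (1 + m) * m = (1 + (m : L)) ^ 2
    rw [map_add, map_one]
    linear_combination (1 + (m : L)) * h1

theorem cgr {G : Type*} [CommGroup G] (m c n z : G) : m = c * n⁻¹ * z * (n * (m * c⁻¹) * z⁻¹) := by
  apply Additive.ofMul.injective; simp only [ofMul_mul, ofMul_inv]; abel

theorem F1 {S : Set (HeightOneSpectrum (𝓞 K))} (hS : CS S) (ha0 : a ≠ 0)
    (h2 : ∀ p ∉ S, od p (2 : K) = 0) (ha : ∀ p ∉ S, od p a = 0) {m : Lˣ} (hm : m ∈ US (SL L S))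
    {c : Kˣ} (hc : q.n m = c ^ 2) : ∃ u ∈ US S, ∃ w, m = jj K L u * w ^ 2 := by
  have hcU : c ∈ US S := US_pure (hc ▸ n_US q hm)
  obtain ⟨w, hw⟩ := h90 q ha0 (m := m * (jj K L c)⁻¹) (by rw [map_mul, map_inv, n_j, hc, mul_inv_cancel])
  have hm' : m * (jj K L c)⁻¹ ∈ US (SL L S) := mul_mem hm (inv_mem (j_US.2 hcU))
  have hod : ∀ P ∉ SL L S, od P (q.τ w) = od P (w : L) := by
    intro P hP
    have h1 := congrArg (fun x : Lˣ => od P (x : L)) hw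
    simp only [odu, odu_pow] at h1
    have h3 := hm' P hP
    rw [odu] at h3
    rw [h3, j_n, odu] at h1
    change od P (w : L) + od P (q.τ w) + 0 = _ at h1
    push_cast at h1
    linarith
  choose f hf using surj_fin (K := K) (L := L)
  obtain ⟨z, hz⟩ := hS.adj (fun p => od (f p) (w : L)) (by
    refine Set.Finite.subset (Set.Finite.preimage (f := f) (fun x _ y _ h => by rw [← hf x, h, hf]) (supp_fin w.ne_zero))
      fun p hp => hp.2)
  have hw' : w * (jj K L z)⁻¹ ∈ US (SL L S) := by
    intro P hP
    have e1 := unram q P ha0 (h2 _ hP) (ha _ hP)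
    rw [odu, odu_inv, jj_val, e1, hz _ hP]
    have h3 : pi K (Sum.inl P : Pl L) = pi K (Sum.inl (f (P.under (𝓞 K)))) := by simp [pi, hf]
    rcases fibre q h3 with h | h
    · have := Sum.inl_injective h
      rw [← this]; ring
    · obtain ⟨Q, h4, h5⟩ := tw_inl q (f (P.under (𝓞 K)))
      rw [h4] at h
      have := Sum.inl_injective h
      subst this
      rw [h5, hod]
      · ring
      · rw [SL, Set.mem_setOf_eq, hf]; exact hP
  have key : m = jj K L (c * (q.n w)⁻¹ * z ^ 2) * (w * (jj K L z)⁻¹) ^ 2 := by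
    rw [map_mul, map_mul, map_pow, map_inv, mul_pow, ← hw]
    rw [inv_pow]
    exact cgr _ _ _ _
  refine ⟨_, ?_, _, key⟩
  rw [← j_US (L := L)]
  rw [eq_comm, ← eq_mul_inv_iff_mul_eq] at key
  rw [key]
  exact mul_mem hm (inv_mem (pow_mem hw' 2))

theorem JU (q : QE K L a) (hns : ¬ IsSquare a) (ha0 : a ≠ 0) {S : Set (HeightOneSpectrum (𝓞 K))} (hSf : S.Finite)
    (ha : ∀ p ∉ S, od p a = 0) :
    2 ^ (S.ncard + Fintype.card (InfinitePlace K)) = 2 * ((KSq Lˣ).comap (jj K L)).relIndex (US S) := by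
  set a' := Units.mk0 a ha0
  have haU : a' ∈ US S := ha
  have c3 := SU hSf
  set U := US S
  set J := (KSq Lˣ).comap (jj K L)
  have hKJ : KSq Kˣ ⊓ U ≤ J ⊓ U := inf_le_inf_right _ fun u hu => (j_KSq q hns (a' := a') rfl).2 (Or.inl hu)
  have i1 := Subgroup.relIndex_mul_relIndex _ _ _ hKJ inf_le_right
  rw [Subgroup.inf_relIndex_right, Subgroup.inf_relIndex_right, c3] at i1
  rw [← i1]
  congr 1
  rw [Subgroup.relIndex_eq_two_iff]
  have haK : a' ∉ KSq Kˣ := by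
    intro h
    obtain ⟨y, hy⟩ := mem_KSq.1 h
    exact hns ⟨y, by rw [← pow_two, ← Units.val_pow_eq_pow_val, hy]; rfl⟩
  refine ⟨a', ⟨(j_KSq q hns (a' := a') rfl).2 (Or.inr (mem_KSq.2 ⟨a', pow_two _⟩)), haU⟩, ?_⟩
  rintro b ⟨hb, hbU⟩
  rcases (j_KSq q hns (a' := a') rfl).1 hb with h | h
  · exact Or.inr ⟨⟨h, hbU⟩, fun h' => haK ((Subgroup.mul_mem_cancel_left _ h).1 h'.1)⟩
  · exact Or.inl ⟨⟨h, mul_mem hbU haU⟩, fun h' => haK ((Subgroup.mul_mem_cancel_left _ h'.1).1 h)⟩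

theorem HC (hns : ¬ IsSquare a) (ha0 : a ≠ 0) {S : Set (HeightOneSpectrum (𝓞 K))} (hSf : S.Finite)
    (hS : CS S) (h2 : ∀ p ∉ S, od p (2 : K) = 0) (ha : ∀ p ∉ S, od p a = 0) :
    2 * ((US (SL L S)).map q.n).relIndex (US S) = 2 ^ {v ∈ PS S | ¬ Sq (av v) a}.ncard := by
  set a' := Units.mk0 a ha0
  have haU : a' ∈ US S := ha
  set M := US (SL L S)
  set U := US S
  have hSL : (SL L S).Finite := by
    have := preim_fin q (PS_fin hSf)
    rw [← PS_SL] at this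
    exact (this.preimage (f := Sum.inl) Sum.inl_injective.injOn).subset fun P hP => PS_inl.2 hP
  have c1 := preim_card q ha0 (PS_fin hSf)
  rw [← PS_SL, PS_card hSL, PS_card hSf] at c1
  have c2 := SU hSL
  have c3 := SU hSf
  set t := {v ∈ PS S | ¬ Sq (av v) a}.ncard
  set s := S.ncard + Fintype.card (InfinitePlace K)
  set sL := (SL L S).ncard + Fintype.card (InfinitePlace L)
  set R := (KSq Kˣ).relIndex (M.map q.n)
  set X := ((KSq Lˣ).comap (jj K L)).relIndex U
  set Y := (M.map q.n).relIndex U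
  have hnM : M.map q.n ≤ U := by rintro _ ⟨m, hm, rfl⟩; exact n_US q hm
  have e1 : 2 ^ sL = X * R := by
    set A := (KSq Kˣ).comap q.n ⊓ M
    have hKA : KSq Lˣ ⊓ M ≤ A := by
      rintro x ⟨hx, hxM⟩
      obtain ⟨y, rfl⟩ := mem_KSq.1 hx
      exact ⟨mem_KSq.2 ⟨q.n y, (map_pow _ _ _).symm⟩, hxM⟩
    have i1 := Subgroup.relIndex_mul_relIndex _ _ _ hKA inf_le_right
    rw [Subgroup.inf_relIndex_right, Subgroup.inf_relIndex_right, Subgroup.relIndex_comap, c2] at i1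
    rw [← i1]
    congr 1
    have hA : A ⊔ KSq Lˣ = U.map (jj K L) ⊔ KSq Lˣ := by
      apply le_antisymm
      · refine sup_le ?_ le_sup_right
        rintro m ⟨h1, h2'⟩
        obtain ⟨c, hc⟩ := mem_KSq.1 h1
        obtain ⟨u, hu, w, rfl⟩ := F1 q hS ha0 h2 ha h2' hc.symm
        exact Subgroup.mul_mem_sup (Subgroup.mem_map_of_mem _ hu) (mem_KSq.2 ⟨w, rfl⟩)
      · refine sup_le_sup_right ?_ _
        rintro _ ⟨u, hu, rfl⟩
        exact ⟨mem_KSq.2 ⟨u, (n_j q u).symm⟩, j_US.2 hu⟩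
    calc (KSq Lˣ ⊓ M).relIndex A = (KSq Lˣ).relIndex A := by
          rw [← Subgroup.inf_relIndex_right, ← Subgroup.inf_relIndex_right (KSq Lˣ) A]
          congr 1
          rw [inf_assoc, inf_eq_right.2 (inf_le_right : A ≤ M)]
      _ = (KSq Lˣ).relIndex (A ⊔ KSq Lˣ) := (Subgroup.relIndex_sup_right _ _).symm
      _ = (KSq Lˣ).relIndex (U.map (jj K L)) := by rw [hA, Subgroup.relIndex_sup_right]
      _ = X := by rw [← Subgroup.relIndex_comap]
  have e2 : 2 ^ s = 2 * X := JU q hns ha0 hSf ha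
  have e3 : 2 ^ s = R * Y := by
    have hKM : KSq Kˣ ⊓ U ≤ M.map q.n := by
      rintro x ⟨hx, hxU⟩
      obtain ⟨y, rfl⟩ := mem_KSq.1 hx
      exact ⟨jj K L y, j_US.2 (US_pure hxU), n_j q y⟩
    have i1 := Subgroup.relIndex_mul_relIndex _ _ _ hKM hnM
    rw [Subgroup.inf_relIndex_right, c3] at i1
    rw [← i1]
    congr 1
    change _ = (KSq Kˣ).relIndex (M.map q.n)
    rw [← Subgroup.inf_relIndex_right, ← Subgroup.inf_relIndex_right (KSq Kˣ) (M.map q.n)]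
    congr 1
    rw [inf_assoc, inf_eq_right.2 hnM]
  have e4 : 2 ^ sL * (2 * Y) = 2 ^ sL * 2 ^ t := by
    calc 2 ^ sL * (2 * Y) = (2 * X) * (R * Y) := by rw [e1]; ring
      _ = 2 ^ (2 * s) := by rw [← e2, ← e3]; ring
      _ = 2 ^ sL * 2 ^ t := by rw [← pow_add, c1]
  exact Nat.eq_of_mul_eq_mul_left (by positivity) e4

end hc
end QC

namespace QC
section ex
open NumberField IsDedekindDomain

theorem QE_exists {K : Type u} [Field K] [NumberField K] {a : K} (hns : ¬ IsSquare a) :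
    ∃ (L : Type u) (_ : Field L) (_ : NumberField L) (_ : Algebra K L), Nonempty (QE K L a) := by
  have : Fact (∀ r : K, r ^ 2 ≠ a + 0 * r) := ⟨fun r h => hns ⟨r, by rw [← pow_two, h]; ring⟩⟩
  have hc : CharZero (QuadraticAlgebra K a 0) := charZero_of_injective_algebraMap (algebraMap K _).injective
  have hf : FiniteDimensional ℚ (QuadraticAlgebra K a 0) := by
    have : IsScalarTower ℚ K (QuadraticAlgebra K a 0) := IsScalarTower.of_algebraMap_eq' (Subsingleton.elim _ _)
    exact Module.Finite.trans K _
  refine ⟨QuadraticAlgebra K a 0, inferInstance, { to_charZero := hc, to_finiteDimensional := hf }, inferInstance, ⟨{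
    α := QuadraticAlgebra.omega
    τ := AlgEquiv.ofRingEquiv (f := starRingAut) ?_
    hα := ?_
    hτ := ?_
    gen := ?_ }⟩⟩
  · intro r
    change star _ = _
    ext <;> simp
  · ext <;> simp [pow_two]
  · change star _ = _
    ext <;> simp
  · intro z
    exact ⟨z.re, z.im, by ext <;> simp⟩

variable {K : Type*} [Field K] [NumberField K]

theorem NVI_fin {B : Set (Pl K)} (hB : B.Finite) (a : K) : (⨅ v ∈ B, NV (av v) a).FiniteIndex := by
  have := hB.to_subtype
  rw [iInf_subtype']
  exact Subgroup.finiteIndex_iInf fun v => NV_fin v.1 a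

theorem NVI_res {B : Set (Pl K)} {a : K} (ha : a ≠ 0) :
    (⨅ v ∈ B, NV (av v) a) = ⨅ v ∈ {v ∈ B | ¬ Sq (av v) a}, NV (av v) a := by
  apply le_antisymm
  · exact biInf_mono fun v hv => hv.1
  · refine le_iInf₂ fun v hv => ?_
    by_cases h : Sq (av v) a
    · rw [NV_eq_top ha h]; exact le_top
    · exact iInf₂_le v ⟨hv, h⟩

theorem FI {a : K} (ha0 : a ≠ 0) (hns : ¬ IsSquare a) {S : Set (HeightOneSpectrum (𝓞 K))} (hSf : S.Finite)
    (hS : CS S) (h2 : ∀ p ∉ S, od p (2 : K) = 0) (ha : ∀ p ∉ S, od p a = 0) :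
    US S ⊔ (⨅ v ∈ PS S, NV (av v) a) ≠ ⊤ := by
  intro htop
  obtain ⟨L, _, _, _, ⟨q⟩⟩ := QE_exists hns
  have h := HC q hns ha0 hSf hS h2 ha
  have hfin := NVI_fin (PS_fin hSf) a
  have hLB := LB (B := {v ∈ PS S | ¬ Sq (av v) a}) ((PS_fin hSf).subset (Set.sep_subset _ _)) ha0 fun v hv => hv.2
  rw [← NVI_res ha0] at hLB
  set N := ⨅ v ∈ PS S, NV (av v) a
  set t := {v ∈ PS S | ¬ Sq (av v) a}.ncard
  have hle : (US (SL L S)).map q.n ≤ N := by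
    rintro _ ⟨m, hm, rfl⟩
    simp only [N, Subgroup.mem_iInf]
    exact fun v hv => Subgroup.mem_sup_left (q.mem_Nm.2 ⟨m, rfl⟩)
  have h0 : 0 < 2 ^ t := by positivity
  have h1 : N.relIndex (US S) ≤ ((US (SL L S)).map q.n).relIndex (US S) :=
    Nat.le_of_dvd (by omega) (Subgroup.relIndex_dvd_of_le_left _ hle)
  rw [← Subgroup.relIndex_sup_right, htop, Subgroup.relIndex_top_right] at h1
  omega

theorem badset (s : Finset Kˣ) (S0 : Set (HeightOneSpectrum (𝓞 K))) (h0 : S0.Finite) :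
    ∃ S : Set (HeightOneSpectrum (𝓞 K)), S.Finite ∧ S0 ⊆ S ∧ CS S ∧ (∀ p ∉ S, od p (2 : K) = 0) ∧
      ∀ x ∈ s, x ∈ US S := by
  obtain ⟨S1, h1, hc⟩ := CS_exists K
  refine ⟨S0 ∪ S1 ∪ {p | od p (2 : K) ≠ 0} ∪ ⋃ x ∈ s, {p | od p (x : K) ≠ 0}, ?_, ?_, ?_, ?_, ?_⟩
  · refine ((h0.union h1).union (supp_fin two_ne_zero)).union ?_
    exact Set.Finite.biUnion s.finite_toSet fun x _ => supp_fin x.ne_zero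
  · intro p hp; simp [hp]
  · refine hc.mono fun p hp => ?_
    simp [hp]
  · intro p hp
    simp at hp; tauto
  · intro x hx p hp
    simp at hp
    exact hp.2 x hx

theorem C1 {a : K} (ha0 : a ≠ 0) (hns : ¬ IsSquare a) {S0 : Set (HeightOneSpectrum (𝓞 K))} (h0 : S0.Finite) :
    ∃ p ∉ S0, ¬ Sq (ab p) a := by
  classical
  by_contra! hcon
  have hfin := NVI_fin (PS_fin h0) a
  set N := ⨅ v ∈ PS S0, NV (av v) a
  have : Fintype (Kˣ ⧸ N) := Fintype.ofFinite _
  obtain ⟨S, hSf, hS0, hS, h2, hs⟩ := badset (insert (Units.mk0 a ha0) (Finset.univ.image (Quotient.out : Kˣ ⧸ N → Kˣ))) S0 h0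
  refine FI ha0 hns hSf hS h2 (hs _ (Finset.mem_insert_self _ _)) (eq_top_iff.2 fun x _ => ?_)
  have hN : N ≤ ⨅ v ∈ PS S, NV (av v) a := by
    refine le_iInf₂ fun v hv => ?_
    by_cases hv0 : v ∈ PS S0
    · exact iInf₂_le v hv0
    · rcases v with p | w
      · rw [NV_eq_top (v := av (Sum.inl p)) ha0 (hcon p fun h => hv0 (PS_inl.2 h))]; exact le_top
      · exact absurd (PS_inr w) hv0
  have hx : (Quotient.out (x : Kˣ ⧸ N))⁻¹ * x ∈ N := by
    rw [← QuotientGroup.eq]; exact Quotient.out_eq' _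
  have := Subgroup.mul_mem_sup (hs (Quotient.out (x : Kˣ ⧸ N)) (by simp)) (hN hx)
  rwa [mul_inv_cancel_left] at this

end ex
end QC

namespace QC
section nd
open NumberField IsDedekindDomain
variable {K : Type*} [Field K] [NumberField K] (p : HeightOneSpectrum (𝓞 K))

theorem Sq_NV {v : AbsoluteValue K ℝ} {a : K} {b : Kˣ} (h : b ∈ SqG v) : b ∈ NV v a := Subgroup.mem_sup_right h
theorem Nm_NV {v : AbsoluteValue K ℝ} {a : K} {b : Kˣ} (h : b ∈ Nm a) : b ∈ NV v a := Subgroup.mem_sup_left h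

theorem fsum {F : Type*} [Field F] [Finite F] (c : F) : ∃ x y : F, x ^ 2 + y ^ 2 = c := by
  have := Fintype.ofFinite F
  by_cases h : ringChar F = 2
  · obtain ⟨s, hs⟩ := FiniteField.isSquare_of_char_two h c
    exact ⟨s, 0, by rw [hs]; ring⟩
  · obtain ⟨x, y, h⟩ := FiniteField.exists_root_sum_quadratic (f := Polynomial.X ^ 2) (g := Polynomial.X ^ 2 - Polynomial.C c)
      (Polynomial.degree_X_pow 2) (Polynomial.degree_X_pow_sub_C two_pos c) (FiniteField.odd_card_of_char_ne_two h)
    refine ⟨x, y, ?_⟩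
    simp at h
    linear_combination h

theorem res_sq (h2 : od p (2 : K) = 0) {x : K} (hx : x ≠ 0) (h : od p x = 0) {r : 𝓞 K} (hr : x - r ∈ PW p 1)
    (hs : IsSquare (Ideal.Quotient.mk p.asIdeal r)) : Sq (ab p) x := by
  obtain ⟨t, ht⟩ := hs
  obtain ⟨t, rfl⟩ := Ideal.Quotient.mk_surjective t
  rw [← map_mul, Ideal.Quotient.eq, ← pow_one p.asIdeal, ← int_mem_PW] at ht
  have := sq_of_res p hx one_ne_zero h (z := (t : K)) (by
    rw [h2]
    convert add_mem hr ht using 1 <;> first | (simp; done) | (simp only [RingOfIntegers.coe_eq_algebraMap, map_sub, map_add, map_mul, map_pow, RingOfIntegers.map_mk]; ring))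
  rwa [mul_one] at this

theorem ND (h2 : od p (2 : K) = 0) {x y : K} (hx : x ≠ 0) (hx1 : od p x = 0) (hy : y ≠ 0) (hy1 : od p y = 0)
    (hxs : ¬ Sq (ab p) x) (hys : ¬ Sq (ab p) y) : Sq (ab p) (x * y) := by
  classical
  obtain ⟨r, -, hr⟩ := unit_int p hx hx1 0
  obtain ⟨s, -, hs⟩ := unit_int p hy hy1 0
  have := p.isMaximal
  let : Field (𝓞 K ⧸ p.asIdeal) := Ideal.Quotient.field _
  have : Finite (𝓞 K ⧸ p.asIdeal) := Ideal.finiteQuotientOfFreeOfNeBot _ p.ne_bot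
  let : Fintype (𝓞 K ⧸ p.asIdeal) := Fintype.ofFinite _
  have hr' := mt (res_sq p h2 hx hx1 (by simpa using hr)) hxs
  have hs' := mt (res_sq p h2 hy hy1 (by simpa using hs)) hys
  rw [← quadraticChar_neg_one_iff_not_isSquare] at hr' hs'
  refine res_sq p h2 (mul_ne_zero hx hy) (by rw [od_mul p hx hy, hx1, hy1]; rfl) (r := r * s) ?_ ?_
  · have := add_mem (mul_PW p (self_PW p x) hs) (mul_PW' p hr (int_PW p s) (k := od p x + (((0 : ℕ) : ℤ) + 1)) (by rw [hx1]; simp))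
    rw [hx1] at this
    convert this using 1 <;> first | (simp; done) | (simp only [RingOfIntegers.coe_eq_algebraMap, map_sub, map_add, map_mul, map_pow, RingOfIntegers.map_mk]; ring)
  · by_contra h
    rw [← quadraticChar_neg_one_iff_not_isSquare, map_mul, map_mul, hr', hs'] at h
    norm_num at h

theorem neg_Nm {F : Type*} [Field F] (a : Fˣ) : -a ∈ Nm (a : F) := mem_Nm.2 ⟨0, 1, by simp⟩

/-- sums of two squares -/
theorem ss (h2 : od p (2 : K) = 0) {b : Kˣ} (hb : od p (b : K) = 0) : b ∈ NV (ab p) (-1 : K) := by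
  obtain ⟨r, -, hr⟩ := unit_int p b.ne_zero hb 0
  have := p.isMaximal
  have : Finite (𝓞 K ⧸ p.asIdeal) := Ideal.finiteQuotientOfFreeOfNeBot _ p.ne_bot
  obtain ⟨x, y, hxy⟩ : ∃ x y, x ^ 2 + y ^ 2 = Ideal.Quotient.mk p.asIdeal r := by
    let : Field (𝓞 K ⧸ p.asIdeal) := Ideal.Quotient.field _
    exact fsum _
  obtain ⟨x, rfl⟩ := Ideal.Quotient.mk_surjective x
  obtain ⟨y, rfl⟩ := Ideal.Quotient.mk_surjective y
  rw [← map_pow, ← map_pow, ← map_add, eq_comm, Ideal.Quotient.eq, ← pow_one p.asIdeal, ← int_mem_PW] at hxy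
  have h1 : (b : K) - ((x : K) ^ 2 + (y : K) ^ 2) ∈ PW p 1 := by
    convert add_mem hr hxy using 1 <;> first | (simp; done) | (simp only [RingOfIntegers.coe_eq_algebraMap, map_sub, map_add, map_mul, map_pow, RingOfIntegers.map_mk]; ring)
  obtain ⟨h3, -⟩ := od_add p b.ne_zero (by rw [hb]; exact neg_mem h1)
  rw [show (b : K) + -(b - ((x : K) ^ 2 + (y : K) ^ 2)) = (x : K) ^ 2 + (y : K) ^ 2 by ring] at h3
  have h4 := sq_of_res p b.ne_zero h3 hb (z := 1) (by rw [h2]; simpa using h1)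
  refine mem_NV.2 ⟨(Units.mk0 _ h3)⁻¹, inv_mem (mem_Nm.2 ⟨x, y, by simp⟩), b * Units.mk0 _ h3, h4, ?_⟩
  rw [mul_comm b, inv_mul_cancel_left]

theorem NDu (h2 : od p (2 : K) = 0) {a b : Kˣ} (ha : od p (a : K) = 0) (hb : od p (b : K) = 0) :
    b ∈ NV (ab p) (a : K) := by
  by_cases h1 : Sq (ab p) (a : K)
  · rw [NV_eq_top a.ne_zero h1]; trivial
  by_cases h3 : Sq (ab p) (b : K)
  · exact Subgroup.mem_sup_right h3
  have hab : a * b ∈ SqG (ab p) := ND p h2 a.ne_zero ha b.ne_zero hb h1 h3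
  by_cases h4 : (-1 : Kˣ) ∈ SqG (ab p)
  · have := mul_mem (Nm_NV (v := ab p) (inv_mem (neg_Nm a)))
      (Sq_NV (mul_mem hab h4))
    convert this using 1
    rw [inv_neg, mul_neg_one, neg_mul_neg, inv_mul_cancel_left]
  · have h1' : od p (((-1 : Kˣ) : Kˣ) : K) = 0 := by simp [od_neg, od_one]
    have h5 : a * (-1) ∈ SqG (ab p) := ND p h2 a.ne_zero ha (Units.ne_zero (-1)) h1' h1 h4
    apply NV_symm
    have h6 : (-1 : Kˣ) ∈ NV (ab p) (b : K) := NV_symm (by simpa using ss p h2 hb)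
    have := mul_mem h6 (Subgroup.mem_sup_right h5)
    simpa using this

theorem odd_cor (h2 : od p (2 : K) = 0) {u w : Kˣ} (hu : ¬ Even (od p (u : K))) (hw : od p (w : K) = 0)
    (hws : ¬ Sq (ab p) (w : K)) (x : Kˣ) : x ∈ NV (ab p) (u : K) ∨ x * w ∈ NV (ab p) (u : K) := by
  have key : ∀ x : Kˣ, Even (od p (x : K)) → x ∈ NV (ab p) (u : K) ∨ x * w ∈ NV (ab p) (u : K) := by
    intro x ⟨k, hk⟩
    obtain ⟨π, hπ0, hπ⟩ := exists_unif p
    set g := (Units.mk0 π hπ0) ^ k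
    have hg : od p (g : K) = k := by rw [odu_zpow]; simp [hπ]
    have hx : od p ((x * g⁻¹ ^ 2 : Kˣ) : K) = 0 := by rw [odu, odu_pow, odu_inv, hg, hk]; push_cast; ring
    have hgN : g ^ 2 ∈ NV (ab p) (u : K) := Subgroup.mem_sup_left (sq_mem_Nm _ g)
    by_cases hs : Sq (ab p) ((x * g⁻¹ ^ 2 : Kˣ) : K)
    · left
      have := mul_mem (Sq_NV (mem_SqG.2 hs)) hgN
      simpa using this
    · right
      have hxw : Sq (ab p) (((x * g⁻¹ ^ 2) * w : Kˣ) : K) := by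
        rw [Units.val_mul _ w]
        exact ND p h2 (Units.ne_zero _) hx w.ne_zero hw hs hws
      have := mul_mem (Sq_NV (b := (x * g⁻¹ ^ 2) * w) (mem_SqG.2 hxw)) hgN
      convert this using 1
      rw [mul_right_comm]; simp
  by_cases hx : Even (od p (x : K))
  · exact key x hx
  · have hN : -u ∈ NV (ab p) (u : K) := Subgroup.mem_sup_left (neg_Nm u)
    have := key (-u * x) (by rw [odu, Units.val_neg, od_neg]; exact (Int.not_even_iff_odd.1 hu).add_odd (Int.not_even_iff_odd.1 hx))
    rwa [mul_assoc, Subgroup.mul_mem_cancel_left _ hN, Subgroup.mul_mem_cancel_left _ hN] at this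

end nd
end QC

namespace QC
section hnt
open NumberField IsDedekindDomain
variable {K : Type*} [Field K] [NumberField K]

theorem rel2 (p : HeightOneSpectrum (𝓞 K)) (h2 : od p (2 : K) = 0) {S : Set (HeightOneSpectrum (𝓞 K))} (hp : p ∉ S) :
    (SqG (ab p)).relIndex (US S) ≠ 0 ∧ (SqG (ab p)).relIndex (US S) ≤ 2 := by
  by_cases h : US S ≤ SqG (ab p)
  · rw [Subgroup.relIndex_eq_one.2 h]; simp
  · obtain ⟨a, ha, has⟩ := SetLike.not_le_iff_exists.1 h
    rw [(Subgroup.relIndex_eq_two_iff (K := US S)).2 ⟨a, ha, fun b hb => ?_⟩]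
    · simp
    · by_cases hbs : b ∈ SqG (ab p)
      · exact Or.inr ⟨hbs, fun h' => has ((Subgroup.mul_mem_cancel_left _ hbs).1 h')⟩
      · exact Or.inl ⟨ND p h2 b.ne_zero (hb p hp) a.ne_zero (ha p hp) hbs has, hbs⟩

variable {L : Type*} [Field L] [NumberField L] [Algebra K L] {a : K}

theorem SL_fin (q : QE K L a) {S : Set (HeightOneSpectrum (𝓞 K))} (hSf : S.Finite) : (SL L S).Finite := by
  have := preim_fin q (PS_fin hSf)
  rw [← PS_SL] at this
  exact (this.preimage (f := Sum.inl) Sum.inl_injective.injOn).subset fun P hP => PS_inl.2 hP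

theorem Sq_up (P : HeightOneSpectrum (𝓞 L)) {x : K} (h : Sq (ab (P.under (𝓞 K))) x) : Sq (ab P) (algebraMap K L x) := by
  obtain ⟨t, ht, h1⟩ := pi_av (K := K) (Sum.inl P : Pl L)
  exact Sq.of_equiv ht h1 h

theorem LT (q : QE K L a) (hns : ¬ IsSquare a) (ha0 : a ≠ 0) {S : Set (HeightOneSpectrum (𝓞 K))} (hSf : S.Finite)
    (h2 : ∀ p ∉ S, od p (2 : K) = 0) (ha : ∀ p ∉ S, od p a = 0) (k : ℕ)
    (hk : k + 1 ≤ S.ncard + Fintype.card (InfinitePlace K)) :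
    ∃ T : Finset (HeightOneSpectrum (𝓞 K)), T.card = k ∧ (∀ p ∈ T, p ∉ S ∧ Sq (ab p) a) ∧
      ∀ A : Set (HeightOneSpectrum (𝓞 K)), ∃ u ∈ US S, ∀ p ∈ T, (Sq (ab p) (u : K) ↔ p ∉ A) := by
  classical
  induction k with
  | zero => exact ⟨∅, rfl, by simp, fun A => ⟨1, one_mem _, by simp⟩⟩
  | succ k ih =>
    obtain ⟨T, hTk, hT, hTA⟩ := ih (by omega)
    set H := ⨅ p : T, SqG (ab p.1)
    have hHm : ∀ c, c ∈ H ↔ ∀ p ∈ T, Sq (ab p) (c : K) := by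
      intro c
      simp only [H, Subgroup.mem_iInf, Subtype.forall, mem_SqG]
    have hH0 : H.relIndex (US S) ≠ 0 := Subgroup.relIndex_iInf_ne_zero fun p => (rel2 p.1 (h2 _ (hT _ p.2).1) (hT _ p.2).1).1
    have hH : H.relIndex (US S) ≤ 2 ^ k := by
      refine (Subgroup.relIndex_iInf_le _).trans ?_
      refine (Finset.prod_le_prod' fun p _ => (rel2 p.1 (h2 _ (hT _ p.2).1) (hT _ p.2).1).2).trans ?_
      simp [hTk]
    have hJ := JU q hns ha0 hSf ha
    set J := (KSq Lˣ).comap (jj K L)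
    obtain ⟨c, ⟨hcH, hcU⟩, hcJ⟩ : ∃ c, c ∈ H ⊓ US S ∧ c ∉ J := by
      rw [← SetLike.not_le_iff_exists]
      intro hle
      have h3 := Nat.le_of_dvd (by rw [Subgroup.inf_relIndex_right]; omega) (Subgroup.relIndex_dvd_of_le_left (US S) hle)
      rw [Subgroup.inf_relIndex_right] at h3
      have h4 : 2 ^ (k + 1 + 1) ≤ 2 ^ (S.ncard + Fintype.card (InfinitePlace K)) := Nat.pow_le_pow_right two_pos hk
      rw [pow_succ, pow_succ] at h4
      have : 0 < 2 ^ k := by positivity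
      omega
    have hcs : ¬ IsSquare (algebraMap K L c) := by
      rintro ⟨y, hy⟩
      have hy0 : y ≠ 0 := by rintro rfl; simp at hy
      exact hcJ (mem_KSq.2 ⟨Units.mk0 y hy0, Units.ext (by rw [jj_val, hy]; simp [pow_two])⟩)
    obtain ⟨P, hP, hPs⟩ := C1 (by simp) hcs (SL_fin q (hSf.union T.finite_toSet))
    set p := P.under (𝓞 K)
    have hp : p ∉ S ∧ p ∉ T := by
      have : ¬ (p ∈ S ∪ T) := hP
      simpa using this
    have hpc : ¬ Sq (ab p) (c : K) := fun h => hPs (Sq_up P h)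
    have hpa : Sq (ab p) a := by
      by_contra h
      have h5 := Sq_up P (ND p (h2 p hp.1) ha0 (ha p hp.1) c.ne_zero (hcU p hp.1) h hpc)
      have h6 : Sq (ab P) ((q.α⁻¹) ^ 2) := Sq.sq _ _
      apply hPs
      have hα : q.α ≠ 0 := fun h => ha0 (by have := q.hα; rw [h] at this; simpa using this.symm)
      convert h5.mul h6 using 1
      rw [map_mul, ← q.hα, inv_pow]; field_simp
    refine ⟨insert p T, by rw [Finset.card_insert_of_notMem hp.2, hTk], ?_, fun A => ?_⟩
    · intro p' hp'
      rcases Finset.mem_insert.1 hp' with rfl | h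
      · exact ⟨hp.1, hpa⟩
      · exact hT _ h
    · obtain ⟨u, hu, huA⟩ := hTA A
      by_cases h : Sq (ab p) (u : K) ↔ p ∉ A
      · refine ⟨u, hu, fun p' hp' => ?_⟩
        rcases Finset.mem_insert.1 hp' with rfl | h'
        · exact h
        · exact huA _ h'
      · refine ⟨u * c, mul_mem hu hcU, fun p' hp' => ?_⟩
        rcases Finset.mem_insert.1 hp' with h' | h'
        · rw [h']
          have : Sq (ab p) ((u * c : Kˣ) : K) ↔ ¬ Sq (ab p) (u : K) := by
            rw [← mem_SqG, ← mem_SqG]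
            refine ⟨fun h1 h3 => hpc ((Subgroup.mul_mem_cancel_left _ h3).1 h1), fun h1 => ?_⟩
            exact ND p (h2 p hp.1) u.ne_zero (hu p hp.1) c.ne_zero (hcU p hp.1) h1 hpc
          tauto
        · rw [← huA _ h', ← mem_SqG, ← mem_SqG, Subgroup.mul_mem_cancel_right _ (mem_SqG.2 ((hHm c).1 hcH _ h'))]

theorem KEY {S T : Set (HeightOneSpectrum (𝓞 K))} (hSf : S.Finite) (hTf : T.Finite) (hS : CS S)
    (h2 : ∀ p ∉ S, od p (2 : K) = 0) (hT : ∀ p ∈ T, p ∉ S)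
    (hTA : ∀ A : Set (HeightOneSpectrum (𝓞 K)), ∃ u ∈ US S, ∀ p ∈ T, (Sq (ab p) (u : K) ↔ p ∉ A)) {u : Kˣ}
    (hu : u ∈ US (S ∪ T)) (huD : ∀ v ∈ PS S, Sq (av v) (u : K)) : u ∈ KSq Kˣ := by
  by_contra hns
  set S' := S ∪ {p ∈ T | ¬ Even (od p (u : K))}
  have hSS : S ⊆ S' := Set.subset_union_left
  obtain ⟨z, hz⟩ := (hS.mono hSS).even u (by
    intro p hp
    by_cases hpT : p ∈ T
    · by_contra h; exact hp (Or.inr ⟨hpT, h⟩)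
    · rw [hu p (by rintro (h | h); exacts [hp (hSS h), hpT h])]; exact Even.zero)
  set u' := u * z ^ 2
  have hns' : ¬ IsSquare (u' : K) := by
    rintro ⟨y, hy⟩
    have hy0 : y ≠ 0 := by rintro rfl; simp at hy
    refine hns (mem_KSq.2 ⟨Units.mk0 y hy0 * z⁻¹, Units.ext ?_⟩)
    have hz0 := z.ne_zero
    simp [u'] at hy ⊢
    field_simp
    linear_combination -hy
  refine FI u'.ne_zero hns' (hSf.union (hTf.subset (Set.sep_subset _ _))) (hS.mono hSS)
    (fun p hp => h2 p fun h => hp (hSS h)) hz (eq_top_iff.2 fun x _ => ?_)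
  obtain ⟨y, hy, hyA⟩ := hTA {p | x ∉ NV (ab p) (u' : K)}
  have hxy : x * y ∈ ⨅ v ∈ PS S', NV (av v) (u' : K) := by
    simp only [Subgroup.mem_iInf]
    intro v hv
    by_cases hvS : v ∈ PS S
    · have : Sq (av v) (u' : K) := by
        rw [Units.val_mul, Units.val_pow_eq_pow_val]
        exact (huD v hvS).mul (Sq.sq _ _)
      rw [NV_eq_top u'.ne_zero this]; trivial
    · rcases v with p | w
      swap
      · exact absurd (PS_inr w) hvS
      rcases PS_inl.1 hv with h | ⟨hpT, hpo⟩
      · exact absurd (PS_inl.2 h) hvS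
      change x * y ∈ NV (ab p) (u' : K)
      by_cases hx : x ∈ NV (ab p) (u' : K)
      · exact mul_mem hx (Sq_NV (mem_SqG.2 ((hyA p hpT).2 fun h => h hx)))
      · have hpS := hT p hpT
        refine (odd_cor p (h2 p hpS) ?_ (hy p hpS) (fun h => (hyA p hpT).1 h hx) x).resolve_left hx
        rw [odu, odu_pow]
        push_cast
        rw [Int.even_add]
        simpa using hpo
  have := Subgroup.mul_mem_sup (US_mono hSS (inv_mem hy)) hxy
  rwa [mul_comm x, inv_mul_cancel_left] at this

theorem HNT {a b : Kˣ} (h : ∀ v : Pl K, b ∈ NV (av v) (a : K)) : b ∈ Nm (a : K) := by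
  classical
  by_cases hns : IsSquare (a : K)
  · obtain ⟨c, hc⟩ := hns
    have hc0 : c ≠ 0 := by rintro rfl; simp at hc
    refine mem_Nm.2 ⟨(b + 1) / 2, (b - 1) / (2 * c), ?_⟩
    rw [hc]; field_simp; ring
  obtain ⟨L, _, _, _, ⟨q⟩⟩ := QE_exists hns
  have ha0 := a.ne_zero
  obtain ⟨S, hSf, -, hS, h2, hab⟩ := badset {a, b} ∅ Set.finite_empty
  have ha : a ∈ US S := hab a (by simp)
  have hb : b ∈ US S := hab b (by simp)
  have hr : 0 < Fintype.card (InfinitePlace K) := Fintype.card_pos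
  obtain ⟨T, hTk, hT, hTA⟩ := LT q hns ha0 hSf h2 ha (S.ncard + Fintype.card (InfinitePlace K) - 1) (by omega)
  set U := US (S ∪ T)
  have hSU : US S ≤ U := US_mono Set.subset_union_left
  have hSf' : (S ∪ T : Set (HeightOneSpectrum (𝓞 K))).Finite := hSf.union T.finite_toSet
  have hcard : (S ∪ T : Set (HeightOneSpectrum (𝓞 K))).ncard = S.ncard + (S.ncard + Fintype.card (InfinitePlace K) - 1) := by
    rw [Set.ncard_union_eq (Set.disjoint_left.2 fun p hp hp' => (hT p hp').1 hp) hSf T.finite_toSet, Set.ncard_coe_finset, hTk]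
  have c1 := SU hSf'
  obtain ⟨c2, c3⟩ := LS hSf
  have c4 := HC q hns ha0 hSf' (hS.mono Set.subset_union_left) (fun p hp => h2 p fun h => hp (Or.inl h)) (hSU ha)
  have c5 := LB (B := {v ∈ PS S | ¬ Sq (av v) (a : K)}) ((PS_fin hSf).subset (Set.sep_subset _ _)) ha0 fun v hv => hv.2
  rw [← NVI_res ha0] at c5
  have hset : {v ∈ PS (S ∪ T) | ¬ Sq (av v) (a : K)} = {v ∈ PS S | ¬ Sq (av v) (a : K)} := by
    ext v
    rcases v with p | w
    · simp only [Set.mem_setOf_eq, PS_inl]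
      refine and_congr_left fun h => ⟨fun h' => h'.resolve_right fun hp => h (hT p hp).2, Or.inl⟩
    · simp only [Set.mem_setOf_eq, PS_inr]
  rw [hset] at c4
  set t := {v ∈ PS S | ¬ Sq (av v) (a : K)}.ncard
  set D := ⨅ v ∈ PS S, SqG (av v)
  set N := ⨅ v ∈ PS S, NV (av v) (a : K)
  have hDm : ∀ u, u ∈ D ↔ ∀ v ∈ PS S, Sq (av v) (u : K) := fun u => by simp only [D, Subgroup.mem_iInf, mem_SqG]
  have hDN : D ≤ N := iInf₂_mono fun v _ => le_sup_right
  have hDU : D ⊓ U = KSq Kˣ ⊓ U := by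
    apply le_antisymm
    · rintro u ⟨hu, huU⟩
      exact ⟨KEY hSf T.finite_toSet hS h2 (fun p hp => (hT p hp).1) hTA huU ((hDm u).1 hu), huU⟩
    · refine inf_le_inf_right _ ?_
      rintro _ ⟨y, rfl⟩
      exact (hDm _).2 fun v _ => sq_mem_SqG (av v) y
  have e1 : D.relIndex U = 2 ^ (2 * (S.ncard + Fintype.card (InfinitePlace K)) - 1) := by
    rw [← Subgroup.inf_relIndex_right, hDU, Subgroup.inf_relIndex_right, c1, hcard]
    congr 1; omega
  have e2 := Subgroup.relIndex_mul_index (le_sup_right : D ≤ U ⊔ D)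
  rw [Subgroup.relIndex_sup_right, e1] at e2
  have e3 : (U ⊔ D).index ≠ 0 := by
    intro h0; rw [h0, mul_zero] at e2; exact c2.index_ne_zero e2.symm
  have e4 : (U ⊔ D).index ≤ 2 := by
    have : (4 : ℕ) ^ (S.ncard + Fintype.card (InfinitePlace K)) = 2 ^ (2 * (S.ncard + Fintype.card (InfinitePlace K)) - 1) * 2 := by
      rw [← pow_succ, show (4 : ℕ) = 2 ^ 2 by norm_num, ← pow_mul]; congr 1; omega
    rw [← e2, this] at c3
    exact Nat.le_of_mul_le_mul_left c3 (by positivity)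
  have e5 : (U ⊔ N).index ≤ 2 :=
    (Nat.le_of_dvd (Nat.pos_of_ne_zero e3) (Subgroup.index_dvd_of_le (sup_le_sup_left hDN U))).trans e4
  have e6 := Subgroup.relIndex_mul_index (le_sup_right : N ≤ U ⊔ N)
  rw [Subgroup.relIndex_sup_right] at e6
  set n := (US (SL L (S ∪ T))).map q.n
  have hnN : n ≤ N ⊓ U := by
    rintro _ ⟨m, hm, rfl⟩
    refine ⟨?_, n_US q hm⟩
    simp only [N, SetLike.mem_coe, Subgroup.mem_toSubmonoid, Subgroup.mem_iInf, Subgroup.coe_toSubmonoid]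
    exact fun v hv => Nm_NV (q.mem_Nm.2 ⟨m, rfl⟩)
  have e7 := Subgroup.relIndex_mul_relIndex _ _ _ hnN inf_le_right
  rw [Subgroup.inf_relIndex_right] at e7
  have ht : 0 < 2 ^ t := by positivity
  have e8 : n.relIndex (N ⊓ U) = 1 := by
    have h1 : 2 ^ t ≤ N.relIndex U * 2 := c5.trans (e6 ▸ Nat.mul_le_mul_left _ e5)
    rw [← e7] at c4
    rcases Nat.lt_or_ge (n.relIndex (N ⊓ U)) 2 with h | h
    · interval_cases hh : n.relIndex (N ⊓ U)
      · omega
      · rfl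
    · nlinarith
  have hbN : b ∈ N := by
    simp only [N, Subgroup.mem_iInf]
    exact fun v _ => h v
  obtain ⟨m, -, hm⟩ := Subgroup.relIndex_eq_one.1 e8 ⟨hbN, hSU hb⟩
  exact q.mem_Nm.2 ⟨m, hm⟩

end hnt
end QC

namespace QC
section t3
open NumberField IsDedekindDomain
variable {K : Type*} [Field K] [NumberField K]

theorem GS {a : K} (h : ∀ v : Pl K, Sq (av v) a) : IsSquare a := by
  by_contra hns
  have ha0 : a ≠ 0 := by rintro rfl; exact hns (IsSquare.zero)
  obtain ⟨p, -, hp⟩ := C1 ha0 hns Set.finite_empty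
  exact hp (h (Sum.inl p))

theorem NV_congr {v : AbsoluteValue K ℝ} {b s : Kˣ} (hs : s ∈ SqG v) : NV v ((b * s : Kˣ) : K) = NV v (b : K) := by
  ext x
  refine ⟨fun h => NV_symm ?_, fun h => NV_symm (mul_mem (NV_symm h) (Sq_NV hs))⟩
  exact (Subgroup.mul_mem_cancel_right _ (Sq_NV hs)).1 (NV_symm h)

theorem Nm_top {F : Type*} [Field F] [CharZero F] {a : F} (ha : IsSquare a) (ha0 : a ≠ 0) (x : Fˣ) : x ∈ Nm a := by
  obtain ⟨c, rfl⟩ := ha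
  have hc0 : c ≠ 0 := by rintro rfl; simp at ha0
  refine mem_Nm.2 ⟨(x + 1) / 2, (x - 1) / (2 * c), ?_⟩
  field_simp; ring

/-- descent -/
theorem TD {L : Type*} [Field L] [CharZero L] [Algebra K L] {a b c : Kˣ} (q : QE K L ((a * b : Kˣ) : K))
    (hω : ¬ IsSquare ((a * b : Kˣ) : K)) {X Y : L}
    (h : algebraMap K L c = X ^ 2 - algebraMap K L a * Y ^ 2) : c ∈ Nm (a : K) ⊔ Nm (b : K) := by
  obtain ⟨x0, x1, rfl⟩ := q.gen X
  obtain ⟨y0, y1, rfl⟩ := q.gen Y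
  have hα := q.hα
  have e1 : algebraMap K L (c - (x0 ^ 2 + a * b * x1 ^ 2 - a * (y0 ^ 2 + a * b * y1 ^ 2))) =
      algebraMap K L (2 * (x0 * x1 - a * y0 * y1)) * q.α := by
    have hα' := hα.trans (by rw [Units.val_mul, map_mul] : _ = algebraMap K L a * algebraMap K L b)
    simp only [map_sub, map_add, map_mul, map_pow, map_ofNat]
    linear_combination h + ((algebraMap K L x1) ^ 2 - algebraMap K L a * (algebraMap K L y1) ^ 2) * hα'
  set A := (c : K) - (x0 ^ 2 + a * b * x1 ^ 2 - a * (y0 ^ 2 + a * b * y1 ^ 2)) with hA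
  set B := 2 * (x0 * x1 - a * y0 * y1) with hB
  have hB0 : B = 0 := by
    by_contra hne
    refine hω ⟨A / B, (algebraMap K L).injective ?_⟩
    have : algebraMap K L B ≠ 0 := by simpa using hne
    rw [← hα, map_mul, map_div₀, e1]
    field_simp
  have hA0 : A = 0 := by
    rw [hB0] at e1
    exact (algebraMap K L).injective (by rw [e1]; simp)
  have hB1 : x0 * x1 - a * y0 * y1 = 0 := by
    simpa [hB] using hB0
  have ha0 := a.ne_zero
  have hc0 := c.ne_zero
  set k := x1 ^ 2 - a * y1 ^ 2 with hk
  by_cases hk0 : k = 0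
  · by_cases hy1 : y1 = 0
    · have hx1 : x1 = 0 := by rw [hk, hy1] at hk0; simpa using hk0
      refine Subgroup.mem_sup_left (mem_Nm.2 ⟨x0, y0, ?_⟩)
      rw [hA, hx1, hy1] at hA0
      linear_combination hA0
    · exact Subgroup.mem_sup_left (Nm_top ⟨x1 / y1, by field_simp; linear_combination -hk0⟩ ha0 c)
  · have hn : -a * Units.mk0 k hk0 ∈ Nm (a : K) := mul_mem (neg_Nm a) (mem_Nm.2 ⟨x1, y1, hk⟩)
    set e := a * (y1 * x0 - x1 * y0) / c with he
    have key : (c : K) * (e ^ 2 - b * (a * k / c) ^ 2) = -a * k := by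
      rw [he]; field_simp
      have h1 : (c - a * b * k) * k = -a * (y1 * x0 - x1 * y0) ^ 2 := by
        rw [hA] at hA0
        linear_combination k * hA0 + (x0 * x1 - a * y0 * y1) * hB1
      linear_combination h1
    have h0 : e ^ 2 - b * (a * k / c) ^ 2 ≠ 0 := by
      intro h0; rw [h0, mul_zero] at key
      exact mul_ne_zero (neg_ne_zero.2 ha0) hk0 key.symm
    have hc : c = (-a * Units.mk0 k hk0) * (Units.mk0 _ h0)⁻¹ := by
      rw [eq_mul_inv_iff_mul_eq]; ext; simpa using key
    rw [hc]
    exact Subgroup.mul_mem_sup hn (inv_mem (mem_Nm.2 ⟨_, _, rfl⟩))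

theorem NV_up {L : Type*} [Field L] [NumberField L] [Algebra K L] (w : Pl L) {a : K} {b : Kˣ}
    (h : b ∈ NV (av (pi K w)) a) : jj K L b ∈ NV (av w) (algebraMap K L a) := by
  obtain ⟨n, hn, s, hs, rfl⟩ := mem_NV.1 h
  rw [map_mul]
  refine mul_mem (Nm_NV ?_) (Sq_NV ?_)
  · obtain ⟨x, y, h⟩ := mem_Nm.1 hn
    exact mem_Nm.2 ⟨algebraMap K L x, algebraMap K L y, by rw [jj_val, h]; simp⟩
  · obtain ⟨t, ht, h1⟩ := pi_av (K := K) w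
    rw [mem_SqG, jj_val]
    exact Sq.of_equiv ht h1 hs

theorem T3n {a b c : Kˣ} (h : ∀ v : Pl K, c ∈ NV (av v) (a : K) ⊔ NV (av v) (b : K)) : c ∈ Nm (a : K) ⊔ Nm (b : K) := by
  by_cases hs : IsSquare ((a * b : Kˣ) : K)
  · obtain ⟨r, hr⟩ := hs
    have hr0 : r ≠ 0 := by rintro rfl; simp at hr
    have hb : (b : K) = a * (r / a) ^ 2 := by
      have := a.ne_zero
      field_simp; rw [pow_two, ← hr, Units.val_mul, mul_comm]
    refine Subgroup.mem_sup_left (HNT fun v => ?_)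
    have := h v
    rwa [hb, NV_sq _ _ (div_ne_zero hr0 a.ne_zero), sup_idem] at this
  · obtain ⟨L, _, _, _, ⟨q⟩⟩ := QE_exists hs
    have : jj K L c ∈ Nm ((jj K L a : Lˣ) : L) := by
      refine HNT fun w => ?_
      obtain ⟨x, hx, y, hy, hxy⟩ := Subgroup.mem_sup.1 (h (pi K w))
      rw [← hxy, map_mul, jj_val]
      refine mul_mem (NV_up w hx) ?_
      have h1 := NV_up w hy
      have ha0 : algebraMap K L a ≠ 0 := by simp
      have hα := q.hα
      have hα0 : q.α ≠ 0 := by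
        intro h0; rw [h0] at hα; simp at hα; 
      rwa [show algebraMap K L b = algebraMap K L a * (q.α / algebraMap K L a) ^ 2 by
        field_simp; rw [hα, Units.val_mul, map_mul, mul_comm], NV_sq _ _ (div_ne_zero hα0 ha0)] at h1
    obtain ⟨X, Y, hXY⟩ := mem_Nm.1 this
    rw [jj_val, jj_val] at hXY
    exact TD q hs hXY

/-- isotropic implies universal -/
theorem iso_univ {F : Type*} [Field F] [CharZero F] {a1 a2 a3 x y z : F} (h1 : a1 ≠ 0) (h2 : a2 ≠ 0) (h3 : a3 ≠ 0)
    (h : a1 * x ^ 2 + a2 * y ^ 2 + a3 * z ^ 2 = 0) (h0 : x ≠ 0 ∨ y ≠ 0 ∨ z ≠ 0) (β : F) :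
    ∃ x y z, a1 * x ^ 2 + a2 * y ^ 2 + a3 * z ^ 2 = β := by
  rcases h0 with h0 | h0 | h0
  · refine ⟨(β - a1) / (2 * a1 * x) * x + 1, (β - a1) / (2 * a1 * x) * y, (β - a1) / (2 * a1 * x) * z, ?_⟩
    have e : (β - a1) / (2 * a1 * x) * (2 * a1 * x) = β - a1 := div_mul_cancel₀ _ (by simp [*])
    linear_combination ((β - a1) / (2 * a1 * x)) ^ 2 * h + e
  · refine ⟨(β - a2) / (2 * a2 * y) * x, (β - a2) / (2 * a2 * y) * y + 1, (β - a2) / (2 * a2 * y) * z, ?_⟩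
    have e : (β - a2) / (2 * a2 * y) * (2 * a2 * y) = β - a2 := div_mul_cancel₀ _ (by simp [*])
    linear_combination ((β - a2) / (2 * a2 * y)) ^ 2 * h + e
  · refine ⟨(β - a3) / (2 * a3 * z) * x, (β - a3) / (2 * a3 * z) * y, (β - a3) / (2 * a3 * z) * z + 1, ?_⟩
    have e : (β - a3) / (2 * a3 * z) * (2 * a3 * z) = β - a3 := div_mul_cancel₀ _ (by simp [*])
    linear_combination ((β - a3) / (2 * a3 * z)) ^ 2 * h + e

/-- local condition for ternary representations -/
theorem T3g {a1 a2 a3 β : Kˣ} (h : ∀ v : Pl K, β * a1⁻¹ ∈ NV (av v) ((-a2 * a1⁻¹ : Kˣ) : K) ⊔ NV (av v) ((a3 * β⁻¹ : Kˣ) : K)) :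
    ∃ x y z : K, a1 * x ^ 2 + a2 * y ^ 2 + a3 * z ^ 2 = β := by
  have h' : β * a1⁻¹ ∈ Nm ((-a2 * a1⁻¹ : Kˣ) : K) ⊔ Nm ((a3 * β⁻¹ : Kˣ) : K) := T3n h
  clear h
  obtain ⟨n, hn, m, hm, hnm⟩ := Subgroup.mem_sup.1 h'
  obtain ⟨x, y, hxy⟩ := mem_Nm.1 hn
  obtain ⟨z, w, hzw⟩ := mem_Nm.1 (inv_mem hm)
  have e : (n : K) = β * (a1 : K)⁻¹ * (m⁻¹ : Kˣ) := by
    rw [← Units.val_inv_eq_inv_val a1, ← Units.val_mul, ← Units.val_mul, ← hnm, mul_inv_cancel_right]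
  rw [hxy, hzw] at e
  have h1 := a1.ne_zero
  have hβ := β.ne_zero
  simp at e
  field_simp at e
  have e2 : a1 * x ^ 2 + a2 * y ^ 2 + a3 * w ^ 2 = β * z ^ 2 := by linear_combination e
  by_cases hz : z = 0
  · refine iso_univ h1 a2.ne_zero a3.ne_zero (by rw [e2, hz]; simp) (x := x) (y := y) (z := w) ?_ _
    by_contra! h0
    obtain ⟨-, -, rfl⟩ := h0
    rw [hz] at hzw
    simp at hzw
  · refine ⟨x / z, y / z, w / z, ?_⟩
    field_simp
    linear_combination e2

/-- exact value gives local condition -/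
theorem T3l {v : AbsoluteValue K ℝ} {a1 a2 a3 β η : Kˣ} {x y z : K} (h : a1 * x ^ 2 + a2 * y ^ 2 + a3 * z ^ 2 = η)
    (hβ : η * β ∈ SqG v) : β * a1⁻¹ ∈ NV v ((-a2 * a1⁻¹ : Kˣ) : K) ⊔ NV v ((a3 * β⁻¹ : Kˣ) : K) := by
  have h1 := a1.ne_zero
  have hη := η.ne_zero
  have hs : (η * β)⁻¹ * η ^ 2 ∈ SqG v := mul_mem (inv_mem hβ) (sq_mem_SqG v _)
  have e1 : a3 * β⁻¹ = (a3 * η⁻¹) * ((η * β)⁻¹ * η ^ 2) := by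
    ext; have := β.ne_zero; simp; field_simp
  rw [e1, NV_congr hs]
  have e2 : β * a1⁻¹ = η * a1⁻¹ * ((η * β) * (η⁻¹) ^ 2) := by
    ext; simp; field_simp
  rw [e2]
  refine mul_mem ?_ (Subgroup.mem_sup_left (Sq_NV (mul_mem hβ (sq_mem_SqG v _))))
  by_cases h0 : 1 - ((a3 : K) * (η : K)⁻¹) * z ^ 2 = 0
  · have hz : z ≠ 0 := by rintro rfl; simp at h0
    refine Subgroup.mem_sup_right (Nm_NV (Nm_top ⟨z⁻¹, ?_⟩ (Units.ne_zero _) _))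
    simp
    field_simp at h0 ⊢
    linear_combination -h0
  · set m := Units.mk0 _ h0
    have hm : m ∈ Nm ((a3 * η⁻¹ : Kˣ) : K) := mem_Nm.2 ⟨1, z, by simp [m]⟩
    rw [← mul_inv_cancel_right (η * a1⁻¹) m]
    refine Subgroup.mul_mem_sup (Nm_NV (mem_Nm.2 ⟨x, y, ?_⟩)) (Nm_NV (inv_mem hm))
    simp [m]
    field_simp
    linear_combination -h

theorem T3 {a1 a2 a3 β : K} (h1 : a1 ≠ 0) (h2 : a2 ≠ 0) (h3 : a3 ≠ 0) (hβ : β ≠ 0)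
    (h : ∀ v : Pl K, ∀ ε > 0, ∃ x y z : K, av v (a1 * x ^ 2 + a2 * y ^ 2 + a3 * z ^ 2 - β) < ε) :
    ∃ x y z : K, a1 * x ^ 2 + a2 * y ^ 2 + a3 * z ^ 2 = β := by
  refine T3g (a1 := Units.mk0 _ h1) (a2 := Units.mk0 _ h2) (a3 := Units.mk0 _ h3) (β := Units.mk0 _ hβ) fun v => ?_
  obtain ⟨ε, hε, h4⟩ := Sq.near (av v) hβ
  obtain ⟨x, y, z, hx⟩ := h v ε hε
  obtain ⟨h5, h6⟩ := h4 _ hx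
  refine T3l (η := Units.mk0 _ h5) (x := x) (y := y) (z := z) rfl (mem_SqG.2 ?_)
  rw [mul_comm]; exact h6

end t3
end QC

namespace QC
section t5
open NumberField IsDedekindDomain

theorem sq_cont {K : Type*} [Field K] (v : AbsoluteValue K ℝ) (a X : K) {δ : ℝ} (hδ : 0 < δ) :
    ∃ ε > 0, ∀ y, v (y - X) < ε → v (a * y ^ 2 - a * X ^ 2) < δ := by
  have h0 : 0 < (v a + 1) * (1 + v (2 * X)) := by have := v.nonneg a; have := v.nonneg (2 * X); positivity
  refine ⟨min 1 (δ / ((v a + 1) * (1 + v (2 * X)))), by positivity, fun y hy => ?_⟩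
  have h1 := hy.trans_le (min_le_left _ _)
  have h2 := (lt_div_iff₀ h0).1 (hy.trans_le (min_le_right _ _))
  rw [show a * y ^ 2 - a * X ^ 2 = (y - X) * (a * ((y - X) + 2 * X)) by ring, map_mul, map_mul]
  refine lt_of_le_of_lt ?_ h2
  gcongr
  · linarith
  · exact (v.add_le _ _).trans (by linarith)

theorem small {K : Type*} [Field K] {v : AbsoluteValue K ℝ} (hv : v.IsNontrivial) (a : K) {δ : ℝ} (hδ : 0 < δ) :
    ∃ d : K, d ≠ 0 ∧ v (a * d ^ 2) < δ := by
  obtain ⟨ε, hε, h⟩ := sq_cont v a 0 hδ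
  obtain ⟨x, hx0, hx⟩ := hv.exists_abv_lt_one
  obtain ⟨n, hn⟩ := exists_pow_lt_of_lt_one hε hx
  refine ⟨x ^ n, pow_ne_zero _ hx0, ?_⟩
  simpa using h (x ^ n) (by simpa using hn)

theorem T5loc {K : Type*} [Field K] [CharZero K] {v : AbsoluteValue K ℝ} (hv : v.IsNontrivial) {a1 a2 a3 a4 a5 μ : K}
    (h3 : a3 ≠ 0) (h4 : a4 ≠ 0) (h5 : a5 ≠ 0) (hμ : μ ≠ 0)
    (h : ∀ ε > 0, ∃ x1 x2 x3 x4 x5 : K, v (a1 * x1 ^ 2 + a2 * x2 ^ 2 + a3 * x3 ^ 2 + a4 * x4 ^ 2 + a5 * x5 ^ 2 - μ) < ε) :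
    ∃ X1 X2 : K, ∃ ε > 0, ∀ y1 y2, v (y1 - X1) < ε → v (y2 - X2) < ε → μ - a1 * y1 ^ 2 - a2 * y2 ^ 2 ≠ 0 ∧
      ∃ x y z η, η ≠ 0 ∧ a3 * x ^ 2 + a4 * y ^ 2 + a5 * z ^ 2 = η ∧ Sq v (η * (μ - a1 * y1 ^ 2 - a2 * y2 ^ 2)) := by
  obtain ⟨ε0, hε0, hnear⟩ := Sq.near v hμ
  have hx : ∃ x1 x2 x3 x4 x5 : K, v (a1 * x1 ^ 2 + a2 * x2 ^ 2 + (a3 * x3 ^ 2 + a4 * x4 ^ 2 + a5 * x5 ^ 2) - μ) < ε0 ∧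
      (x3 ≠ 0 ∨ x4 ≠ 0 ∨ x5 ≠ 0) := by
    obtain ⟨x1, x2, x3, x4, x5, hx⟩ := h (ε0 / 2) (by positivity)
    by_cases h0 : x3 ≠ 0 ∨ x4 ≠ 0 ∨ x5 ≠ 0
    · refine ⟨x1, x2, x3, x4, x5, ?_, h0⟩
      rw [← add_assoc, ← add_assoc]; linarith
    · push Not at h0
      obtain ⟨rfl, rfl, rfl⟩ := h0
      obtain ⟨d, hd0, hd⟩ := small hv a3 (half_pos hε0)
      refine ⟨x1, x2, d, 0, 0, ?_, Or.inl hd0⟩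
      have := v.add_le (a1 * x1 ^ 2 + a2 * x2 ^ 2 + a3 * 0 ^ 2 + a4 * 0 ^ 2 + a5 * 0 ^ 2 - μ) (a3 * d ^ 2)
      refine lt_of_le_of_lt ?_ (lt_of_le_of_lt this ((add_lt_add hx hd).trans_eq (add_halves _)))
      apply le_of_eq; congr 1; ring
  obtain ⟨x1, x2, x3, x4, x5, hx, hx0⟩ := hx
  set g := a1 * x1 ^ 2 + a2 * x2 ^ 2 with hg
  have hT : ∃ t η : K, (∃ x y z, a3 * x ^ 2 + a4 * y ^ 2 + a5 * z ^ 2 = η) ∧ η ≠ 0 ∧ ∃ ε > 0, ∀ β, v (β - (μ - t ^ 2 * g)) < ε →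
      β ≠ 0 ∧ Sq v (η * β) := by
    set η := a3 * x3 ^ 2 + a4 * x4 ^ 2 + a5 * x5 ^ 2 with hη
    by_cases hη0 : η = 0
    · refine ⟨0, μ, iso_univ h3 h4 h5 hη0 hx0 μ, hμ, ε0, hε0, fun β hβ => hnear β ?_⟩
      simpa using hβ
    · obtain ⟨hm0, hms⟩ := hnear _ hx
      set m := g + η with hm
      have hc0 : μ / m * η ≠ 0 := mul_ne_zero (div_ne_zero hμ hm0) hη0
      obtain ⟨ε1, hε1, hn1⟩ := Sq.near v hc0
      have hs : Sq v (μ / m) := by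
        have := hms.mul (Sq.sq v m⁻¹)
        rwa [show μ * m * m⁻¹ ^ 2 = μ / m by field_simp] at this
      have hvg : 0 < v g + 1 := by have := v.nonneg g; positivity
      obtain ⟨t, ht⟩ := hs (ε1 / 2 / (v g + 1)) (by positivity)
      rw [lt_div_iff₀ hvg] at ht
      refine ⟨t, η, ⟨_, _, _, hη.symm⟩, hη0, ε1 / 2, by positivity, fun β hβ => ?_⟩
      have h1 : v (β - μ / m * η) < ε1 := by
        have e : β - μ / m * η = (β - (μ - t ^ 2 * g)) + (μ / m - t ^ 2) * g := by
          rw [show η = m - g by rw [hm]; ring]; field_simp; ring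
        rw [e]
        refine (v.add_le _ _).trans_lt ?_
        rw [map_mul]
        have := v.nonneg (μ / m - t ^ 2)
        nlinarith [v.nonneg g]
      obtain ⟨h2, h3⟩ := hn1 β h1
      refine ⟨h2, ?_⟩
      have := (h3.mul hs).mul (Sq.sq v (m / μ))
      rwa [show μ / m * η * β * (μ / m) * (m / μ) ^ 2 = η * β by field_simp] at this
  obtain ⟨t, η, ⟨x, y, z, hxyz⟩, hη, ε, hε, hT⟩ := hT
  obtain ⟨e1, he1, hc1⟩ := sq_cont v a1 (t * x1) (half_pos hε)
  obtain ⟨e2, he2, hc2⟩ := sq_cont v a2 (t * x2) (half_pos hε)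
  refine ⟨t * x1, t * x2, min e1 e2, by positivity, fun y1 y2 hy1 hy2 => ?_⟩
  have h1 := hc1 y1 (hy1.trans_le (min_le_left _ _))
  have h2 := hc2 y2 (hy2.trans_le (min_le_right _ _))
  obtain ⟨h3, h4⟩ := hT (μ - a1 * y1 ^ 2 - a2 * y2 ^ 2) (by
    rw [← v.map_neg]
    refine lt_of_le_of_lt (le_of_eq ?_) ((v.add_le _ _).trans_lt (add_lt_add h1 h2) |>.trans_eq (by ring))
    congr 1; rw [hg]; ring)
  exact ⟨h3, x, y, z, η, hη, hxyz, h4⟩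

variable {K : Type*} [Field K] [NumberField K]

theorem T5good (p : HeightOneSpectrum (𝓞 K)) (h2 : od p (2 : K) = 0) {c a u : Kˣ} (ha : od p (a : K) = 0)
    (hu : Even (od p (c : K)) ∨ ¬ Even (od p (u : K))) : c ∈ NV (ab p) (a : K) ⊔ NV (ab p) (u : K) := by
  rcases hu with ⟨k, hk⟩ | hu
  · obtain ⟨π, hπ0, hπ⟩ := exists_unif p
    set g := (Units.mk0 π hπ0) ^ k
    have hg : od p (g : K) = k := by rw [odu_zpow]; simp [hπ]
    have hx : od p ((c * g⁻¹ ^ 2 : Kˣ) : K) = 0 := by rw [odu, odu_pow, odu_inv, hg, hk]; push_cast; ring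
    have := mul_mem (NDu p h2 ha hx) (Nm_NV (sq_mem_Nm _ g))
    exact Subgroup.mem_sup_left (by simpa using this)
  · by_cases hs : Sq (ab p) (a : K)
    · rw [NV_eq_top a.ne_zero hs]; simp
    · rcases odd_cor p h2 hu ha hs c with h | h
      · exact Subgroup.mem_sup_right h
      · rw [← Subgroup.mul_mem_cancel_right _ (Subgroup.mem_sup_left (NDu p h2 ha ha))]
        exact Subgroup.mem_sup_right h

theorem T5 {a1 a2 a3 a4 a5 μ : K} (h3 : a3 ≠ 0) (h4 : a4 ≠ 0) (h5 : a5 ≠ 0) (hμ : μ ≠ 0)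
    (h : ∀ v : Pl K, ∀ ε > 0, ∃ x1 x2 x3 x4 x5 : K,
      av v (a1 * x1 ^ 2 + a2 * x2 ^ 2 + a3 * x3 ^ 2 + a4 * x4 ^ 2 + a5 * x5 ^ 2 - μ) < ε) :
    ∃ x1 x2 x3 x4 x5 : K, a1 * x1 ^ 2 + a2 * x2 ^ 2 + a3 * x3 ^ 2 + a4 * x4 ^ 2 + a5 * x5 ^ 2 = μ := by
  classical
  choose X1 X2 ε hε hX using fun v => T5loc (av_nontriv v) h3 h4 h5 hμ (h v)
  obtain ⟨S, hS, -, -, hS2, hSu⟩ := badset {Units.mk0 a3 h3, Units.mk0 a4 h4, Units.mk0 a5 h5} (∅ : Set (HeightOneSpectrum (𝓞 K))) Set.finite_empty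
  obtain ⟨y1, hy1⟩ := wa (PS_fin hS) X1 ε hε
  obtain ⟨y2, hy2⟩ := wa (PS_fin hS) X2 ε hε
  obtain ⟨w⟩ : Nonempty (InfinitePlace K) := inferInstance
  have hβ := (hX _ y1 y2 (hy1 _ (PS_inr w)) (hy2 _ (PS_inr w))).1
  set β := μ - a1 * y1 ^ 2 - a2 * y2 ^ 2 with hβd
  obtain ⟨x, y, z, hxyz⟩ := T3g (a1 := Units.mk0 _ h3) (a2 := Units.mk0 _ h4) (a3 := Units.mk0 _ h5) (β := Units.mk0 _ hβ) fun v => by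
    by_cases hv : v ∈ PS S
    · obtain ⟨-, x, y, z, η, hη, h6, h7⟩ := hX _ y1 y2 (hy1 _ hv) (hy2 _ hv)
      exact T3l (η := Units.mk0 _ hη) (x := x) (y := y) (z := z) h6 (mem_SqG.2 h7)
    · rcases v with p | w'
      · have hp : p ∉ S := fun h' => hv (PS_inl.2 h')
        have e3 : od p a3 = 0 := hSu (Units.mk0 a3 h3) (by simp) p hp
        have e4 : od p a4 = 0 := hSu (Units.mk0 a4 h4) (by simp) p hp
        have e5 : od p a5 = 0 := hSu (Units.mk0 a5 h5) (by simp) p hp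
        refine T5good p (hS2 p hp) ?_ ?_
        · rw [odu, odu_inv, Units.val_neg, od_neg]; simp [e3, e4]
        · rw [odu, odu, odu_inv, odu_inv]; simp only [Units.val_mk0, e3, e5]; simp only [neg_zero, zero_add, add_zero, even_neg]
          exact em _
      · exact (hv (PS_inr w')).elim
  refine ⟨y1, y2, x, y, z, ?_⟩
  simp only [Units.val_mk0, hβd] at hxyz
  linear_combination hxyz

end t5
end QC

namespace QC
section mat
open Matrix Polynomial

def Sol {F : Type*} [Field F] {n : ℕ} (A : Matrix (Fin n) (Fin n) F) (m : F[X]) : Prop :=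
  ∃ S : Matrix (Fin n) (Fin n) F, Sᵀ * A = -(A * S) ∧ S.charpoly = m

variable {F : Type*} [Field F] {n : ℕ}

theorem Sol_congrS {A P S : Matrix (Fin n) (Fin n) F} {m : F[X]} (hP : P.det ≠ 0) (hS : Sᵀ * A = -(A * S)) (hm : S.charpoly = m) :
    (P⁻¹ * S * P)ᵀ * (Pᵀ * A * P) = -((Pᵀ * A * P) * (P⁻¹ * S * P)) ∧ (P⁻¹ * S * P).charpoly = m := by
  have hu : IsUnit P.det := hP.isUnit
  refine ⟨?_, ?_⟩
  · have e : Pᵀ * (P⁻¹)ᵀ = 1 := by rw [← transpose_mul, nonsing_inv_mul _ hu, transpose_one]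
    have e2 : (P⁻¹)ᵀ * Pᵀ = 1 := by rw [← transpose_mul, mul_nonsing_inv _ hu, transpose_one]
    calc (P⁻¹ * S * P)ᵀ * (Pᵀ * A * P) = Pᵀ * Sᵀ * ((P⁻¹)ᵀ * Pᵀ) * A * P := by
          simp only [transpose_mul, Matrix.mul_assoc]
      _ = Pᵀ * (Sᵀ * A) * P := by rw [e2]; simp only [Matrix.mul_assoc, Matrix.one_mul]
      _ = -(Pᵀ * A * (P * P⁻¹) * S * P) := by
          rw [hS, mul_nonsing_inv _ hu]; simp only [Matrix.mul_assoc, Matrix.one_mul, Matrix.mul_neg, Matrix.neg_mul]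
      _ = _ := by simp only [Matrix.mul_assoc]
  · rw [← hm]
    rw [charpoly_mul_comm, ← Matrix.mul_assoc, mul_nonsing_inv _ hu, Matrix.one_mul]

theorem Sol_congr {A P : Matrix (Fin n) (Fin n) F} {m : F[X]} (hP : P.det ≠ 0) (h : Sol A m) : Sol (Pᵀ * A * P) m := by
  obtain ⟨S, hS, hm⟩ := h
  exact ⟨_, Sol_congrS hP hS hm⟩

theorem Sol_congr' {A P : Matrix (Fin n) (Fin n) F} {m : F[X]} (hP : P.det ≠ 0) (h : Sol (Pᵀ * A * P) m) : Sol A m := by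
  have hu : IsUnit P.det := hP.isUnit
  have := Sol_congr (P := P⁻¹) (by simpa [det_nonsing_inv] using hP) h
  have e2 : (P⁻¹)ᵀ * Pᵀ = 1 := by rw [← transpose_mul, mul_nonsing_inv _ hu, transpose_one]
  rwa [show (P⁻¹)ᵀ * (Pᵀ * A * P) * P⁻¹ = ((P⁻¹)ᵀ * Pᵀ) * A * (P * P⁻¹) by simp only [Matrix.mul_assoc], e2,
    mul_nonsing_inv _ hu, Matrix.one_mul, Matrix.mul_one] at this

noncomputable def NN (a : Fin n → F) (b : Fin n → Fin n → F) : Matrix (Fin n) (Fin n) F[X] :=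
  of fun i j => if i = j then X * C (a i) else - C (b i j)

theorem NN_eq {a : Fin n → F} {S : Matrix (Fin n) (Fin n) F} (h : Sᵀ * diagonal a = -(diagonal a * S))
    (h2 : (2 : F) ≠ 0) :
    C (∏ i, a i) * S.charpoly = (NN a fun i j => a i * S i j).det := by
  have e : diagonal (fun i => C (a i)) * charmatrix S = NN a fun i j => a i * S i j := by
    refine Matrix.ext fun i j => ?_
    rw [diagonal_mul]
    simp only [NN, of_apply]
    split_ifs with hij
    · subst hij
      have := congrFun (congrFun h i) i
      simp only [Matrix.neg_apply, diagonal_mul, mul_diagonal, transpose_apply] at this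
      have h0 : a i * S i i = 0 := by
        have : 2 * (a i * S i i) = 0 := by linear_combination this
        simpa [h2] using this
      rw [charmatrix_apply_eq, mul_sub, ← C_mul, h0, map_zero, sub_zero, mul_comm]
    · rw [charmatrix_apply_ne _ _ _ hij]; simp
  rw [← e, det_mul, det_diagonal, charpoly, map_prod]

theorem Sol_diag (h2 : (2 : F) ≠ 0) {a : Fin n → F} (ha : ∀ i, a i ≠ 0) {m : F[X]} :
    Sol (diagonal a) m ↔ ∃ b : Fin n → Fin n → F, (∀ i j, b j i = - b i j) ∧ C (∏ i, a i) * m = (NN a b).det := by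
  constructor
  · rintro ⟨S, hS, rfl⟩
    refine ⟨fun i j => a i * S i j, fun i j => ?_, NN_eq hS h2⟩
    have := congrFun (congrFun hS i) j
    simp only [Matrix.neg_apply, diagonal_mul, mul_diagonal, transpose_apply] at this
    linear_combination this
  · rintro ⟨b, hb, h⟩
    have hS : (of fun i j => (a i)⁻¹ * b i j : Matrix (Fin n) (Fin n) F)ᵀ * diagonal a =
        -(diagonal a * (of fun i j => (a i)⁻¹ * b i j)) := by
      refine Matrix.ext fun i j => ?_
      simp only [Matrix.neg_apply, diagonal_mul, mul_diagonal, transpose_apply, of_apply]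
      rw [mul_inv_cancel_left₀ (ha i), mul_comm, mul_inv_cancel_left₀ (ha j), hb]
    refine ⟨_, hS, ?_⟩
    have h1 := NN_eq hS h2
    have e : (fun i j => a i * (of fun i j => (a i)⁻¹ * b i j : Matrix (Fin n) (Fin n) F) i j) = b := by
      funext i j; simp [mul_inv_cancel_left₀ (ha i)]
    rw [e, ← h] at h1
    exact mul_left_cancel₀ (by simpa [Finset.prod_eq_zero_iff] using ha) h1

theorem det2 (a : Fin 2 → F) (b : Fin 2 → Fin 2 → F) (hb : ∀ i j, b j i = - b i j) :
    (NN a b).det = C (a 0 * a 1) * X ^ 2 + C (b 0 1 ^ 2) := by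
  simp [det_succ_row_zero, Fin.sum_univ_succ, NN, hb 0 1, Fin.succAbove]
  ring

theorem det3 (a : Fin 3 → F) (b : Fin 3 → Fin 3 → F) (hb : ∀ i j, b j i = - b i j) :
    (NN a b).det = C (a 0 * a 1 * a 2) * X ^ 3 + C (b 0 1 ^ 2 * a 2 + b 0 2 ^ 2 * a 1 + b 1 2 ^ 2 * a 0) * X := by
  simp [det_succ_row_zero, Fin.sum_univ_succ, NN, hb 0 1, hb 0 2, hb 1 2, Fin.succAbove]
  ring

def Pf (x01 x23 x02 x13 x03 x12 : F) : F := x01 * x23 - x02 * x13 + x03 * x12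

theorem det4 (a : Fin 4 → F) (b : Fin 4 → Fin 4 → F) (hb : ∀ i j, b j i = - b i j) :
    (NN a b).det = C (a 0 * a 1 * a 2 * a 3) * X ^ 4 + C (b 0 1 ^ 2 * a 2 * a 3 + b 0 2 ^ 2 * a 1 * a 3 +
      b 0 3 ^ 2 * a 1 * a 2 + b 1 2 ^ 2 * a 0 * a 3 + b 1 3 ^ 2 * a 0 * a 2 + b 2 3 ^ 2 * a 0 * a 1) * X ^ 2 +
      C (Pf (b 0 1) (b 2 3) (b 0 2) (b 1 3) (b 0 3) (b 1 2) ^ 2) := by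
  simp [det_succ_row_zero, Fin.sum_univ_succ, NN, hb 0 1, hb 0 2, hb 1 2, hb 0 3, hb 1 3, hb 2 3, Fin.succAbove, Pf]
  ring

theorem det5 (a : Fin 5 → F) (b : Fin 5 → Fin 5 → F) (hb : ∀ i j, b j i = - b i j) :
    (NN a b).det = C (a 0 * a 1 * a 2 * a 3 * a 4) * X ^ 5 + C (b 0 1 ^ 2 * a 2 * a 3 * a 4 + b 0 2 ^ 2 * a 1 * a 3 * a 4 +
      b 0 3 ^ 2 * a 1 * a 2 * a 4 + b 1 2 ^ 2 * a 0 * a 3 * a 4 + b 1 3 ^ 2 * a 0 * a 2 * a 4 + b 2 3 ^ 2 * a 0 * a 1 * a 4 +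
      b 0 4 ^ 2 * a 1 * a 2 * a 3 + b 1 4 ^ 2 * a 0 * a 2 * a 3 + b 2 4 ^ 2 * a 0 * a 1 * a 3 + b 3 4 ^ 2 * a 0 * a 1 * a 2) * X ^ 3 +
      C (a 4 * Pf (b 0 1) (b 2 3) (b 0 2) (b 1 3) (b 0 3) (b 1 2) ^ 2 + a 3 * Pf (b 0 1) (b 2 4) (b 0 2) (b 1 4) (b 0 4) (b 1 2) ^ 2 +
      a 2 * Pf (b 0 1) (b 3 4) (b 0 3) (b 1 4) (b 0 4) (b 1 3) ^ 2 + a 1 * Pf (b 0 2) (b 3 4) (b 0 3) (b 2 4) (b 0 4) (b 2 3) ^ 2 +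
      a 0 * Pf (b 1 2) (b 3 4) (b 1 3) (b 2 4) (b 1 4) (b 2 3) ^ 2) * X := by
  simp [det_succ_row_zero, Fin.sum_univ_succ, NN, hb 0 1, hb 0 2, hb 1 2, hb 0 3, hb 1 3, hb 2 3,
    hb 0 4, hb 1 4, hb 2 4, hb 3 4, Fin.succAbove, Pf]
  ring

end mat
end QC

namespace QC
section dg
open Matrix Polynomial
variable {F : Type*} [Field F] {n : ℕ}

theorem fam {A : Matrix (Fin n) (Fin n) F} {w : Fin n → Fin n → F} {d : Fin n → F} (hd : ∀ i, d i ≠ 0)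
    (h : ∀ i, w i ⬝ᵥ A *ᵥ w i = d i) (ho : ∀ i j, i ≠ j → w i ⬝ᵥ A *ᵥ w j = 0) :
    ∃ P : Matrix (Fin n) (Fin n) F, P.det ≠ 0 ∧ Pᵀ * A * P = diagonal d := by
  have e : (of w) * A * (of w)ᵀ = diagonal d := by
    refine Matrix.ext fun i j => ?_
    rw [Matrix.mul_assoc, mul_apply_eq_vecMul, ← mulVec_transpose, diagonal_apply]
    have : ((A * (of w)ᵀ)ᵀ *ᵥ of w i) j = w i ⬝ᵥ A *ᵥ w j := by
      rw [mulVec_transpose, vecMul, dotProduct, dotProduct]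
      rfl
    rw [this]
    split_ifs with hij
    · rw [← hij, h]
    · exact ho i j hij
  refine ⟨(of w)ᵀ, ?_, by rw [transpose_transpose, e]⟩
  intro h0
  have := congrArg det e
  rw [det_mul, h0, mul_zero, det_diagonal] at this
  exact Finset.prod_ne_zero_iff.2 (fun i _ => hd i) this.symm

theorem DG1 (h2 : (2 : F) ≠ 0) {A : Matrix (Fin n) (Fin n) F} (hs : A.IsSymm) (hA : A.det ≠ 0) :
    ∃ (P : Matrix (Fin n) (Fin n) F) (d : Fin n → F), P.det ≠ 0 ∧ (∀ i, d i ≠ 0) ∧ Pᵀ * A * P = diagonal d := by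
  haveI : Invertible (2 : F) := invertibleOfNonzero h2
  obtain ⟨v, hv⟩ := LinearMap.BilinForm.exists_orthogonal_basis (B := A.toBilin') ⟨(isSymm_toBilin'_iff_isSymm.2 hs).eq⟩
  have hnd := hv.not_isOrtho_basis_self_of_separatingLeft (LinearMap.BilinForm.nondegenerate_toBilin'_of_det_ne_zero' A hA).1
  let g : Fin n ≃ Fin (Module.finrank F (Fin n → F)) := finCongr (by simp)
  obtain ⟨P, h1, h2⟩ := fam (A := A) (w := fun i => v (g i)) (d := fun i => v (g i) ⬝ᵥ A *ᵥ v (g i))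
    (fun i => by have := hnd (g i); rwa [toBilin'_apply'] at this) (fun i => rfl)
    (fun i j hij => by have := hv (g.injective.ne hij); simpa only [Function.onFun, toBilin'_apply'] using this)
  exact ⟨P, _, h1, fun i => by have := hnd (g i); rwa [toBilin'_apply'] at this, h2⟩

theorem DG2 (h2 : (2 : F) ≠ 0) {A : Matrix (Fin (n + 1)) (Fin (n + 1)) F} (hs : A.IsSymm) (hA : A.det ≠ 0) {e : Fin (n + 1) → F}
    (he : e ⬝ᵥ A *ᵥ e ≠ 0) :
    ∃ (P : Matrix (Fin (n + 1)) (Fin (n + 1)) F) (d : Fin (n + 1) → F), P.det ≠ 0 ∧ (∀ i, d i ≠ 0) ∧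
      Pᵀ * A * P = diagonal d ∧ d (Fin.last n) = e ⬝ᵥ A *ᵥ e := by
  haveI : Invertible (2 : F) := invertibleOfNonzero h2
  set B := A.toBilin' with hB
  have hsy : ∀ x y, B x y = B y x := (isSymm_toBilin'_iff_isSymm.2 hs).eq
  have hee : B e e ≠ 0 := by rwa [hB, toBilin'_apply']
  set W := LinearMap.ker (B e) with hW
  have hdim : Module.finrank F W = n := by
    have h1 := LinearMap.finrank_range_add_finrank_ker (B e)
    have h3 : LinearMap.range (B e) = ⊤ := LinearMap.range_eq_top.2 (LinearMap.surjective (by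
      intro h; rw [h] at hee; simp at hee))
    rw [h3, finrank_top, Module.finrank_self, Module.finrank_fin_fun] at h1
    rw [hW]; omega
  obtain ⟨v, hv⟩ := LinearMap.BilinForm.exists_orthogonal_basis (B := B.domRestrict₁₂ W W)
    ⟨fun x y => by simp only [LinearMap.domRestrict₁₂_apply]; exact hsy x y⟩
  have hnd := hv.not_isOrtho_basis_self_of_separatingLeft (by
    intro w hw
    ext1
    refine (LinearMap.BilinForm.nondegenerate_toBilin'_of_det_ne_zero' A hA).1 w fun x => ?_
    have hx : x - (B e x / B e e) • e ∈ W := by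
      rw [hW, LinearMap.mem_ker]; simp; field_simp; simp
    have h3 := hw ⟨_, hx⟩
    have h4 : B w e = 0 := by rw [hsy]; exact w.2
    simp only [LinearMap.domRestrict₁₂_apply, map_sub, map_smul, h4] at h3
    simpa using h3)
  let g : Fin n ≃ Fin (Module.finrank F W) := finCongr hdim.symm
  have hself : ∀ i, (v (g i) : Fin (n + 1) → F) ⬝ᵥ A *ᵥ (v (g i)) ≠ 0 := fun i => by
    have := hnd (g i); rwa [LinearMap.domRestrict₁₂_apply, hB, toBilin'_apply'] at this
  let w : Fin (n + 1) → Fin (n + 1) → F := Fin.snoc (fun i => (v (g i) : Fin (n + 1) → F)) e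
  have hd : ∀ i, w i ⬝ᵥ A *ᵥ w i ≠ 0 := by
    intro i
    refine Fin.lastCases ?_ (fun i => ?_) i
    · simpa [w] using he
    · simpa [w] using hself i
  have ho : ∀ i j, i ≠ j → w i ⬝ᵥ A *ᵥ w j = 0 := by
    intro i j hij
    rw [← toBilin'_apply', ← hB]
    induction i using Fin.lastCases with
    | last =>
      induction j using Fin.lastCases with
      | last => exact (hij rfl).elim
      | cast j => simp only [w, Fin.snoc_castSucc, Fin.snoc_last]; exact (v (g j)).2
    | cast i =>
      induction j using Fin.lastCases with
      | last => simp only [w, Fin.snoc_castSucc, Fin.snoc_last]; rw [hsy]; exact (v (g i)).2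
      | cast j =>
        simp only [w, Fin.snoc_castSucc]
        exact hv (g.injective.ne fun h => hij (by rw [h]))
  obtain ⟨P, h1, h2⟩ := fam (A := A) (w := w) (d := fun i => w i ⬝ᵥ A *ᵥ w i) hd (fun i => rfl) ho
  exact ⟨P, _, h1, hd, h2, by simp [w]⟩

/-- reflection -/
theorem refl1 {a : Fin n → F} {u : Fin n → F} (hu : u ⬝ᵥ diagonal a *ᵥ u ≠ 0) :
    ∃ R : Matrix (Fin n) (Fin n) F, R.det ≠ 0 ∧ Rᵀ * diagonal a * R = diagonal a ∧ ∀ x, R *ᵥ x =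
      x - (2 * (u ⬝ᵥ diagonal a *ᵥ x) / (u ⬝ᵥ diagonal a *ᵥ u)) • u := by
  set A := diagonal a with hA
  have hAs : Aᵀ = A := by rw [hA, diagonal_transpose]
  set c := 2 / (u ⬝ᵥ A *ᵥ u) with hc
  have key : ∀ x, (1 - c • vecMulVec u (A *ᵥ u)) *ᵥ x = x - (2 * (u ⬝ᵥ A *ᵥ x) / (u ⬝ᵥ A *ᵥ u)) • u := by
    intro x
    rw [sub_mulVec, one_mulVec, smul_mulVec, vecMulVec_mulVec]
    have : (A *ᵥ u) ⬝ᵥ x = u ⬝ᵥ A *ᵥ x := by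
      rw [dotProduct_mulVec, ← mulVec_transpose, hAs]
    rw [this]
    congr 1
    ext i
    simp [hc]; ring
  set R := 1 - c • vecMulVec u (A *ᵥ u) with hR
  have hinv : R * R = 1 := by
    refine Matrix.ext_iff_mulVec.2 fun x => ?_
    rw [← mulVec_mulVec, key, key, one_mulVec]
    rw [mulVec_sub, mulVec_smul, dotProduct_sub, dotProduct_smul, sub_sub, ← add_smul]
    rw [sub_eq_self, smul_eq_mul]
    rw [show 2 * (u ⬝ᵥ A *ᵥ x) / (u ⬝ᵥ A *ᵥ u) + 2 * (u ⬝ᵥ A *ᵥ x - 2 * (u ⬝ᵥ A *ᵥ x) / (u ⬝ᵥ A *ᵥ u) * (u ⬝ᵥ A *ᵥ u)) / (u ⬝ᵥ A *ᵥ u) = 0 by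
      field_simp; ring, zero_smul]
  refine ⟨R, ?_, ?_, key⟩
  · intro h0
    have := congrArg det hinv
    rw [det_mul, h0] at this; simp at this
  · have : Rᵀ * A = A * R := by
      rw [hR]
      simp only [transpose_sub, transpose_one, transpose_smul, transpose_vecMulVec, Matrix.sub_mul, Matrix.mul_sub,
        Matrix.one_mul, Matrix.mul_one, smul_mul, Matrix.mul_smul, mul_vecMulVec, vecMulVec_mul]
      rw [← mulVec_transpose, hAs]
    rw [this, Matrix.mul_assoc, hinv, Matrix.mul_one]

end dg
end QC

namespace QC
section w5
open Matrix Polynomial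

def E4 {F : Type*} [Field F] (a0 a1 a2 a3 p q b01 b02 b03 b12 b13 b23 : F) : Prop :=
  b01 ^ 2 * a2 * a3 + b02 ^ 2 * a1 * a3 + b03 ^ 2 * a1 * a2 + b12 ^ 2 * a0 * a3 + b13 ^ 2 * a0 * a2 + b23 ^ 2 * a0 * a1 =
    p * (a0 * a1 * a2 * a3) ∧ Pf b01 b23 b02 b13 b03 b12 ^ 2 = q * (a0 * a1 * a2 * a3)

theorem Sol5_coeff {F : Type*} [Field F] {a : Fin 5 → F} {b : Fin 5 → Fin 5 → F} {p q : F} (hb : ∀ i j, b j i = - b i j)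
    (h : C (∏ i, a i) * (X ^ 5 + C p * X ^ 3 + C q * X) = (NN a b).det) :
    (b 0 1 ^ 2 * a 2 * a 3 * a 4 + b 0 2 ^ 2 * a 1 * a 3 * a 4 +
      b 0 3 ^ 2 * a 1 * a 2 * a 4 + b 1 2 ^ 2 * a 0 * a 3 * a 4 + b 1 3 ^ 2 * a 0 * a 2 * a 4 + b 2 3 ^ 2 * a 0 * a 1 * a 4 +
      b 0 4 ^ 2 * a 1 * a 2 * a 3 + b 1 4 ^ 2 * a 0 * a 2 * a 3 + b 2 4 ^ 2 * a 0 * a 1 * a 3 + b 3 4 ^ 2 * a 0 * a 1 * a 2) =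
      p * (a 0 * a 1 * a 2 * a 3 * a 4) ∧
    (a 4 * Pf (b 0 1) (b 2 3) (b 0 2) (b 1 3) (b 0 3) (b 1 2) ^ 2 + a 3 * Pf (b 0 1) (b 2 4) (b 0 2) (b 1 4) (b 0 4) (b 1 2) ^ 2 +
      a 2 * Pf (b 0 1) (b 3 4) (b 0 3) (b 1 4) (b 0 4) (b 1 3) ^ 2 + a 1 * Pf (b 0 2) (b 3 4) (b 0 3) (b 2 4) (b 0 4) (b 2 3) ^ 2 +
      a 0 * Pf (b 1 2) (b 3 4) (b 1 3) (b 2 4) (b 1 4) (b 2 3) ^ 2) = q * (a 0 * a 1 * a 2 * a 3 * a 4) := by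
  rw [det5 a b hb, Fin.prod_univ_five] at h
  have h3 := congrArg (fun f => coeff f 3) h
  have h1 := congrArg (fun f => coeff f 1) h
  simp only [mul_add, ← mul_assoc, ← C_mul, coeff_add, coeff_C_mul, coeff_X_pow, coeff_X] at h3 h1
  norm_num at h3 h1
  constructor
  · rw [← h3]; ring
  · rw [← h1]; ring

theorem W5 {F : Type*} [Field F] (h2 : (2 : F) ≠ 0) {a : Fin 5 → F} (ha : ∀ i, a i ≠ 0) {p q c : F} (hc : c ≠ 0)
    (hq : q * (a 0 * a 1 * a 2 * a 3 * a 4) = a 4 * c ^ 2)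
    (h : Sol (diagonal a) (X ^ 5 + C p * X ^ 3 + C q * X)) :
    ∃ b01 b02 b03 b12 b13 b23, E4 (a 0) (a 1) (a 2) (a 3) p q b01 b02 b03 b12 b13 b23 := by
  obtain ⟨S, hS, hm⟩ := h
  have key : ∀ S : Matrix (Fin 5) (Fin 5) F, Sᵀ * diagonal a = -(diagonal a * S) →
      ∀ i j, a j * S j i = - (a i * S i j) := by
    intro S hS i j
    have := congrFun (congrFun hS i) j
    simp only [Matrix.neg_apply, diagonal_mul, mul_diagonal, transpose_apply] at this
    linear_combination this
  have hb := key S hS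
  obtain ⟨-, hk⟩ := Sol5_coeff (b := fun i j => a i * S i j) hb (by rw [← hm]; exact NN_eq hS h2)
  set b := fun i j => a i * S i j with hbd
  have hbd' : ∀ i j, a i * S i j = b i j := fun i j => rfl
  have hb' : ∀ i j, b j i = - b i j := hb
  have hb0 : ∀ i, b i i = 0 := fun i => by
    have := hb' i i
    have : 2 * b i i = 0 := by linear_combination this
    simpa [h2] using this
  set k : Fin 5 → F := ![Pf (b 1 2) (b 3 4) (b 1 3) (b 2 4) (b 1 4) (b 2 3), -Pf (b 0 2) (b 3 4) (b 0 3) (b 2 4) (b 0 4) (b 2 3),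
    Pf (b 0 1) (b 3 4) (b 0 3) (b 1 4) (b 0 4) (b 1 3), -Pf (b 0 1) (b 2 4) (b 0 2) (b 1 4) (b 0 4) (b 1 2),
    Pf (b 0 1) (b 2 3) (b 0 2) (b 1 3) (b 0 3) (b 1 2)] with hkd
  have hSk : S *ᵥ k = 0 := by
    funext i
    refine mul_left_cancel₀ (ha i) ?_
    simp only [mulVec, dotProduct, Fin.sum_univ_five, mul_add, ← mul_assoc, hbd', Pi.zero_apply, mul_zero]
    fin_cases i <;> simp [hkd, hb0, hb' 0 1, hb' 0 2, hb' 1 2, hb' 0 3, hb' 1 3, hb' 2 3, hb' 0 4, hb' 1 4, hb' 2 4, hb' 3 4, Pf] <;> ring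
  have hkk : a 0 * k 0 ^ 2 + a 1 * k 1 ^ 2 + a 2 * k 2 ^ 2 + a 3 * k 3 ^ 2 + a 4 * k 4 ^ 2 = a 4 * c ^ 2 := by
    rw [← hq, ← hk]; simp [hkd]; ring
  clear_value k b
  wlog hck : c ≠ k 4 generalizing c
  · refine this (c := -c) (neg_ne_zero.2 hc) (by rw [hq]; ring) (by rw [hkk]; ring) ?_
    push Not at hck
    rw [← hck]
    intro h
    have : 2 * c = 0 := by linear_combination -h
    simp [h2, hc] at this
  set e : Fin 5 → F := Pi.single 4 1 with he
  have fD : ∀ x y : Fin 5 → F, x ⬝ᵥ diagonal a *ᵥ y = a 0 * x 0 * y 0 + a 1 * x 1 * y 1 + a 2 * x 2 * y 2 + a 3 * x 3 * y 3 + a 4 * x 4 * y 4 := by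
    intro x y; simp [dotProduct, mulVec_diagonal, Fin.sum_univ_five]; ring
  have fu : (k - c • e) ⬝ᵥ diagonal a *ᵥ (k - c • e) = 2 * c * a 4 * (c - k 4) := by
    rw [fD]; simp [he]; linear_combination hkk
  have fe : (k - c • e) ⬝ᵥ diagonal a *ᵥ e = a 4 * (k 4 - c) := by
    rw [fD]; simp [he]
  have hck' : c - k 4 ≠ 0 := sub_ne_zero.2 hck
  have ha4 := ha 4
  obtain ⟨R, hR, hRa, hRx⟩ := refl1 (a := a) (u := k - c • e) (by rw [fu]; simp [h2, hc, ha4, hck'])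
  have hRe : R *ᵥ e = c⁻¹ • k := by
    rw [hRx, fu, fe, show 2 * (a 4 * (k 4 - c)) / (2 * c * a 4 * (c - k 4)) = -c⁻¹ by field_simp; ring]
    rw [neg_smul, smul_sub, smul_smul, inv_mul_cancel₀ hc]; simp
  obtain ⟨h3, h4⟩ := Sol_congrS hR hS hm
  rw [hRa] at h3
  set S' := R⁻¹ * S * R
  have hS' : S' *ᵥ e = 0 := by
    rw [← mulVec_mulVec, hRe, mulVec_smul, ← mulVec_mulVec, hSk, mulVec_zero, smul_zero]
  have h04 : ∀ i, S' i 4 = 0 := fun i => by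
    have := congrFun hS' i; simpa [he] using this
  obtain ⟨h5, h6⟩ := Sol5_coeff (b := fun i j => a i * S' i j) (key S' h3) (by rw [← h4]; exact NN_eq h3 h2)
  simp only [h04, Pf] at h5 h6
  refine ⟨a 0 * S' 0 1, a 0 * S' 0 2, a 0 * S' 0 3, a 1 * S' 1 2, a 1 * S' 1 3, a 2 * S' 2 3,
    mul_right_cancel₀ ha4 ?_, mul_right_cancel₀ ha4 ?_⟩
  · linear_combination h5
  · rw [Pf]; linear_combination h6

end w5
end QC

namespace QC
section n4
open NumberField Polynomial

theorem apx {K C : Type*} [Field K] [NormedField C] {v : AbsoluteValue K ℝ} {i : K →+* C} (hd : DenseRange i)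
    (hi : ∀ x, ‖i x‖ = v x) {n : ℕ} (G1 G2 : (Fin n → K) → K) (F1 F2 : (Fin n → C) → C) (c1 : Continuous F1) (c2 : Continuous F2)
    (h1 : ∀ x, i (G1 x) = F1 (i ∘ x)) (h2 : ∀ x, i (G2 x) = F2 (i ∘ x)) {y : Fin n → C} {β1 β2 : K}
    (e1 : F1 y = i β1) (e2 : F2 y = i β2) {ε : ℝ} (hε : 0 < ε) : ∃ x, v (G1 x - β1) < ε ∧ v (G2 x - β2) < ε := by
  have hdp : DenseRange (fun x : Fin n → K => (i ∘ x : Fin n → C)) := DenseRange.piMap fun _ => hd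
  have ho : IsOpen {z | ‖F1 z - i β1‖ < ε ∧ ‖F2 z - i β2‖ < ε} := IsOpen.inter
    (isOpen_lt (f := fun z => ‖F1 z - i β1‖) (by fun_prop) continuous_const)
    (isOpen_lt (f := fun z => ‖F2 z - i β2‖) (by fun_prop) continuous_const)
  obtain ⟨x, hx⟩ := hdp.exists_mem_open ho ⟨y, by simp [e1, e2, hε]⟩
  refine ⟨x, ?_⟩
  rw [← hi, ← hi, map_sub, map_sub, h1, h2]
  exact hx

def Q4 {F : Type*} [Field F] (a0 a1 a2 a3 b01 b02 b03 b12 b13 b23 : F) : F :=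
  b01 ^ 2 * a2 * a3 + b02 ^ 2 * a1 * a3 + b03 ^ 2 * a1 * a2 + b12 ^ 2 * a0 * a3 + b13 ^ 2 * a0 * a2 + b23 ^ 2 * a0 * a1

theorem idG {F : Type*} [Field F] {a0 a1 a2 a3 b01 b02 b03 b12 b13 b23 w : F} (h0 : a0 ≠ 0) (h1 : a1 ≠ 0) (h2 : a2 ≠ 0) (h3 : a3 ≠ 0)
    (hw : w ^ 2 = a0 * a1 * a2 * a3) :
    a0 * a1 * (b23 + b01 / (a0 * a1) * w) ^ 2 + a0 * a2 * (-b13 + b02 / (a0 * a2) * w) ^ 2 +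
      a0 * a3 * (b12 + b03 / (a0 * a3) * w) ^ 2 =
    Q4 a0 a1 a2 a3 b01 b02 b03 b12 b13 b23 + 2 * w * Pf b01 b23 b02 b13 b03 b12 := by
  rw [Q4, Pf]
  field_simp
  linear_combination (b01 ^ 2 * a2 * a3 + b02 ^ 2 * a1 * a3 + b03 ^ 2 * a1 * a2) * hw

variable {K : Type*} [Field K] [NumberField K]

theorem N4a {L : Type*} [Field L] [NumberField L] [Algebra K L] {a0 a1 a2 a3 p q r : K} (h0 : a0 ≠ 0) (h1 : a1 ≠ 0) (h2 : a2 ≠ 0) (h3 : a3 ≠ 0)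
    (hpq : p ^ 2 ≠ 4 * q) (hr : r ^ 2 = q * (a0 * a1 * a2 * a3))
    (h : ∀ v : Pl K, ∀ ε > 0, ∃ b01 b02 b03 b12 b13 b23 : K, av v (Q4 a0 a1 a2 a3 b01 b02 b03 b12 b13 b23 - p * (a0 * a1 * a2 * a3)) < ε ∧
      av v (Pf b01 b23 b02 b13 b03 b12 - r) < ε) {w : L} (hw : w ^ 2 = algebraMap K L (a0 * a1 * a2 * a3)) :
    ∃ x y z : L, algebraMap K L (a0 * a1) * x ^ 2 + algebraMap K L (a0 * a2) * y ^ 2 + algebraMap K L (a0 * a3) * z ^ 2 =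
      algebraMap K L (p * (a0 * a1 * a2 * a3)) + 2 * w * algebraMap K L r := by
  have hA : a0 * a1 * a2 * a3 ≠ 0 := by simp [*]
  refine T3 (by simp [*]) (by simp [*]) (by simp [*]) ?_ fun v ε hε => ?_
  · intro hβ
    refine hpq (mul_right_cancel₀ (pow_ne_zero 2 hA) ((algebraMap K L).injective ?_))
    have hr' := congrArg (algebraMap K L) hr
    simp only [map_mul, map_pow, map_ofNat] at hβ hr' hw ⊢
    linear_combination ((algebraMap K L) p * ((algebraMap K L) a0 * (algebraMap K L) a1 * (algebraMap K L) a2 * (algebraMap K L) a3) -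
      2 * w * (algebraMap K L) r) * hβ + 4 * (algebraMap K L r) ^ 2 * hw +
      4 * ((algebraMap K L) a0 * (algebraMap K L) a1 * (algebraMap K L) a2 * (algebraMap K L) a3) * hr'
  · obtain ⟨t, ht, hv⟩ := pi_av (K := K) v
    have hD : 0 < 1 + av v (2 * w) := by have := (av v).nonneg (2 * w); positivity
    set δ := ε / 2 / (1 + av v (2 * w)) with hδ
    have hδ0 : 0 < δ := by positivity
    obtain ⟨b01, b02, b03, b12, b13, b23, e1, e2⟩ := h (pi K v) (δ ^ t⁻¹) (by positivity)
    have ff : ∀ y : K, av (pi K v) y < δ ^ t⁻¹ → av v (algebraMap K L y) < δ := fun y hy => by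
      rw [← hv]
      have := Real.rpow_lt_rpow ((av (pi K v)).nonneg y) hy ht
      rwa [← Real.rpow_mul hδ0.le, inv_mul_cancel₀ ht.ne', Real.rpow_one] at this
    have g := idG (F := L) (a0 := algebraMap K L a0) (a1 := algebraMap K L a1) (a2 := algebraMap K L a2) (a3 := algebraMap K L a3)
      (b01 := algebraMap K L b01) (b02 := algebraMap K L b02) (b03 := algebraMap K L b03) (b12 := algebraMap K L b12)
      (b13 := algebraMap K L b13) (b23 := algebraMap K L b23) (w := w) (by simp [*]) (by simp [*]) (by simp [*]) (by simp [*]) (by simpa using hw)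
    refine ⟨algebraMap K L b23 + algebraMap K L b01 / (algebraMap K L a0 * algebraMap K L a1) * w,
      -algebraMap K L b13 + algebraMap K L b02 / (algebraMap K L a0 * algebraMap K L a2) * w,
      algebraMap K L b12 + algebraMap K L b03 / (algebraMap K L a0 * algebraMap K L a3) * w, lt_of_le_of_lt (le_of_eq (congrArg (av v) ?_)) (lt_of_le_of_lt ((av v).add_le
      (algebraMap K L (Q4 a0 a1 a2 a3 b01 b02 b03 b12 b13 b23 - p * (a0 * a1 * a2 * a3))) (2 * w * algebraMap K L (Pf b01 b23 b02 b13 b03 b12 - r))) ?_)⟩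
    · rw [map_mul, map_mul, map_mul, g]
      simp only [Q4, Pf, map_sub, map_add, map_mul, map_pow]
      ring
    · rw [map_mul (av v)]
      have q1 := ff _ e1
      have q2 := ff _ e2
      have : δ + av v (2 * w) * δ = ε / 2 := by rw [hδ]; field_simp
      have q3 := mul_le_mul_of_nonneg_left q2.le ((av v).nonneg (2 * w))
      linarith

theorem N4b {a0 a1 a2 a3 p q r : K} (h0 : a0 ≠ 0) (h1 : a1 ≠ 0) (h2 : a2 ≠ 0) (h3 : a3 ≠ 0)
    (hpq : p ^ 2 ≠ 4 * q) (hr : r ^ 2 = q * (a0 * a1 * a2 * a3))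
    (h : ∀ v : Pl K, ∀ ε > 0, ∃ b01 b02 b03 b12 b13 b23 : K, av v (Q4 a0 a1 a2 a3 b01 b02 b03 b12 b13 b23 - p * (a0 * a1 * a2 * a3)) < ε ∧
      av v (Pf b01 b23 b02 b13 b03 b12 - r) < ε) : ∃ b01 b02 b03 b12 b13 b23 : K, Q4 a0 a1 a2 a3 b01 b02 b03 b12 b13 b23 = p * (a0 * a1 * a2 * a3) ∧
      Pf b01 b23 b02 b13 b03 b12 = r := by
  have hA : a0 * a1 * a2 * a3 ≠ 0 := by simp [*]
  by_cases hs : IsSquare (a0 * a1 * a2 * a3)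
  · obtain ⟨w, hw⟩ := hs
    have hw0 : w ≠ 0 := by rintro rfl; exact hA (by rw [hw, mul_zero])
    obtain ⟨x, y, z, e⟩ := N4a (L := K) h0 h1 h2 h3 hpq hr h (w := w) (by rw [hw]; simp [pow_two])
    obtain ⟨x', y', z', e'⟩ := N4a (L := K) h0 h1 h2 h3 hpq hr h (w := -w) (by rw [hw]; simp [pow_two])
    simp only [Algebra.algebraMap_self, RingHom.id_apply] at e e'
    set b01 := a0 * a1 * ((x - x') / (2 * w)) with d01
    set b02 := a0 * a2 * ((y - y') / (2 * w)) with d02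
    set b03 := a0 * a3 * ((z - z') / (2 * w)) with d03
    have i1 := idG (b01 := b01) (b02 := b02) (b03 := b03) (b12 := (z + z') / 2) (b13 := -((y + y') / 2)) (b23 := (x + x') / 2) h0 h1 h2 h3 (w := w) (by rw [hw, pow_two])
    have i2 := idG (b01 := b01) (b02 := b02) (b03 := b03) (b12 := (z + z') / 2) (b13 := -((y + y') / 2)) (b23 := (x + x') / 2) h0 h1 h2 h3 (w := -w) (by rw [hw]; ring)
    rw [show (x + x') / 2 + b01 / (a0 * a1) * w = x by rw [d01]; field_simp; ring,
      show -(-((y + y') / 2)) + b02 / (a0 * a2) * w = y by rw [d02]; field_simp; ring,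
      show (z + z') / 2 + b03 / (a0 * a3) * w = z by rw [d03]; field_simp; ring, e] at i1
    rw [show (x + x') / 2 + b01 / (a0 * a1) * -w = x' by rw [d01]; field_simp; ring,
      show -(-((y + y') / 2)) + b02 / (a0 * a2) * -w = y' by rw [d02]; field_simp; ring,
      show (z + z') / 2 + b03 / (a0 * a3) * -w = z' by rw [d03]; field_simp; ring, e'] at i2
    refine ⟨b01, b02, b03, (z + z') / 2, -((y + y') / 2), (x + x') / 2, ?_, ?_⟩
    · linear_combination - (i1 + i2) / 2
    · refine mul_left_cancel₀ (mul_ne_zero (by norm_num : (4 : K) ≠ 0) hw0) ?_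
      linear_combination i2 - i1
  · obtain ⟨L, _, _, _, ⟨s⟩⟩ := QE_exists hs
    obtain ⟨x, y, z, e⟩ := N4a (L := L) h0 h1 h2 h3 hpq hr h s.hα
    obtain ⟨x0, x1, rfl⟩ := s.gen x
    obtain ⟨y0, y1, rfl⟩ := s.gen y
    obtain ⟨z0, z1, rfl⟩ := s.gen z
    have hα := s.hα
    refine ⟨a0 * a1 * x1, a0 * a2 * y1, a0 * a3 * z1, z0, -y0, x0, ?_⟩
    set Q := Q4 a0 a1 a2 a3 (a0 * a1 * x1) (a0 * a2 * y1) (a0 * a3 * z1) z0 (-y0) x0 with hQ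
    set P := Pf (a0 * a1 * x1) x0 (a0 * a2 * y1) (-y0) (a0 * a3 * z1) z0 with hP
    have e1 : algebraMap K L (Q - p * (a0 * a1 * a2 * a3)) = algebraMap K L (2 * (r - P)) * s.α := by
      rw [hQ, hP, Q4, Pf]
      simp only [map_sub, map_add, map_mul, map_pow, map_ofNat, map_neg] at e hα ⊢
      linear_combination e - (algebraMap K L a0 * algebraMap K L a1 * algebraMap K L x1 ^ 2 + algebraMap K L a0 * algebraMap K L a2 * algebraMap K L y1 ^ 2
        + algebraMap K L a0 * algebraMap K L a3 * algebraMap K L z1 ^ 2) * hα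
    have hB0 : 2 * (r - P) = 0 := by
      by_contra hne
      refine hs ⟨(Q - p * (a0 * a1 * a2 * a3)) / (2 * (r - P)), (algebraMap K L).injective ?_⟩
      have : algebraMap K L (2 * (r - P)) ≠ 0 := (_root_.map_ne_zero _).2 hne
      rw [← hα, map_mul, map_div₀, e1]
      field_simp
    rw [hB0, map_zero, zero_mul, map_eq_zero_iff _ (algebraMap K L).injective] at e1
    exact ⟨sub_eq_zero.1 e1, (sub_eq_zero.1 (by simpa using hB0)).symm⟩

end n4
end QC

namespace QC
section main
open NumberField Polynomial Matrix
variable {K : Type u} [Field K] [NumberField K]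

/-- local solvability -/
def LE (v : Pl K) (Q : (C : Type u) → [NormedField C] → (K →+* C) → Prop) : Prop :=
  ∃ (C : Type u) (_ : NormedField C) (i : K →+* C), DenseRange i ∧ (∀ x, ‖i x‖ = av v x) ∧ Q C i

theorem LE.mono {v : Pl K} {Q Q' : (C : Type u) → [NormedField C] → (K →+* C) → Prop} (h : LE v Q)
    (hQ : ∀ (C : Type u) [NormedField C] (i : K →+* C), Q C i → Q' C i) : LE v Q' := by
  obtain ⟨C, _, i, h1, h2, h3⟩ := h
  exact ⟨C, _, i, h1, h2, hQ C i h3⟩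

theorem N4 {a0 a1 a2 a3 p q : K} (h0 : a0 ≠ 0) (h1 : a1 ≠ 0) (h2 : a2 ≠ 0) (h3 : a3 ≠ 0) (hpq : p ^ 2 ≠ 4 * q)
    (h : ∀ v : Pl K, LE v fun C _ i => ∃ b01 b02 b03 b12 b13 b23, E4 (i a0) (i a1) (i a2) (i a3) (i p) (i q) b01 b02 b03 b12 b13 b23) :
    ∃ b01 b02 b03 b12 b13 b23, E4 a0 a1 a2 a3 p q b01 b02 b03 b12 b13 b23 := by
  obtain ⟨r, hr⟩ : IsSquare (q * (a0 * a1 * a2 * a3)) := GS fun v => by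
    obtain ⟨C, _, i, hd, hi, b01, b02, b03, b12, b13, b23, -, e⟩ := h v
    exact Sq_of_dense i hd hi (by rw [e]; simp)
  obtain ⟨b01, b02, b03, b12, b13, b23, e1, e2⟩ := N4b h0 h1 h2 h3 hpq (r := r) (by rw [hr, pow_two]) fun v ε hε => by
    obtain ⟨C, _, i, hd, hi, b01, b02, b03, b12, b13, b23, e1, e2⟩ := h v
    obtain ⟨c01, c02, c03, e3, e4⟩ : ∃ c01 c02 c03, Q4 (i a0) (i a1) (i a2) (i a3) c01 c02 c03 b12 b13 b23 = i (p * (a0 * a1 * a2 * a3)) ∧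
        Pf c01 b23 c02 b13 c03 b12 = i r := by
      have : Pf b01 b23 b02 b13 b03 b12 ^ 2 = i r ^ 2 := by
        rw [e2, ← map_pow, pow_two, ← hr]; simp
      rcases sq_eq_sq_iff_eq_or_eq_neg.1 this with h | h
      · exact ⟨b01, b02, b03, by rw [Q4, e1]; simp, h⟩
      · refine ⟨-b01, -b02, -b03, ?_, ?_⟩
        · rw [Q4]; simp only [neg_sq]; rw [e1]; simp
        · rw [Pf] at h ⊢; linear_combination -h
    obtain ⟨x, hx⟩ := apx hd hi (n := 6) (fun x => Q4 a0 a1 a2 a3 (x 0) (x 1) (x 2) (x 3) (x 4) (x 5)) (fun x => Pf (x 0) (x 5) (x 1) (x 4) (x 2) (x 3))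
      (fun x => Q4 (i a0) (i a1) (i a2) (i a3) (x 0) (x 1) (x 2) (x 3) (x 4) (x 5)) (fun x => Pf (x 0) (x 5) (x 1) (x 4) (x 2) (x 3))
      (by unfold Q4; fun_prop) (by unfold Pf; fun_prop) (by intro x; simp [Q4]) (by intro x; simp [Pf]) (y := ![c01, c02, c03, b12, b13, b23])
      e3 e4 hε
    exact ⟨_, _, _, _, _, _, hx⟩
  exact ⟨b01, b02, b03, b12, b13, b23, e1, by rw [e2, hr, pow_two]⟩

theorem two_ne {C : Type u} [NormedField C] (i : K →+* C) : (2 : C) ≠ 0 := by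
  rw [← map_ofNat i 2]; exact (_root_.map_ne_zero i).2 two_ne_zero

theorem MD {n : ℕ} {a : Fin n → K} (ha : ∀ i, a i ≠ 0) {m : K[X]} {C : Type u} [NormedField C] {i : K →+* C}
    (h : Sol ((diagonal a).map i) (m.map i)) : Sol (diagonal (i ∘ a)) (m.map i) ∧ ∃ b : Fin n → Fin n → C, (∀ i j, b j i = - b i j) ∧ 
      Polynomial.C (∏ k, i (a k)) * m.map i = (NN (i ∘ a) b).det := by
  rw [diagonal_map (map_zero i)] at h
  exact ⟨h, (Sol_diag (two_ne i) (fun k => (_root_.map_ne_zero i).2 (ha k))).1 h⟩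

theorem M2 {a : Fin 2 → K} (ha : ∀ i, a i ≠ 0) {m : K[X]} (hm : m.Monic) (hd : m.natDegree = 2)
    (h : ∀ v : Pl K, LE v fun F _ i => Sol ((diagonal a).map i) (m.map i)) : Sol (diagonal a) m := by
  have h' : ∀ v : Pl K, LE v fun F _ i => i (m.coeff 1) = 0 ∧ ∃ b, b ^ 2 = i (m.coeff 0 * (a 0 * a 1)) := fun v => (h v).mono fun F _ i h => by
    obtain ⟨-, b, hb, e⟩ := MD ha h
    rw [det2 _ b hb, Fin.prod_univ_two] at e
    have c1 := congrArg (coeff · 1) e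
    have c0 := congrArg (coeff · 0) e
    simp [-map_mul, -map_pow, coeff_C_mul, coeff_X_pow, coeff_C, ha] at c1 c0
    exact ⟨by simpa using c1, b 0 1, by simp only [map_mul]; linear_combination - c0⟩
  obtain ⟨F, _, i, -, -, h1, -⟩ := h' (Sum.inr (Classical.arbitrary _))
  rw [_root_.map_eq_zero] at h1
  obtain ⟨r, hr⟩ : IsSquare (m.coeff 0 * (a 0 * a 1)) := GS fun v => by
    obtain ⟨F, _, i, hd, hi, -, b, e⟩ := h' v
    exact Sq_of_dense i hd hi e
  have hm2 : m.coeff 2 = 1 := by rw [← hd]; exact hm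
  refine (Sol_diag two_ne_zero ha).2 ⟨![![0, r], ![-r, 0]], by simp [Fin.forall_fin_succ], ?_⟩
  rw [det2 _ _ (by simp [Fin.forall_fin_succ]), m.as_sum_range_C_mul_X_pow, hd]
  simp only [Finset.sum_range_succ, Finset.range_zero, Finset.sum_empty, h1, hm2, Fin.prod_univ_two]
  simp only [cons_val, pow_two r, ← hr, C_mul, C_0, C_1]
  ring

theorem M3 {a : Fin 3 → K} (ha : ∀ i, a i ≠ 0) {m : K[X]} (hm : m.Monic) (hd : m.natDegree = 3) (hs : Squarefree m)
    (h : ∀ v : Pl K, LE v fun F _ i => Sol ((diagonal a).map i) (m.map i)) : Sol (diagonal a) m := by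
  have h' : ∀ v : Pl K, LE v fun F _ i => (i (m.coeff 2) = 0 ∧ i (m.coeff 0) = 0) ∧ ∃ x y z, i (a 2) * x ^ 2 + i (a 1) * y ^ 2 + i (a 0) * z ^ 2 =
      i (m.coeff 1 * (a 0 * a 1 * a 2)) := fun v => (h v).mono fun F _ i h => by
    obtain ⟨-, b, hb, e⟩ := MD ha h
    rw [det3 _ b hb, Fin.prod_univ_three] at e
    have c2 := congrArg (coeff · 2) e
    have c1 := congrArg (coeff · 1) e
    have c0 := congrArg (coeff · 0) e
    simp [-map_add, -map_mul, coeff_C_mul, coeff_X, coeff_C, ha] at c2 c1 c0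
    exact ⟨⟨by simpa using c2, by simpa using c0⟩, b 0 1, b 0 2, b 1 2, by simp only [map_mul]; linear_combination - c1⟩
  obtain ⟨F, _, i, -, -, ⟨h2, h0⟩, -⟩ := h' (Sum.inr (Classical.arbitrary _))
  rw [_root_.map_eq_zero] at h0 h2
  have hm3 : m.coeff 3 = 1 := by rw [← hd]; exact hm
  have hmm : m = X ^ 3 + C (m.coeff 1) * X := by
    conv_lhs => rw [m.as_sum_range_C_mul_X_pow, hd]
    simp [Finset.sum_range_succ, h0, h2, hm3]; ring
  have hp : m.coeff 1 ≠ 0 := fun h0 => by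
    refine not_isUnit_X (hs X ⟨X, ?_⟩)
    rw [hmm, h0]; simp; ring
  obtain ⟨x, y, z, e⟩ := T3 (ha 2) (ha 1) (ha 0) (β := m.coeff 1 * (a 0 * a 1 * a 2)) (by simp [hp, ha]) fun v ε hε => by
    obtain ⟨F, _, i, hd, hi, -, x, y, z, e⟩ := h' v
    obtain ⟨t, ht, -⟩ := apx hd hi (n := 3) (fun x => a 2 * x 0 ^ 2 + a 1 * x 1 ^ 2 + a 0 * x 2 ^ 2) (fun x => 0)
      (fun x => i (a 2) * x 0 ^ 2 + i (a 1) * x 1 ^ 2 + i (a 0) * x 2 ^ 2) (fun x => 0) (by fun_prop) (by fun_prop)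
      (by simp) (by simp) (y := ![x, y, z]) e (β2 := 0) (by simp) hε
    exact ⟨_, _, _, ht⟩
  refine (Sol_diag two_ne_zero ha).2 ⟨![![0, x, y], ![-x, 0, z], ![-y, -z, 0]], by simp [Fin.forall_fin_succ], ?_⟩
  rw [det3 _ _ (by simp [Fin.forall_fin_succ]), Fin.prod_univ_three]
  conv_lhs => rw [hmm]
  have : x ^ 2 * a 2 + y ^ 2 * a 1 + z ^ 2 * a 0 = m.coeff 1 * (a 0 * a 1 * a 2) := by rw [← e]; ring
  simp only [cons_val]
  rw [this]; simp only [C_mul]; ring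

theorem sqf {p q : K} (hs : Squarefree (X ^ 4 + C p * X ^ 2 + C q)) : p ^ 2 ≠ 4 * q := fun h => by
  obtain ⟨t, rfl⟩ : ∃ t, p = 2 * t := ⟨p / 2, by ring⟩
  obtain rfl : q = t ^ 2 := by linear_combination -h / 4
  have hu := hs (X ^ 2 + C t) ⟨1, by simp only [C_mul, C_pow, map_ofNat]; ring⟩
  have := natDegree_eq_zero_of_isUnit hu
  rw [natDegree_X_pow_add_C] at this
  omega

theorem M4 {a : Fin 4 → K} (ha : ∀ i, a i ≠ 0) {m : K[X]} (hm : m.Monic) (hd : m.natDegree = 4) (hs : Squarefree m)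
    (h : ∀ v : Pl K, LE v fun F _ i => Sol ((diagonal a).map i) (m.map i)) : Sol (diagonal a) m := by
  have h' : ∀ v : Pl K, LE v fun F _ i => (i (m.coeff 3) = 0 ∧ i (m.coeff 1) = 0) ∧
      ∃ b01 b02 b03 b12 b13 b23, E4 (i (a 0)) (i (a 1)) (i (a 2)) (i (a 3)) (i (m.coeff 2)) (i (m.coeff 0)) b01 b02 b03 b12 b13 b23 :=
    fun v => (h v).mono fun F _ i h => by
    obtain ⟨-, b, hb, e⟩ := MD ha h
    rw [det4 _ b hb, Fin.prod_univ_four] at e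
    have c3 := congrArg (coeff · 3) e
    have c2 := congrArg (coeff · 2) e
    have c1 := congrArg (coeff · 1) e
    have c0 := congrArg (coeff · 0) e
    simp [-map_add, -map_mul, -map_pow, coeff_C_mul, coeff_X_pow, coeff_C, ha] at c3 c2 c1 c0
    exact ⟨⟨by simpa using c3, by simpa using c1⟩, b 0 1, b 0 2, b 0 3, b 1 2, b 1 3, b 2 3, by linear_combination - c2, by linear_combination - c0⟩
  obtain ⟨F, _, i, -, -, ⟨h3, h1⟩, -⟩ := h' (Sum.inr (Classical.arbitrary _))
  rw [_root_.map_eq_zero] at h1 h3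
  have hm4 : m.coeff 4 = 1 := by rw [← hd]; exact hm
  have hmm : m = X ^ 4 + C (m.coeff 2) * X ^ 2 + C (m.coeff 0) := by
    conv_lhs => rw [m.as_sum_range_C_mul_X_pow, hd]
    simp [Finset.sum_range_succ, h1, h3, hm4]; ring
  obtain ⟨b01, b02, b03, b12, b13, b23, e1, e2⟩ := N4 (ha 0) (ha 1) (ha 2) (ha 3) (sqf (by rw [← hmm]; exact hs)) fun v => (h' v).mono fun F _ i h => h.2
  refine (Sol_diag two_ne_zero ha).2 ⟨![![0, b01, b02, b03], ![-b01, 0, b12, b13], ![-b02, -b12, 0, b23], ![-b03, -b13, -b23, 0]], by simp [Fin.forall_fin_succ], ?_⟩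
  rw [det4 _ _ (by simp [Fin.forall_fin_succ]), Fin.prod_univ_four]
  conv_lhs => rw [hmm]
  simp only [cons_val]
  rw [e1, e2]; simp only [C_mul]; ring

theorem M5 {a : Fin 5 → K} (ha : ∀ i, a i ≠ 0) {m : K[X]} (hm : m.Monic) (hd : m.natDegree = 5) (hs : Squarefree m)
    (h : ∀ v : Pl K, LE v fun F _ i => Sol ((diagonal a).map i) (m.map i)) : Sol (diagonal a) m := by
  have h1 : m.coeff 4 = 0 ∧ m.coeff 2 = 0 ∧ m.coeff 0 = 0 := by
    obtain ⟨F, _, i, -, -, h⟩ := h (Sum.inr (Classical.arbitrary _))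
    obtain ⟨-, b, hb, e⟩ := MD ha h
    rw [det5 _ b hb, Fin.prod_univ_five] at e
    have c4 := congrArg (coeff · 4) e
    have c2 := congrArg (coeff · 2) e
    have c0 := congrArg (coeff · 0) e
    simp [-map_add, -map_mul, -map_pow, coeff_C_mul, coeff_X_pow, coeff_X, coeff_C, ha] at c4 c2 c0
    exact ⟨by simpa using c4, by simpa using c2, by simpa using c0⟩
  have hm5 : m.coeff 5 = 1 := by rw [← hd]; exact hm
  obtain ⟨p, q, hmm⟩ : ∃ p q, m = X ^ 5 + C p * X ^ 3 + C q * X := by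
    refine ⟨m.coeff 3, m.coeff 1, ?_⟩
    conv_lhs => rw [m.as_sum_range_C_mul_X_pow, hd]
    simp [Finset.sum_range_succ, h1, hm5]; ring
  have hmi : ∀ (F : Type u) [NormedField F] (i : K →+* F), m.map i = X ^ 5 + C (i p) * X ^ 3 + C (i q) * X := by
    intro F _ i; rw [hmm]; simp
  have hq : q ≠ 0 := fun h0 => by
    refine not_isUnit_X (hs X ⟨X ^ 3 + C p * X, ?_⟩)
    rw [hmm, h0]; simp; ring
  have hpq : p ^ 2 ≠ 4 * q := sqf (hs.squarefree_of_dvd ⟨X, by rw [hmm]; ring⟩)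
  have hμ : q * (a 0 * a 1 * a 2 * a 3 * a 4) ≠ 0 := by simp [*]
  obtain ⟨x0, x1, x2, x3, x4, e⟩ := T5 (ha 2) (ha 3) (ha 4) (a1 := a 0) (a2 := a 1) hμ fun v ε hε => by
    obtain ⟨F, _, i, hd, hi, h⟩ := h v
    obtain ⟨-, b, hb, e⟩ := MD ha h
    rw [hmi] at e
    obtain ⟨-, e⟩ := Sol5_coeff hb e
    obtain ⟨x0, x1, x2, x3, x4, e⟩ : ∃ x0 x1 x2 x3 x4, i (a 0) * x0 ^ 2 + i (a 1) * x1 ^ 2 + i (a 2) * x2 ^ 2 + i (a 3) * x3 ^ 2 + i (a 4) * x4 ^ 2 =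
      i (q * (a 0 * a 1 * a 2 * a 3 * a 4)) := 
      ⟨Pf (b 1 2) (b 3 4) (b 1 3) (b 2 4) (b 1 4) (b 2 3), Pf (b 0 2) (b 3 4) (b 0 3) (b 2 4) (b 0 4) (b 2 3),
        Pf (b 0 1) (b 3 4) (b 0 3) (b 1 4) (b 0 4) (b 1 3), Pf (b 0 1) (b 2 4) (b 0 2) (b 1 4) (b 0 4) (b 1 2),
        Pf (b 0 1) (b 2 3) (b 0 2) (b 1 3) (b 0 3) (b 1 2), by simp only [map_mul]; linear_combination e⟩
    obtain ⟨t, ht, -⟩ := apx hd hi (n := 5) (fun x => a 0 * x 0 ^ 2 + a 1 * x 1 ^ 2 + a 2 * x 2 ^ 2 + a 3 * x 3 ^ 2 + a 4 * x 4 ^ 2) (fun x => 0)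
      (fun x => i (a 0) * x 0 ^ 2 + i (a 1) * x 1 ^ 2 + i (a 2) * x 2 ^ 2 + i (a 3) * x 3 ^ 2 + i (a 4) * x 4 ^ 2) (fun x => 0) (by fun_prop) (by fun_prop)
      (by simp) (by simp) (y := ![x0, x1, x2, x3, x4]) e (β2 := 0) (by simp) hε
    exact ⟨_, _, _, _, _, ht⟩
  have he : ![x0, x1, x2, x3, x4] ⬝ᵥ diagonal a *ᵥ ![x0, x1, x2, x3, x4] = q * (a 0 * a 1 * a 2 * a 3 * a 4) := by
    rw [← e]
    simp only [dotProduct, mulVec_diagonal, Fin.sum_univ_five, cons_val]; ring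
  obtain ⟨P, d, hP, hd, hPd, hd4⟩ := DG2 two_ne_zero (A := diagonal a) (by simp) (by
    rw [det_diagonal]; exact Finset.prod_ne_zero_iff.2 fun i _ => ha i) (by rw [he]; exact hμ)
  rw [he] at hd4
  change d 4 = _ at hd4
  have hdet : d 0 * d 1 * d 2 * d 3 * d 4 = P.det ^ 2 * (a 0 * a 1 * a 2 * a 3 * a 4) := by
    have := congrArg Matrix.det hPd
    rw [det_mul, det_mul, det_transpose, det_diagonal, det_diagonal, Fin.prod_univ_five, Fin.prod_univ_five] at this
    rw [← this]; ring
  obtain ⟨b01, b02, b03, b12, b13, b23, e1, e2⟩ := N4 (hd 0) (hd 1) (hd 2) (hd 3) hpq fun v => (h v).mono fun F _ i h => by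
    have h2 := Sol_congr (P := P.map i) (by
      rw [← RingHom.mapMatrix_apply, ← RingHom.map_det]; exact (_root_.map_ne_zero i).2 hP) h
    rw [← transpose_map, ← Matrix.map_mul, ← Matrix.map_mul, hPd] at h2
    have h3 := (MD hd h2).1
    rw [hmi] at h3
    refine W5 (two_ne i) (a := i ∘ d) (fun k => (_root_.map_ne_zero i).2 (hd k)) (c := i P.det) ((map_ne_zero i).2 hP) ?_ h3
    simp only [Function.comp, ← map_mul, ← map_pow]
    rw [hdet, hd4]; congr 1; ring
  refine Sol_congr' hP ?_
  rw [hPd]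
  refine (Sol_diag two_ne_zero hd).2 ⟨![![0, b01, b02, b03, 0], ![-b01, 0, b12, b13, 0], ![-b02, -b12, 0, b23, 0], ![-b03, -b13, -b23, 0, 0], ![0, 0, 0, 0, 0]],
    by simp [Fin.forall_fin_succ], ?_⟩
  rw [det5 _ _ (by simp [Fin.forall_fin_succ]), Fin.prod_univ_five, hmm]
  simp only [cons_val]
  rw [Pf] at e2
  have e1' := congrArg C e1
  have e2' := congrArg C e2
  simp only [Pf, C_mul, C_add, C_sub, C_pow, C_0] at e1' e2' ⊢
  linear_combination -X ^ 3 * C (d 4) * e1' - X * C (d 4) * e2'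

theorem MM {n : ℕ} (hn : n ≤ 5) {A : Matrix (Fin n) (Fin n) K} (hA : A.IsSymm) (hA0 : A.det ≠ 0) {m : K[X]} (hm : m.Monic)
    (hd : m.natDegree = n) (hs : Squarefree m)
    (h : ∀ v : Pl K, LE v fun F _ i => Sol (A.map i) (m.map i)) : Sol A m := by
  obtain ⟨P, a, hP, ha, hPa⟩ := DG1 two_ne_zero hA hA0
  refine Sol_congr' hP ?_
  replace h : ∀ v : Pl K, LE v fun F _ i => Sol ((diagonal a).map i) (m.map i) := fun v => (h v).mono fun F _ i h => by
    have h2 := Sol_congr (P := P.map i) (by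
      rw [← RingHom.mapMatrix_apply, ← RingHom.map_det]; exact (_root_.map_ne_zero i).2 hP) h
    rwa [← transpose_map, ← Matrix.map_mul, ← Matrix.map_mul, hPa] at h2
  rw [hPa]
  match n, hn with
  | 0, _ => 
    refine ⟨0, by simp, ?_⟩
    rw [Monic.natDegree_eq_zero hm |>.1 hd]; simp
  | 1, _ =>
    obtain ⟨F, _, i, -, -, S, hS, e⟩ := h (Sum.inr (Classical.arbitrary _))
    refine ⟨0, by simp, ?_⟩
    have h0 := congrFun (congrFun hS 0) 0
    have h2 := two_ne i
    have : i (a 0) ≠ 0 := (_root_.map_ne_zero i).2 (ha 0)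
    have h00 : S 0 0 = 0 := by
      simp [Matrix.mul_apply] at h0
      have : 2 * (S 0 0 * i (a 0)) = 0 := by linear_combination h0
      simpa [*] using this
    refine Polynomial.map_injective i i.injective ?_
    rw [← e]
    simp [Matrix.charpoly, Matrix.charmatrix, h00]
  | 2, _ => exact M2 ha hm hd h
  | 3, _ => exact M3 ha hm hd hs h
  | 4, _ => exact M4 ha hm hd hs h
  | 5, _ => exact M5 ha hm hd hs h

end main
end QC

namespace QC
section top
open TensorProduct Polynomial
variable {K E : Type u} [Field K] [NumberField K] [CommRing E] [Algebra K E] [FiniteDimensional K E]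

theorem trσ {σ : E →ₐ[K] E} (hσ : ∀ x, σ (σ x) = x) :
    LinearMap.trace K E σ.toLinearMap + Module.finrank K E = 2 * Module.finrank K (LinearMap.ker (σ.toLinearMap - LinearMap.id)) := by
  have h : LinearMap.IsProj (LinearMap.ker (σ.toLinearMap - LinearMap.id)) ((2⁻¹ : K) • (σ.toLinearMap + LinearMap.id)) := by
    constructor
    · intro x
      simp only [LinearMap.mem_ker, LinearMap.sub_apply, LinearMap.smul_apply, LinearMap.add_apply, map_smul, LinearMap.id_apply, AlgHom.toLinearMap_apply, map_add, hσ]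
      rw [sub_add_sub_cancel, sub_self, smul_zero]
    · intro x hx
      have : σ x = x := by simpa [sub_eq_zero] using hx
      simp only [LinearMap.smul_apply, LinearMap.add_apply, LinearMap.id_apply, AlgHom.toLinearMap_apply, this, ← two_smul K x, smul_smul]
      norm_num
  have := h.trace
  rw [map_smul, map_add, LinearMap.trace_id, smul_eq_mul] at this
  rw [← this]; ring

theorem top0 [Algebra.Etale K E] {n : ℕ} (hdim : Module.finrank K E = n)
    (σ : E →ₐ[K] E) (hσ : ∀ x, σ (σ x) = x)
    (hfix : Module.finrank K (LinearMap.ker (σ.toLinearMap - LinearMap.id)) = (n + 1) / 2) :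
    ∃ (I : Type u) (_ : Fintype I) (φ : I → E →ₐ[K] AlgebraicClosure K) (s : E), Fintype.card I = n ∧ (∀ a, (∀ i, φ i a = 0) → a = 0) ∧
      σ s = -s ∧ Function.Injective fun i => φ i s := by
  classical
  set Ω := AlgebraicClosure K
  set e := Algebra.FormallyEtale.equivPiOfIsSepClosed Ω (Ω ⊗[K] E) with he
  set g : Ω ⊗[K] E →ₐ[Ω] Ω ⊗[K] E := Algebra.TensorProduct.map (AlgHom.id Ω Ω) σ with hg
  set τ : PrimeSpectrum (Ω ⊗[K] E) → PrimeSpectrum (Ω ⊗[K] E) := fun p => p.comap (g : Ω ⊗[K] E →+* Ω ⊗[K] E) with hτ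
  have hτe : ∀ x p, e x (τ p) = e (g x) p := fun x p => Algebra.FormallyEtale.equivPiOfIsSepClosed_comap g x p
  have : IsArtinianRing (Ω ⊗[K] E) := isArtinian_of_tower Ω inferInstance
  have : Fintype (PrimeSpectrum (Ω ⊗[K] E)) := Fintype.ofFinite _
  have hcard : Fintype.card (PrimeSpectrum (Ω ⊗[K] E)) = n := by
    have := e.toLinearEquiv.finrank_eq
    rw [Module.finrank_baseChange, hdim, Module.finrank_fintype_fun_eq_card] at this
    exact this.symm
  have htr : (((Finset.univ.filter fun i => τ i = i).card : ℕ) : Ω) = algebraMap K Ω (LinearMap.trace K E σ.toLinearMap) := by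
    rw [← LinearMap.trace_baseChange, ← LinearMap.trace_conj' (σ.toLinearMap.baseChange Ω) e.toLinearEquiv,
      LinearMap.trace_eq_matrix_trace Ω (Pi.basisFun Ω _), Matrix.trace, Finset.card_filter, Nat.cast_sum]
    refine Finset.sum_congr rfl fun i _ => ?_
    have hgb : ∀ x, σ.toLinearMap.baseChange Ω x = g x := fun x => rfl
    rw [Matrix.diag_apply, LinearMap.toMatrix_apply]
    simp only [Pi.basisFun_apply, Pi.basisFun_repr, LinearEquiv.conj_apply, LinearMap.comp_apply, LinearEquiv.coe_coe]
    rw [hgb]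
    change _ = e (g _) i
    rw [← hτe]
    change _ = e (e.symm _) _
    rw [e.apply_symm_apply, Pi.single_apply]
    simp
  have hle : (Finset.univ.filter fun i => τ i = i).card ≤ 1 := by
    have h2 := congrArg (algebraMap K Ω) (trσ hσ)
    rw [map_add, ← htr, hdim, hfix] at h2
    simp only [map_mul, map_natCast, map_ofNat] at h2
    have : CharZero Ω := charZero_of_injective_algebraMap (algebraMap K Ω).injective
    replace h2 : (Finset.univ.filter fun i => τ i = i).card + n = 2 * ((n + 1) / 2) :=
      Nat.cast_injective (R := Ω) (by rw [Nat.cast_add, Nat.cast_mul]; exact h2)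
    omega
  have hfx : ∀ i j, τ i = i → τ j = j → i = j := fun i j hi hj => Finset.card_le_one.1 hle i (by simpa using hi) j (by simpa using hj)
  set φ : PrimeSpectrum (Ω ⊗[K] E) → E →ₐ[K] Ω := fun p =>
    (((Pi.evalAlgHom Ω (fun _ => Ω) p).comp e.toAlgHom).restrictScalars K).comp Algebra.TensorProduct.includeRight with hφ
  have hφe : ∀ i a, φ i a = e (1 ⊗ₜ a) i := fun i a => rfl
  have hφσ : ∀ i a, φ i (σ a) = φ (τ i) a := fun i a => by
    rw [hφe, hφe, hτe, hg]; simp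
  -- key
  have key : ∀ i j, (∀ s, σ s = -s → φ i s = φ j s) → i = j := by
    intro i j h
    by_contra hij
    have h1 : ∀ x : Ω ⊗[K] E, e x i - e x (τ i) - e x j + e x (τ j) = 0 := by
      intro x
      induction x using TensorProduct.induction_on with
      | zero => simp
      | add x y hx hy => simp only [map_add, Pi.add_apply]; linear_combination hx + hy
      | tmul c a =>
        have := h (a - σ a) (by rw [map_sub, hσ]; ring)
        rw [map_sub, map_sub, hφσ, hφσ] at this
        rw [show c ⊗ₜ[K] a = c • ((1 : Ω) ⊗ₜ[K] a) by rw [smul_tmul', smul_eq_mul, mul_one]]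
        simp only [map_smul, Pi.smul_apply, smul_eq_mul, ← hφe]
        linear_combination c * this
    have h2 := h1 (e.symm (Pi.single i 1))
    have h3 := h1 (e.symm (Pi.single j 1))
    simp only [e.apply_symm_apply, Pi.single_apply, hij, Ne.symm hij, if_true, if_false] at h2 h3
    refine hij (hfx i j ?_ ?_)
    · by_contra hc
      rw [if_neg hc] at h2
      split_ifs at h2 <;> norm_num at h2
    · by_contra hc
      rw [if_neg hc] at h3
      split_ifs at h3 <;> norm_num at h3
  -- generic s
  set V : Submodule K E := LinearMap.ker (σ.toLinearMap + LinearMap.id) with hV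
  have hVm : ∀ s, s ∈ V ↔ σ s = -s := fun s => by simp [hV, eq_neg_iff_add_eq_zero]
  set W : PrimeSpectrum (Ω ⊗[K] E) × PrimeSpectrum (Ω ⊗[K] E) → Submodule K V := fun p => LinearMap.ker (((φ p.1).toLinearMap - (φ p.2).toLinearMap).comp V.subtype) with hW
  have hWm : ∀ p s, s ∈ W p ↔ φ p.1 s = φ p.2 s := fun p s => by simp [hW, sub_eq_zero]
  have hne := Subspace.biUnion_ne_univ_of_top_notMem (k := K) (E := V) (s := (Finset.univ.filter fun p => p.1 ≠ p.2).image W) (by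
    simp only [Finset.mem_image, Finset.mem_filter, Finset.mem_univ, true_and, not_exists, not_and]
    intro p hp ht
    refine hp (key _ _ fun s hs => ?_)
    exact (hWm p ⟨s, (hVm s).2 hs⟩).1 (by rw [ht]; trivial))
  obtain ⟨s, hs⟩ := (Set.ne_univ_iff_exists_notMem _).1 hne
  refine ⟨_, inferInstance, φ, s, hcard, fun a ha => ?_, (hVm _).1 s.2, fun i j hij => ?_⟩
  · have h1 : e (1 ⊗ₜ a) = 0 := funext fun i => ha i
    rw [map_eq_zero_iff _ e.injective] at h1
    exact Algebra.TensorProduct.includeRight_injective (A := Ω) (B := E) (R := K) (algebraMap K Ω).injective (by simpa using h1)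
  · by_contra hc
    refine hs ?_
    simp only [Set.mem_iUnion, Finset.mem_image, Finset.mem_filter, Finset.mem_univ, true_and, exists_prop]
    exact ⟨_, ⟨(i, j), hc, rfl⟩, (hWm (i, j) s).2 hij⟩

end top
end QC

namespace QC
section fin
open TensorProduct Polynomial Matrix

variable {K E : Type u} [Field K] [NumberField K] [CommRing E] [Algebra K E]

theorem locSol {n : ℕ} {σ : E →ₐ[K] E} {M : Matrix (Fin n) (Fin n) K} {s : E} (hs : σ s = -s) (pb : PowerBasis K E) (hg : pb.gen = s) (hpd : pb.dim = n)
    {F : Type u} [Field F] [Algebra K F] (h : CompatibleLocalEmbedding K E σ n M F) :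
    Sol (M.map (algebraMap K F)) ((minpoly K s).map (algebraMap K F)) := by
  obtain ⟨ι, hι, hc⟩ := h
  set T := ι (1 ⊗ₜ s) with hT
  refine ⟨LinearMap.toMatrix' T, ?_, ?_⟩
  · have h1 : ∀ x y, x ⬝ᵥ ((LinearMap.toMatrix' T)ᵀ * M.map (algebraMap K F)) *ᵥ y = x ⬝ᵥ (-(M.map (algebraMap K F) * LinearMap.toMatrix' T)) *ᵥ y := by
      intro x y
      have := hc (1 ⊗ₜ s) x y
      rw [Algebra.TensorProduct.map_tmul, hs, tmul_neg, map_neg, AlgHom.id_apply, ← hT] at this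
      rw [← mulVec_mulVec, dotProduct_mulVec, vecMul_transpose, LinearMap.toMatrix'_mulVec, this, neg_mulVec, ← mulVec_mulVec, LinearMap.toMatrix'_mulVec,
        LinearMap.neg_apply, mulVec_neg]
    ext i j
    have := h1 (Pi.single i 1) (Pi.single j 1)
    simpa using this
  · have hd : (minpoly K s).natDegree = n := by rw [← hg, pb.natDegree_minpoly, hpd]
    set m := (minpoly K s).map (algebraMap K F) with hm
    have hint : IsIntegral K s := hg ▸ pb.isIntegral_gen
    have hmd : m.natDegree = n := by rw [hm, natDegree_map, hd]
    have hmm : m.Monic := (minpoly.monic hint).map _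
    set c := (LinearMap.toMatrix' T).charpoly with hc
    have hcd : c.natDegree = n := by rw [hc, Matrix.charpoly_natDegree_eq_dim, Fintype.card_fin]
    have hcm : c.Monic := Matrix.charpoly_monic _
    have e1 : aeval ((1 : F) ⊗ₜ[K] s) m = 0 := by
      rw [hm, aeval_map_algebraMap]
      have := aeval_algHom_apply (Algebra.TensorProduct.includeRight : E →ₐ[K] F ⊗[K] E) s (minpoly K s)
      rw [minpoly.aeval, map_zero] at this
      exact this
    have e2 : aeval ((1 : F) ⊗ₜ[K] s) c = 0 := by
      refine hι ?_
      rw [map_zero, ← aeval_algHom_apply, ← hT, hc]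
      have := Matrix.aeval_self_charpoly (LinearMap.toMatrix' T)
      have h2 := aeval_algHom_apply (Matrix.toLinAlgEquiv' : Matrix (Fin n) (Fin n) F ≃ₐ[F] _) (LinearMap.toMatrix' T) c
      rw [this, map_zero] at h2
      rw [← h2]
      exact congrArg (fun t => aeval t c) (Matrix.toLin'_toMatrix' T).symm
    rw [aeval_eq_sum_range' (n := n + 1) (by omega), Finset.sum_range_succ] at e1 e2
    have hcn : c.coeff n = 1 := by rw [← hcd]; exact hcm
    have hmn : m.coeff n = 1 := by rw [← hmd]; exact hmm
    rw [hcn] at e2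
    rw [hmn] at e1
    have e3 : ∑ k : Fin n, (c.coeff k - m.coeff k) • ((1 : F) ⊗ₜ[K] s) ^ (k : ℕ) = 0 := by
      rw [Fin.sum_univ_eq_sum_range (fun k => (c.coeff k - m.coeff k) • ((1 : F) ⊗ₜ[K] s) ^ k)]
      simp only [sub_smul, Finset.sum_sub_distrib]
      linear_combination e2 - e1
    subst hpd
    have li : LinearIndependent F fun k : Fin pb.dim => ((1 : F) ⊗ₜ[K] s) ^ (k : ℕ) := by
      convert (Algebra.TensorProduct.basis F pb.basis).linearIndependent using 2 with k
      rw [Algebra.TensorProduct.basis_apply, pb.basis_eq_pow, hg, Algebra.TensorProduct.tmul_pow, one_pow]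
    have h0 := Fintype.linearIndependent_iff.1 li _ e3
    ext k
    rcases lt_trichotomy k pb.dim with h | rfl | h
    · exact sub_eq_zero.1 (h0 ⟨k, h⟩)
    · rw [hcn, hmn]
    · rw [coeff_eq_zero_of_natDegree_lt (by omega), coeff_eq_zero_of_natDegree_lt (by omega)]

theorem fin_norm (v : IsDedekindDomain.HeightOneSpectrum (NumberField.RingOfIntegers K)) (x : K) :
    ‖algebraMap K (v.adicCompletion K) x‖ = av (Sum.inl v) x :=
  NumberField.FinitePlace.norm_embedding v x

theorem finale [FiniteDimensional K E] [Algebra.Etale K E]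
    (n : ℕ) (hn : n ≤ 5) (hdim : Module.finrank K E = n)
    (σ : E →ₐ[K] E) (hσ : ∀ x, σ (σ x) = x)
    (hfix : Module.finrank K (LinearMap.ker (σ.toLinearMap - LinearMap.id)) = (n + 1) / 2)
    (M : Matrix (Fin n) (Fin n) K) (hMsym : M.IsSymm) (hMdet : M.det ≠ 0)
    (hfin : ∀ v : IsDedekindDomain.HeightOneSpectrum (NumberField.RingOfIntegers K),
      CompatibleLocalEmbedding K E σ n M (v.adicCompletion K))
    (hinf : ∀ v : NumberField.InfinitePlace K,
      CompatibleLocalEmbedding K E σ n M v.Completion) :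
    ∃ ι : E →ₐ[K] Module.End K (Fin n → K),
      Function.Injective ι ∧
        ∀ (a : E) (x y : Fin n → K),
          dotProduct (ι a x) (M.mulVec y) =
            dotProduct x (M.mulVec (ι (σ a) y)) := by
  obtain ⟨I, _, φ, s, hI, hφ0, hs, hinj⟩ := top0 hdim σ hσ hfix
  have hint : IsIntegral K s := Algebra.IsIntegral.isIntegral s
  have hmm := minpoly.monic hint
  set m := minpoly K s with hm
  have hr : ∀ i, (m.map (algebraMap K (AlgebraicClosure K))).eval (φ i s) = 0 := fun i => by
    rw [eval_map_algebraMap, aeval_algHom_apply, minpoly.aeval, map_zero]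
  have hdvd : (∏ i, (X - C (φ i s))) ∣ m.map (algebraMap K (AlgebraicClosure K)) := by
    refine Finset.prod_dvd_of_coprime (fun i _ j _ hij => ?_) fun i _ => dvd_iff_isRoot.2 (hr i)
    exact isCoprime_X_sub_C_of_isUnit_sub (sub_ne_zero.2 (hinj.ne hij)).isUnit
  have hpd : (∏ i, (X - C (φ i s))).natDegree = n := by
    rw [natDegree_finset_prod_X_sub_C_eq_card, Finset.card_univ, hI]
  have hle : m.natDegree ≤ n := by
    have := (linearIndependent_pow (K := K) s).fintype_card_le_finrank
    rwa [Fintype.card_fin, hdim] at this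
  have hdeg : m.natDegree = n := by
    have := natDegree_le_of_dvd hdvd (hmm.map _).ne_zero
    rw [hpd, natDegree_map] at this
    omega
  have heq : ∏ i, (X - C (φ i s)) = m.map (algebraMap K (AlgebraicClosure K)) :=
    (eq_of_monic_of_dvd_of_natDegree_le (monic_prod_of_monic _ _ fun i _ => monic_X_sub_C _) (hmm.map _) hdvd (by rw [hpd, natDegree_map]; exact hle)).symm
  have hsq : Squarefree m := by
    have h1 : (∏ i, (X - C (φ i s))).Separable := separable_prod_X_sub_C_iff.2 hinj
    rw [heq, separable_map] at h1
    exact h1.squarefree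
  have li := linearIndependent_pow (K := K) s
  let pb : PowerBasis K E := ⟨s, m.natDegree, basisOfLinearIndependentOfCardEqFinrank' _ li (by rw [Fintype.card_fin, hdim, hdeg]), by simp⟩
  have hpn : pb.dim = n := hdeg
  obtain ⟨S, hS, hSm⟩ : Sol M m := by
    refine MM hn hMsym hMdet hmm hdeg hsq fun v => ?_
    rcases v with v | w
    · exact ⟨v.adicCompletion K, inferInstance, algebraMap K _, v.denseRange_algebraMap K, fin_norm v, locSol hs pb rfl hpn (hfin v)⟩
    · exact ⟨w.Completion, inferInstance, algebraMap K _, inf_dense w, inf_norm w, locSol hs pb rfl hpn (hinf w)⟩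
  set T := Matrix.toLin' S with hT
  have hTm : aeval T m = 0 := by
    have := Matrix.aeval_self_charpoly S
    have h2 := aeval_algHom_apply (Matrix.toLinAlgEquiv' : Matrix (Fin n) (Fin n) K ≃ₐ[K] _) S m
    rw [← hSm, this, map_zero, hSm] at h2
    exact h2
  set ι := pb.lift T hTm with hι
  have hιs : ι s = T := pb.lift_gen T hTm
  refine ⟨ι, (injective_iff_map_eq_zero ι).2 fun a ha => hφ0 a fun i => ?_, fun a x y => ?_⟩
  · obtain ⟨P, hP⟩ := pb.exists_eq_aeval' a
    change a = aeval s P at hP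
    rw [hP, ← aeval_algHom_apply, hιs] at ha
    have hev : Module.End.HasEigenvalue (Matrix.toLin' (S.map (algebraMap K (AlgebraicClosure K)))) (φ i s) := by
      rw [Module.End.hasEigenvalue_iff_isRoot_charpoly, Matrix.charpoly_toLin', Matrix.charpoly_map, hSm]
      exact hr i
    obtain ⟨x, hx⟩ := hev.exists_hasEigenvector
    have h1 := Module.End.aeval_apply_of_hasEigenvector (p := P.map (algebraMap K (AlgebraicClosure K))) hx
    have h2 : aeval (Matrix.toLin' (S.map (algebraMap K (AlgebraicClosure K)))) (P.map (algebraMap K (AlgebraicClosure K))) = 0 := by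
      have h3 : aeval S P = 0 := by
        refine Matrix.toLin'.injective ?_
        have h2 := aeval_algHom_apply (Matrix.toLinAlgEquiv' : Matrix (Fin n) (Fin n) K ≃ₐ[K] _) S P
        rw [map_zero]; exact h2.symm.trans ha
      have h4 := aeval_algHom_apply (Algebra.ofId K (AlgebraicClosure K)).mapMatrix S P
      rw [h3, map_zero] at h4
      have h5 := aeval_algHom_apply (Matrix.toLinAlgEquiv' : Matrix (Fin n) (Fin n) (AlgebraicClosure K) ≃ₐ[AlgebraicClosure K] _)
        (S.map (algebraMap K (AlgebraicClosure K))) (P.map (algebraMap K (AlgebraicClosure K)))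
      refine h5.trans ?_
      rw [aeval_map_algebraMap]
      exact (congrArg _ h4).trans (map_zero _)
    rw [h2, LinearMap.zero_apply] at h1
    rw [hP, ← aeval_algHom_apply, ← eval_map_algebraMap]
    exact (smul_eq_zero.1 h1.symm).resolve_right hx.2
  · obtain ⟨P, rfl⟩ := pb.exists_eq_aeval' a
    change ι (aeval s P) x ⬝ᵥ M *ᵥ y = x ⬝ᵥ M *ᵥ ι (σ (aeval s P)) y
    have hbase : ∀ x y, ι s x ⬝ᵥ M *ᵥ y = x ⬝ᵥ M *ᵥ ι (σ s) y := by
      intro x y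
      rw [hs, map_neg, hιs, hT, LinearMap.neg_apply, toLin'_apply, toLin'_apply, mulVec_neg, mulVec_mulVec, ← neg_mulVec, ← hS, ← mulVec_mulVec,
        dotProduct_mulVec, dotProduct_mulVec, dotProduct_mulVec, vecMul_transpose]
    induction P using Polynomial.induction_on generalizing x y with
    | C c =>
      rw [aeval_C, AlgHom.commutes σ, AlgHom.commutes ι, Module.algebraMap_end_apply, Module.algebraMap_end_apply, smul_dotProduct, mulVec_smul, dotProduct_smul]
    | add p q hp hq => simp only [map_add, LinearMap.add_apply, add_dotProduct, mulVec_add, dotProduct_add, hp, hq]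
    | monomial k c ih =>
      rw [pow_succ, ← mul_assoc, map_mul (aeval s), aeval_X, map_mul ι, map_mul σ, mul_comm (σ _), map_mul ι, Module.End.mul_apply, Module.End.mul_apply, ih, hbase]

end fin
end QC

/-- Let `K` be a number field, `n ≤ 5`, `E` a finite étale commutative
`K`-algebra of dimension `n`, and `σ` a `K`-linear algebra involution of `E` with
`dim_K E^σ = ⌊(n+1)/2⌋`.  Let `f` be a nondegenerate symmetric bilinear form on `K^n`, with
symmetric Gram matrix `M` of nonzero determinant.  If for every place `v` of `K` — every finite
place (height-one prime of `𝓞_K`, with completion `K_v` the `v`-adic completion) and every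
archimedean (infinite) place (with completion `K_v = v.completion`) — there is an injective
`K_v`-algebra homomorphism `ι_v : E ⊗_K K_v → End_{K_v} (K_v^n)` compatible with `σ ⊗ id` and
`f_v`, then there is an injective `K`-algebra homomorphism `ι : E → End_K (K^n)` with
`f (ι a x, y) = f (x, ι (σ a) y)` for all `a ∈ E` and `x, y ∈ K^n`. -/
theorem statement15 {K E : Type u} [Field K] [NumberField K]
    [CommRing E] [Algebra K E] [FiniteDimensional K E] [Algebra.Etale K E]
    (n : ℕ) (hn : n ≤ 5) (hdim : Module.finrank K E = n)
    (σ : E →ₐ[K] E) (hσ : ∀ x, σ (σ x) = x)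
    (hfix : Module.finrank K (LinearMap.ker (σ.toLinearMap - LinearMap.id)) = (n + 1) / 2)
    (M : Matrix (Fin n) (Fin n) K) (hMsym : M.IsSymm) (hMdet : M.det ≠ 0)
    (hfin : ∀ v : IsDedekindDomain.HeightOneSpectrum (NumberField.RingOfIntegers K),
      CompatibleLocalEmbedding K E σ n M (v.adicCompletion K))
    (hinf : ∀ v : NumberField.InfinitePlace K,
      CompatibleLocalEmbedding K E σ n M v.Completion) :
    ∃ ι : E →ₐ[K] Module.End K (Fin n → K),
      Function.Injective ι ∧
        ∀ (a : E) (x y : Fin n → K),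
          dotProduct (ι a x) (M.mulVec y) =
            dotProduct x (M.mulVec (ι (σ a) y)) := by
  exact QC.finale n hn hdim σ hσ hfix M hMsym hMdet hfin hinf
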